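/- Let N ≥ 2, fix y ∈ ℝ^N, and let F be the unique holomorphic function on D_N = {(b,x) ∈ S_a × ℂ^N : max_{1≤j<k≤N} |Im(x_j−x_k)| < 2a − Re b} agreeing with J_N(b;x,y) for real x. Set a_s = min(a₊,a₋), s_δ(z) = sinh(πz/a_δ) and e_δ(z) = exp(πz/a_δ) for δ ∈ {+,−} (a_+ = a₊, a_− = a₋), and let a_{−δ} denote a₋ when δ = + and a₊ when δ = −. Then for all (b,x) with Re b ∈ (0,a_s) and max_{j<k}|Im(x_j−x_k)| < a_s − Re b, such that s_δ(x_m−x_n) ≠ 0 for all m ≠ n, and for every k = 1,…,N and δ ∈ {+,−}: Σ_{I⊆{1,…,N}, |I|=k} ∏_{m∈I, n∉I} ( s_δ(x_m−x_n−ib)/s_δ(x_m−x_n) ) · F(b, x − i a_{−δ} χ_I) = e_k( e_δ(2y₁), …, e_δ(2y_N) ) · F(b,x), where χ_I ∈ {0,1}^N is the indicator vector of I and e_k is the k-th elementary symmetric polynomial in N variables. -/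

import Mathlib

open MeasureTheory Complex

/-- `α = 2π/(a₊a₋)`. -/
noncomputable def alphaPar (ap am : ℝ) : ℝ := 2 * Real.pi / (ap * am)

/-- The function `g(a₊,a₋;z)` from the integral representation of the hyperbolic gamma
function. -/
noncomputable def ghyp (ap am : ℝ) (z : ℂ) : ℂ :=
  ∫ y in Set.Ioi (0 : ℝ),
    (1 / (y : ℂ)) *
      (Complex.sin (2 * (y : ℂ) * z) /
          (2 * Complex.sinh ((ap : ℂ) * (y : ℂ)) * Complex.sinh ((am : ℂ) * (y : ℂ))) -
        z / ((ap : ℂ) * (am : ℂ) * (y : ℂ)))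

/-- The hyperbolic gamma function `G(a₊,a₋;z) = exp(i g(a₊,a₋;z))`. -/
noncomputable def Ghyp (ap am : ℝ) (z : ℂ) : ℂ := Complex.exp (Complex.I * ghyp ap am z)

/-- The weight-function building block
`w(b;t) = 4 sinh²(πt/a₋) ∏_{δ=±1} G(δt + i(a₋−a₊)/2)/G(δt + ia − ib)`. -/
noncomputable def wfun (ap am : ℝ) (b : ℂ) (t : ℝ) : ℂ :=
  ((4 * Real.sinh (Real.pi * t / am) ^ 2 : ℝ) : ℂ) *
    ((Ghyp ap am ((t : ℂ) + Complex.I * ((am - ap : ℝ) : ℂ) / 2) /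
        Ghyp ap am ((t : ℂ) + Complex.I * (((ap + am) / 2 : ℝ) : ℂ) - Complex.I * b)) *
      (Ghyp ap am (-(t : ℂ) + Complex.I * ((am - ap : ℝ) : ℂ) / 2) /
        Ghyp ap am (-(t : ℂ) + Complex.I * (((ap + am) / 2 : ℝ) : ℂ) - Complex.I * b)))

/-- The kernel-function factor `G(w−ib/2)/G(w+ib/2)`. -/
noncomputable def rker (ap am : ℝ) (b : ℂ) (w : ℂ) : ℂ :=
  Ghyp ap am (w - Complex.I * b / 2) / Ghyp ap am (w + Complex.I * b / 2)

/-- The recursively defined joint eigenfunctions: `J₁(b;x,y) = exp(iαxy)` and, for `N ≥ 2`,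
`J_N(b;x,y) = (exp(iαy_N(x₁+⋯+x_N))/(N−1)!) ∫_{ℝ^{N−1}} W_{N−1}(b;z) 𝒮_N^♯(b;x,z)
J_{N−1}(b;z,(y₁−y_N,…,y_{N−1}−y_N)) dz`. -/
noncomputable def Jrec (ap am : ℝ) (b : ℂ) : (N : ℕ) → (Fin N → ℝ) → (Fin N → ℝ) → ℂ
  | 0, _, _ => 1
  | 1, x, y => Complex.exp (Complex.I * (alphaPar ap am : ℂ) * (x 0 : ℂ) * (y 0 : ℂ))
  | (N + 2), x, y =>
      (Complex.exp (Complex.I * (alphaPar ap am : ℂ) * (y (Fin.last (N + 1)) : ℂ) *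
          ∑ j : Fin (N + 2), (x j : ℂ)) / (Nat.factorial (N + 1) : ℂ)) *
        ∫ z : Fin (N + 1) → ℝ,
          (∏ q ∈ Finset.univ.filter (fun q : Fin (N + 1) × Fin (N + 1) => q.1 < q.2),
            wfun ap am b (z q.1 - z q.2)) *
          (∏ j : Fin (N + 2), ∏ k : Fin (N + 1), rker ap am b ((x j : ℂ) - (z k : ℂ))) *
          Jrec ap am b (N + 1) z
            (fun j => y (Fin.castSucc j) - y (Fin.last (N + 1)))

/-- The domain `D_N = {(b,x) ∈ S_a × ℂ^N : max_{j<k}|Im(x_j−x_k)| < 2a − Re b}`. -/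
def DN (ap am : ℝ) (N : ℕ) : Set (ℂ × (Fin N → ℂ)) :=
  {p | (0 < p.1.re ∧ p.1.re < ap + am) ∧
    ∀ j k : Fin N, |(p.2 j - p.2 k).im| < ap + am - p.1.re}


open Filter Topology Set in
theorem hol_param {α : Type*} [MeasurableSpace α] {μ : Measure α} {U : Set ℂ} (hU : IsOpen U)
    {h : ℂ → α → ℂ} (hm : ∀ ζ ∈ U, AEStronglyMeasurable (h ζ) μ)
    (hd : ∀ a, DifferentiableOn ℂ (fun ζ => h ζ a) U)
    (hb : ∀ ζ₀ ∈ U, ∃ r > 0, ∃ g : α → ℝ, Integrable g μ ∧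
      ∀ᵐ a ∂μ, ∀ ζ ∈ U, ‖ζ - ζ₀‖ < r → ‖h ζ a‖ ≤ g a) :
    DifferentiableOn ℂ (fun ζ => ∫ a, h ζ a ∂μ) U := by
  intro ζ₀ hζ₀
  obtain ⟨r, hr, g, hg, hb⟩ := hb ζ₀ hζ₀
  obtain ⟨s, hs, hsU⟩ := Metric.isOpen_iff.1 hU ζ₀ hζ₀
  set R := min r s / 2 with hR
  have hR0 : 0 < R := by positivity
  have hRr : R + R ≤ r := by have := min_le_left r s; linarith
  have hRs : R + R ≤ s := by have := min_le_right r s; linarith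
  have hsub : ∀ ζ, ‖ζ - ζ₀‖ < R + R → ζ ∈ U := fun ζ hζ => hsU (by
    rw [Metric.mem_ball, dist_eq_norm]; linarith)
  have hderiv : ∀ a, ∀ ζ ∈ U, HasDerivAt (fun ζ => h ζ a) (deriv (fun ζ => h ζ a) ζ) ζ :=
    fun a ζ hζ => ((hd a).differentiableAt (hU.mem_nhds hζ)).hasDerivAt
  have key := hasDerivAt_integral_of_dominated_loc_of_deriv_le (μ := μ) (F := h)
    (F' := fun ζ a => deriv (fun ζ => h ζ a) ζ) (x₀ := ζ₀) (s := Metric.ball ζ₀ (R/2))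
    (bound := fun a => g a / (R/2)) (Metric.ball_mem_nhds _ (by positivity)) ?_ ?_ ?_ ?_ ?_ ?_
  · exact key.2.differentiableAt.differentiableWithinAt
  · filter_upwards [hU.mem_nhds hζ₀] with ζ hζ using hm ζ hζ
  · refine hg.mono' (hm _ hζ₀) ?_
    filter_upwards [hb] with a ha using ha _ hζ₀ (by simpa using hr)
  · have hu : Tendsto (fun n : ℕ => ζ₀ + ((R / ((n:ℝ) + 1) : ℝ) : ℂ)) atTop (𝓝 ζ₀) := by
      have h1 : Tendsto (fun n : ℕ => R / ((n:ℝ) + 1)) atTop (𝓝 0) :=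
        tendsto_const_div_atTop_nhds_zero_nat R |>.comp (tendsto_add_atTop_nat 1) |>.congr
          (fun n => by simp)
      have h2 : Tendsto (fun n : ℕ => ((R / ((n:ℝ) + 1) : ℝ) : ℂ)) atTop (𝓝 0) := by
        have := (continuous_ofReal.tendsto 0).comp h1
        rwa [ofReal_zero] at this
      simpa using h2.const_add ζ₀
    have hu2 : Tendsto (fun n : ℕ => ζ₀ + ((R / ((n:ℝ) + 1) : ℝ) : ℂ)) atTop (𝓝[≠] ζ₀) := by
      refine tendsto_nhdsWithin_iff.2 ⟨hu, Eventually.of_forall fun n => ?_⟩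
      have : R / ((n:ℝ)+1) ≠ 0 := by positivity
      simp only [mem_compl_iff, mem_singleton_iff, add_eq_left]
      exact_mod_cast this
    refine aestronglyMeasurable_of_tendsto_ae atTop (f := fun (n : ℕ) a =>
      slope (fun ζ => h ζ a) ζ₀ (ζ₀ + ((R / ((n:ℝ) + 1) : ℝ) : ℂ))) (fun n => ?_) ?_
    · have hin : ζ₀ + ((R / ((n:ℝ) + 1) : ℝ) : ℂ) ∈ U := by
        apply hsub
        rw [add_sub_cancel_left, Complex.norm_real, Real.norm_of_nonneg (by positivity)]
        have : R / ((n:ℝ)+1) ≤ R := div_le_self hR0.le (by linarith [Nat.cast_nonneg (α := ℝ) n])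
        linarith
      simp only [slope, vsub_eq_sub]
      exact ((hm _ hin).sub (hm _ hζ₀)).const_smul
        ((ζ₀ + ((R / ((n:ℝ) + 1) : ℝ) : ℂ) - ζ₀)⁻¹)
    · refine Eventually.of_forall fun a => ?_
      exact (hasDerivAt_iff_tendsto_slope.1 (hderiv a ζ₀ hζ₀)).comp hu2
  · filter_upwards [hb] with a ha ζ hζ
    rw [Metric.mem_ball, dist_eq_norm] at hζ
    refine Complex.norm_deriv_le_of_forall_mem_sphere_norm_le (by positivity) ?_ ?_
    · refine ((hd a).mono ?_).diffContOnCl_ball (U := Metric.ball ζ₀ (R+R)) ?_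
      · intro z hz; exact hsub z (by simpa [dist_eq_norm] using hz)
      · intro z hz
        rw [Metric.mem_closedBall, dist_eq_norm] at hz
        rw [Metric.mem_ball, dist_eq_norm]
        calc ‖z - ζ₀‖ = ‖(z - ζ) + (ζ - ζ₀)‖ := by ring_nf
          _ ≤ _ := norm_add_le _ _
          _ < _ := by linarith
    · intro z hz
      rw [mem_sphere_iff_norm] at hz
      have : ‖z - ζ₀‖ < R + R := by
        calc ‖z - ζ₀‖ = ‖(z - ζ) + (ζ - ζ₀)‖ := by ring_nf
          _ ≤ _ := norm_add_le _ _
          _ < _ := by linarith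
      exact ha z (hsub z this) (by linarith)
  · exact hg.div_const _
  · exact Eventually.of_forall fun a ζ hζ => hderiv a ζ (hsub ζ (by
      rw [Metric.mem_ball, dist_eq_norm] at hζ; linarith))

/-- identity along a horizontal strip: holomorphic and vanishing on the reals -/
theorem strip_id {σ τ : ℝ} (hσ : σ < 0) (hτ : 0 < τ) {f : ℂ → ℂ}
    (hf : DifferentiableOn ℂ f {z | σ < z.im ∧ z.im < τ})
    (h0 : ∃ᶠ t : ℝ in nhdsWithin 0 {0}ᶜ, f t = 0) : ∀ z : ℂ, σ < z.im → z.im < τ → f z = 0 := by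
  have hop : IsOpen {z : ℂ | σ < z.im ∧ z.im < τ} :=
    (isOpen_lt continuous_const Complex.continuous_im).inter
      (isOpen_lt Complex.continuous_im continuous_const)
  have hconv : Convex ℝ {z : ℂ | σ < z.im ∧ z.im < τ} := by
    have : {z : ℂ | σ < z.im ∧ z.im < τ} = Complex.imLm ⁻¹' (Set.Ioo σ τ) := by
      ext z; simp
    rw [this]
    exact (convex_Ioo σ τ).linear_preimage _
  have hA := hf.analyticOnNhd hop
  have := hA.eqOn_zero_of_preconnected_of_frequently_eq_zero hconv.isPreconnected
    (z₀ := 0) (by simp [hσ, hτ]) ?_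
  · intro z h1 h2; exact this ⟨h1, h2⟩
  · have ht : Filter.Tendsto (fun t : ℝ => (t : ℂ)) (nhdsWithin 0 {0}ᶜ) (nhdsWithin 0 {0}ᶜ) := by
      refine tendsto_nhdsWithin_iff.2 ⟨?_, ?_⟩
      · have := (Complex.continuous_ofReal.tendsto 0)
        simpa using this.mono_left nhdsWithin_le_nhds
      · filter_upwards [self_mem_nhdsWithin] with t ht
        simpa using ht
    exact ht.frequently h0


theorem norm_cos_le_exp (v : ℂ) : ‖Complex.cos v‖ ≤ Real.exp |v.im| := by
  rw [Complex.cos]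
  calc ‖(exp (v * I) + exp (-v * I)) / 2‖ ≤ (‖exp (v * I)‖ + ‖exp (-v * I)‖) / 2 := by
        rw [norm_div]; simp only [RCLike.norm_ofNat]; gcongr; exact norm_add_le _ _
    _ ≤ (Real.exp |v.im| + Real.exp |v.im|) / 2 := by
        rw [Complex.norm_exp, Complex.norm_exp]
        gcongr <;> simp [neg_le_abs, le_abs_self]
    _ = _ := by ring

theorem norm_sin_le_exp (v : ℂ) : ‖Complex.sin v‖ ≤ Real.exp |v.im| := by
  have := norm_cos_le_exp (v - Real.pi / 2)
  rw [Complex.cos_sub_pi_div_two] at this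
  have h : (v - Real.pi / 2).im = v.im := by
    have : ((Real.pi : ℂ) / 2) = ((Real.pi / 2 : ℝ) : ℂ) := by push_cast; rfl
    rw [this, Complex.sub_im, Complex.ofReal_im, sub_zero]
  rwa [h] at this

theorem convex_imband (ρ : ℝ) : Convex ℝ {z : ℂ | |z.im| ≤ ρ} := by
  have : {z : ℂ | |z.im| ≤ ρ} = Complex.imLm ⁻¹' (Set.Icc (-ρ) ρ) := by
    ext z; simp [abs_le]
  rw [this]
  exact (convex_Icc _ _).linear_preimage _

theorem norm_sin_le_mul (v : ℂ) : ‖Complex.sin v‖ ≤ ‖v‖ * Real.exp |v.im| := by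
  have := (convex_imband |v.im|).norm_image_sub_le_of_norm_hasDerivWithin_le
    (f := Complex.sin) (f' := Complex.cos) (C := Real.exp |v.im|) (x := 0) (y := v)
    (fun x _ => (Complex.hasDerivAt_sin x).hasDerivWithinAt)
    (fun x hx => (norm_cos_le_exp x).trans (Real.exp_le_exp.2 hx))
    (show |(0:ℂ).im| ≤ |v.im| by simp) (show |v.im| ≤ |v.im| from le_rfl)
  simpa [mul_comm] using this

theorem norm_one_sub_cos_le (v : ℂ) : ‖1 - Complex.cos v‖ ≤ ‖v‖ ^ 2 * Real.exp |v.im| := by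
  have h : 1 - Complex.cos v = 2 * Complex.sin (v / 2) ^ 2 := by
    have := Complex.cos_sq (v/2)
    have h2 := Complex.sin_sq_add_cos_sq (v/2)
    rw [mul_div_cancel₀ v two_ne_zero] at this
    linear_combination -2 * h2 + 2 * this
  rw [h, norm_mul, norm_pow]
  have := norm_sin_le_mul (v/2)
  have him : (v/2).im = v.im / 2 := by simp
  rw [him, abs_div, norm_div] at this
  simp only [RCLike.norm_ofNat, abs_two] at this ⊢
  calc 2 * ‖Complex.sin (v/2)‖ ^ 2 ≤ 2 * (‖v‖ / 2 * Real.exp (|v.im| / 2)) ^ 2 := by gcongr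
    _ = ‖v‖^2/2 * (Real.exp (|v.im| / 2) ^ 2) := by ring
    _ = ‖v‖^2/2 * Real.exp |v.im| := by rw [← Real.exp_nat_mul]; congr 2; push_cast; ring
    _ ≤ _ := by gcongr; linarith [sq_nonneg ‖v‖]

theorem inv_sinh_le {x : ℝ} (hx : 0 < x) : (Real.sinh x)⁻¹ ≤ Real.exp (-x) * (2 + 1 / x) := by
  have hs : 0 < Real.sinh x := Real.sinh_pos_iff.2 hx
  rw [inv_le_iff_one_le_mul₀ hs]
  have h1 : 1 + 2 * x ≤ Real.exp (2 * x) := by linarith [Real.add_one_le_exp (2*x)]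
  have h2 : Real.exp (2*x) = Real.exp x * Real.exp x := by rw [← Real.exp_add]; ring_nf
  have h3 : Real.exp (-x) * Real.exp x = 1 := by rw [← Real.exp_add]; simp
  have h4 : Real.exp (-x) * (2 + 1/x) * Real.sinh x
      = (2 + 1/x) * (1 - Real.exp (-x)^2) / 2 := by
    rw [Real.sinh_eq]; linear_combination ((2 + 1/x) / 2) * h3
  rw [h4]
  have h5 : Real.exp (-x)^2 * (1 + 2*x) ≤ 1 := by
    calc Real.exp (-x)^2 * (1 + 2*x) ≤ Real.exp (-x)^2 * (Real.exp x * Real.exp x) := by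
          rw [← h2]; gcongr
      _ = (Real.exp (-x) * Real.exp x)^2 := by ring
      _ = 1 := by rw [h3]; norm_num
  have h6 : (2 + 1/x) = (1 + 2*x)/x := by field_simp; ring
  rw [h6, div_mul_eq_mul_div, div_div, le_div_iff₀ (by positivity)]
  nlinarith

theorem norm_sinh_real {D y : ℝ} (hD : 0 < D) (hy : 0 < y) :
    ‖Complex.sinh ((D:ℂ) * (y:ℂ))‖ = Real.sinh (D * y) := by
  rw [← Complex.ofReal_mul, ← Complex.ofReal_sinh, Complex.norm_real, Real.norm_of_nonneg]
  exact (Real.sinh_pos_iff.2 (by positivity)).le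

theorem sinh_real_ne {D y : ℝ} (hD : 0 < D) (hy : 0 < y) :
    Complex.sinh ((D:ℂ) * (y:ℂ)) ≠ 0 := by
  rw [← norm_pos_iff, norm_sinh_real hD hy]; exact Real.sinh_pos_iff.2 (by positivity)

open Filter Topology Asymptotics in
theorem integrable_tool {f : ℝ → ℂ} (hc : ContinuousOn f (Set.Ioi 0))
    (h0 : f =O[𝓝[>] 0] (fun _ => (1:ℝ))) (h1 : f =O[atTop] (fun y : ℝ => y ^ (-2:ℝ))) :
    IntegrableOn f (Set.Ioi 0) := by
  have := mellinConvergent_of_isBigO_rpow (s := 1) (a := 2) (b := 0) (f := f)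
    (hc.locallyIntegrableOn measurableSet_Ioi) h1 (by simp) (by simpa using h0) (by simp)
  simpa [MellinConvergent] using this

theorem tan_series {x : ℂ} (h1 : x ∈ Complex.integerComplement)
    (h2 : 2 * x ∈ Complex.integerComplement) (hsin : Complex.sin (Real.pi * x) ≠ 0)
    (hcos : Complex.cos (Real.pi * x) ≠ 0) :
    HasSum (fun k : ℕ => 8 * x / ((2 * (k:ℂ) + 1) ^ 2 - 4 * x ^ 2))
      (Real.pi * Complex.tan (Real.pi * x)) := by
  have e1 := cot_series_rep' h1
  have e2 := cot_series_rep' h2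
  have s1 := summable_cotTerm h1
  have s2 := summable_cotTerm h2
  simp only [cotTerm] at s1 s2
  have hodd : ∀ k : ℕ, (1 / (2 * x - (((2 * k + 1 : ℕ) : ℂ) + 1)) +
      1 / (2 * x + (((2 * k + 1 : ℕ) : ℂ) + 1))) =
      (1/2) * (1 / (x - ((k:ℂ) + 1)) + 1 / (x + ((k:ℂ) + 1))) := by
    intro k
    have a1 : 2 * x - (((2 * k + 1 : ℕ) : ℂ) + 1) = 2 * (x - (k + 1)) := by push_cast; ring
    have a2 : 2 * x + (((2 * k + 1 : ℕ) : ℂ) + 1) = 2 * (x + (k + 1)) := by push_cast; ring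
    rw [a1, a2]; simp only [one_div, mul_inv]; ring
  have heven : ∀ k : ℕ, (1 / (2 * x - (((2 * k : ℕ) : ℂ) + 1)) +
      1 / (2 * x + (((2 * k : ℕ) : ℂ) + 1))) =
      (-1/2) * (8 * x / ((2 * (k:ℂ) + 1) ^ 2 - 4 * x ^ 2)) := by
    intro k
    have n1 : 2 * x - (2 * (k:ℂ) + 1) ≠ 0 := by
      intro h
      apply h2
      exact ⟨2 * k + 1, by push_cast; linear_combination -h⟩
    have n2 : 2 * x + (2 * (k:ℂ) + 1) ≠ 0 := by
      intro h
      apply h2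
      exact ⟨-(2 * k + 1), by push_cast; linear_combination -h⟩
    have n3 : (2 * (k:ℂ) + 1) ^ 2 - 4 * x ^ 2 =
        -((2 * x - (2 * (k:ℂ) + 1)) * (2 * x + (2 * (k:ℂ) + 1))) := by ring
    rw [n3]
    push_cast
    field_simp
    ring
  have sE : Summable (fun k : ℕ => (1 / (2 * x - (((2 * k : ℕ) : ℂ) + 1)) +
      1 / (2 * x + (((2 * k : ℕ) : ℂ) + 1)))) :=
    s2.comp_injective (i := fun k : ℕ => 2 * k) (fun a b h => by simpa using h)
  have sO : Summable (fun k : ℕ => (1 / (2 * x - (((2 * k + 1 : ℕ) : ℂ) + 1)) +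
      1 / (2 * x + (((2 * k + 1 : ℕ) : ℂ) + 1)))) :=
    s2.comp_injective (i := fun k : ℕ => 2 * k + 1) (fun a b h => by simpa using h)
  have hsplit := tsum_even_add_odd (f := fun n : ℕ => 1 / (2 * x - ((n : ℂ) + 1)) +
      1 / (2 * x + ((n : ℂ) + 1))) sE sO
  rw [← e2, tsum_congr hodd, tsum_mul_left, ← e1, tsum_congr heven, tsum_mul_left] at hsplit
  have hS : Summable (fun k : ℕ => 8 * x / ((2 * (k:ℂ) + 1) ^ 2 - 4 * x ^ 2)) := by
    have := (sE.congr (fun k => heven k)).mul_left (-2)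
    refine this.congr fun k => by ring
  have hval : Real.pi * Complex.tan (Real.pi * x) =
      ∑' k : ℕ, 8 * x / ((2 * (k:ℂ) + 1) ^ 2 - 4 * x ^ 2) := by
    have hx0 : x ≠ 0 := by rintro rfl; simp at hsin
    have hc2 : Complex.cot (Real.pi * (2 * x)) =
        (Complex.cot (Real.pi * x) - Complex.tan (Real.pi * x)) / 2 := by
      have : (Real.pi:ℂ) * (2 * x) = 2 * (Real.pi * x) := by ring
      rw [this, Complex.cot, Complex.cot, Complex.tan, Complex.sin_two_mul, Complex.cos_two_mul']
      field_simp
    rw [hc2] at hsplit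
    linear_combination 2 * hsplit
  rw [hval]; exact hS.hasSum


theorem int_y_exp {m : ℝ} (hm : 0 < m) :
    IntegrableOn (fun y : ℝ => y * Real.exp (-(m * y))) (Set.Ioi 0) ∧
    ∫ y in Set.Ioi (0:ℝ), y * Real.exp (-(m * y)) = 1 / m ^ 2 := by
  constructor
  · have := integrableOn_rpow_mul_exp_neg_mul_rpow (p := 1) (s := 1) (b := m) (by norm_num)
      (by norm_num) hm
    simpa using this
  · have := Real.integral_rpow_mul_exp_neg_mul_Ioi (a := 2) (r := m) (by norm_num) hm
    norm_num at this
    rw [this]; simp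

theorem sin_exp_integral {w : ℂ} {m : ℝ} (h : 2 * |w.im| < m) :
    ∫ y in Set.Ioi (0:ℝ), Complex.sin (2 * (y:ℂ) * w) * Complex.exp (-((m:ℂ) * (y:ℂ))) =
      2 * w / ((m:ℂ) ^ 2 + 4 * w ^ 2) := by
  have hw1 := le_abs_self w.im
  have hw2 := neg_abs_le w.im
  have r1 : (-2 * I * w - m).re < 0 := by simp; linarith
  have r2 : (2 * I * w - m).re < 0 := by simp; linarith
  have hn1 : (-2 * I * w - m) ≠ 0 := fun h => by rw [h] at r1; simp at r1
  have hn2 : (2 * I * w - m) ≠ 0 := fun h => by rw [h] at r2; simp at r2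
  have e : ∀ y : ℝ, Complex.sin (2 * (y:ℂ) * w) * Complex.exp (-((m:ℂ) * (y:ℂ))) =
      (I / 2) * (Complex.exp ((-2 * I * w - m) * y) - Complex.exp ((2 * I * w - m) * y)) := by
    intro y
    have a1 : (-2 * I * w - m) * y = -(2 * y * w) * I + -(m * y) := by ring
    have a2 : (2 * I * w - m) * y = (2 * y * w) * I + -(m * y) := by ring
    rw [a1, a2, Complex.exp_add, Complex.exp_add, Complex.sin]
    ring
  simp_rw [e]
  rw [integral_const_mul, integral_sub (integrableOn_exp_mul_complex_Ioi r1 0)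
    (integrableOn_exp_mul_complex_Ioi r2 0), integral_exp_mul_complex_Ioi r1,
    integral_exp_mul_complex_Ioi r2]
  have hp : (m:ℂ)^2 + 4 * w^2 = (-2 * I * w - m) * (2 * I * w - m) := by
    linear_combination (4 * w^2) * I_sq
  rw [hp]
  simp only [ofReal_zero, mul_zero, Complex.exp_zero]
  have hd : (-2 * I * w - m) - (2 * I * w - m) = -4 * I * w := by ring
  generalize (-2 * I * w - (m:ℂ)) = A at *
  generalize (2 * I * w - (m:ℂ)) = B at *
  rw [eq_div_iff (mul_ne_zero hn1 hn2)]
  field_simp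
  linear_combination (I) * hd - 4 * w * I_sq

theorem sinh_series {D y : ℝ} (hD : 0 < D) (hy : 0 < y) :
    HasSum (fun n : ℕ => 2 * Complex.exp (-((((2 * n + 1) * D : ℝ) : ℂ) * (y:ℂ))))
      (1 / Complex.sinh ((D:ℂ) * (y:ℂ))) := by
  have hq : ‖Complex.exp (-(2 * D * y : ℝ))‖ < 1 := by
    rw [Complex.norm_exp]; simp; positivity
  have := (hasSum_geometric_of_norm_lt_one hq).mul_left (2 * Complex.exp (-(D * y : ℝ)))
  have hf : (fun n : ℕ => 2 * Complex.exp (-((((2 * n + 1) * D : ℝ) : ℂ) * (y:ℂ)))) =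
      fun n : ℕ => 2 * Complex.exp (-(D * y : ℝ)) * Complex.exp (-(2 * D * y : ℝ)) ^ n := by
    funext n
    rw [← Complex.exp_nat_mul, mul_assoc, ← Complex.exp_add]
    congr 2; push_cast; ring
  have hv : 1 / Complex.sinh ((D:ℂ) * (y:ℂ)) =
      2 * Complex.exp (-(D * y : ℝ)) * (1 - Complex.exp (-(2 * D * y : ℝ)))⁻¹ := by
    have h1 := sinh_real_ne hD hy
    have h2 : (1 - Complex.exp (-(2 * D * y : ℝ))) ≠ 0 := by
      intro h
      rw [sub_eq_zero] at h
      rw [← h] at hq; simp at hq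
    rw [div_eq_iff h1, ← div_eq_mul_inv, div_mul_eq_mul_div, eq_div_iff h2]
    have e1 : Complex.exp (-(2 * D * y : ℝ)) = Complex.exp (-(D * y)) * Complex.exp (-(D*y)) := by
      rw [← Complex.exp_add]; congr 1; push_cast; ring
    have e2 : Complex.exp (-(D*y)) * Complex.exp (D * y) = 1 := by
      rw [← Complex.exp_add]; simp
    rw [e1, Complex.sinh]; push_cast
    linear_combination (-1) * e2
  rw [hf, hv]; exact this

theorem im_two_mul (y : ℝ) (w : ℂ) : (2 * (y:ℂ) * w).im = 2 * y * w.im := by simp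

theorem tanh_integral {D : ℝ} (hD : 0 < D) {w : ℂ} (hw : 2 * |w.im| < D) :
    ∫ y in Set.Ioi (0:ℝ), 2 * Complex.sin (2 * (y:ℂ) * w) / Complex.sinh ((D:ℂ) * (y:ℂ)) =
      (Real.pi / D) * Complex.tanh (Real.pi * w / D) := by
  rcases eq_or_ne w 0 with rfl | hw0
  · simp
  have hDc : (D:ℂ) ≠ 0 := by exact_mod_cast hD.ne'
  have hm : ∀ n : ℕ, 0 < (2 * (n:ℝ) + 1) * D - 2 * |w.im| := by
    intro n
    have : (0:ℝ) ≤ n := Nat.cast_nonneg n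
    nlinarith
  have hbd : ∀ n : ℕ, ∀ y : ℝ, 0 < y → ‖2 * Complex.sin (2 * (y:ℂ) * w) *
      (2 * Complex.exp (-((((2 * n + 1) * D : ℝ) : ℂ) * (y:ℂ))))‖ ≤
      (8 * ‖w‖) * (y * Real.exp (-(((2 * n + 1) * D - 2 * |w.im|) * y))) := by
    intro n y hy
    have := norm_sin_le_mul (2 * (y:ℂ) * w)
    rw [im_two_mul] at this
    rw [norm_mul, norm_mul, norm_mul, Complex.norm_exp]
    have e1 : (-((((2 * n + 1) * D : ℝ) : ℂ) * (y:ℂ))).re = -((2 * n + 1) * D * y) := by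
      rw [← Complex.ofReal_mul, ← Complex.ofReal_neg, Complex.ofReal_re]
    have e2 : ‖2 * (y:ℂ) * w‖ = 2 * y * ‖w‖ := by
      rw [norm_mul, norm_mul, Complex.norm_real, Real.norm_of_nonneg hy.le]; simp
    have e3 : |2 * y * w.im| = 2 * y * |w.im| := by
      rw [abs_mul, abs_of_nonneg (by positivity)]
    rw [e1]; rw [e2, e3] at this
    simp only [RCLike.norm_ofNat]
    calc 2 * ‖Complex.sin (2 * (y:ℂ) * w)‖ * (2 * Real.exp (-((2 * n + 1) * D * y))) ≤
        2 * (2 * y * ‖w‖ * Real.exp (2 * y * |w.im|)) * (2 * Real.exp (-((2 * n + 1) * D * y))) := by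
          gcongr
      _ = 8 * ‖w‖ * (y * (Real.exp (2 * y * |w.im|) * Real.exp (-((2 * n + 1) * D * y)))) := by ring
      _ = _ := by rw [← Real.exp_add]; ring_nf
  have hcont : ∀ n : ℕ, Continuous (fun y : ℝ => 2 * Complex.sin (2 * (y:ℂ) * w) *
      (2 * Complex.exp (-((((2 * n + 1) * D : ℝ) : ℂ) * (y:ℂ))))) := by intro n; fun_prop
  have hint : ∀ n : ℕ, Integrable (fun y : ℝ => 2 * Complex.sin (2 * (y:ℂ) * w) *
      (2 * Complex.exp (-((((2 * n + 1) * D : ℝ) : ℂ) * (y:ℂ))))) (volume.restrict (Set.Ioi 0)) := by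
    intro n
    refine ((int_y_exp (hm n)).1.const_mul (8 * ‖w‖)).mono' (hcont n).aestronglyMeasurable ?_
    filter_upwards [ae_restrict_mem measurableSet_Ioi] with y hy using hbd n y hy
  have hsum : Summable (fun n : ℕ => ∫ y in Set.Ioi (0:ℝ), ‖2 * Complex.sin (2 * (y:ℂ) * w) *
      (2 * Complex.exp (-((((2 * n + 1) * D : ℝ) : ℂ) * (y:ℂ))))‖) := by
    refine Summable.of_nonneg_of_le (fun n => integral_nonneg fun _ => norm_nonneg _)
      (f := fun n : ℕ => (8 * ‖w‖ / (D - 2 * |w.im|)^2) * (1 / ((n:ℝ) + 1)^2)) (fun n => ?_) ?_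
    · calc _ ≤ ∫ y in Set.Ioi (0:ℝ), (8 * ‖w‖) *
            (y * Real.exp (-(((2 * n + 1) * D - 2 * |w.im|) * y))) := by
            refine integral_mono_ae (hint n).norm ((int_y_exp (hm n)).1.const_mul _) ?_
            filter_upwards [ae_restrict_mem measurableSet_Ioi] with y hy using hbd n y hy
        _ = (8 * ‖w‖) * (1 / ((2 * n + 1) * D - 2 * |w.im|)^2) := by
            rw [integral_const_mul, (int_y_exp (hm n)).2]
        _ ≤ (8 * ‖w‖) * (1 / ((D - 2 * |w.im|) * ((n:ℝ) + 1))^2) := by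
            have hp : 0 < D - 2 * |w.im| := by linarith
            gcongr
            have : (0:ℝ) ≤ n := Nat.cast_nonneg n
            nlinarith [mul_nonneg this (abs_nonneg w.im), mul_nonneg this hD.le]
        _ = _ := by rw [mul_pow]; field_simp
    · apply Summable.mul_left
      exact_mod_cast (summable_nat_add_iff 1).2 (Real.summable_one_div_nat_pow.2 one_lt_two)
  have key := hasSum_integral_of_summable_integral_norm hint hsum
  have hL : ∫ y in Set.Ioi (0:ℝ), ∑' n : ℕ, 2 * Complex.sin (2 * (y:ℂ) * w) *
      (2 * Complex.exp (-((((2 * n + 1) * D : ℝ) : ℂ) * (y:ℂ)))) =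
      ∫ y in Set.Ioi (0:ℝ), 2 * Complex.sin (2 * (y:ℂ) * w) / Complex.sinh ((D:ℂ) * (y:ℂ)) := by
    refine setIntegral_congr_fun measurableSet_Ioi fun y hy => ?_
    rw [← mul_one_div, ← ((sinh_series hD hy).mul_left _).tsum_eq]
  rw [hL] at key
  have hre : |(I * w / D).re| < 1 / 2 := by
    have : (I * w / D).re = - w.im / D := by
      rw [Complex.div_ofReal_re]; simp
    rw [this, abs_div, abs_neg, abs_of_pos hD, div_lt_iff₀ hD]; linarith
  have hx0 : I * w / D ≠ 0 := div_ne_zero (mul_ne_zero I_ne_zero hw0) hDc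
  have h1 : I * w / D ∈ Complex.integerComplement := by
    rintro ⟨n, hn⟩
    rw [← hn] at hre hx0
    simp only [intCast_re] at hre
    have h3 : |n| < 1 := by
      have : |(n:ℝ)| < 1 := by linarith
      exact_mod_cast this
    rw [Int.abs_lt_one_iff] at h3
    simp [h3] at hx0
  have h2 : 2 * (I * w / D) ∈ Complex.integerComplement := by
    rintro ⟨n, hn⟩
    have hr2 : |(2 * (I * w / D)).re| < 1 := by
      have : (2 * (I * w / D)).re = 2 * (I * w / D).re := by simp
      rw [this, abs_mul, abs_two]; linarith
    have hx2 : 2 * (I * w / D) ≠ 0 := mul_ne_zero two_ne_zero hx0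
    rw [← hn] at hr2 hx2
    simp only [intCast_re] at hr2
    have h3 : |n| < 1 := by exact_mod_cast hr2
    rw [Int.abs_lt_one_iff] at h3
    simp [h3] at hx2
  have hsin := sin_pi_mul_ne_zero h1
  have hcos : Complex.cos (Real.pi * (I * w / D)) ≠ 0 := by
    intro h
    apply sin_pi_mul_ne_zero h2
    rw [show (Real.pi:ℂ) * (2 * (I * w / D)) = 2 * (Real.pi * (I * w / D)) by ring,
      Complex.sin_two_mul, h, mul_zero]
  have ts := (tan_series h1 h2 hsin hcos).mul_left (1 / (I * D))
  have hterm : ∀ n : ℕ, ∫ y in Set.Ioi (0:ℝ), 2 * Complex.sin (2 * (y:ℂ) * w) *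
      (2 * Complex.exp (-((((2 * n + 1) * D : ℝ) : ℂ) * (y:ℂ)))) =
      1 / (I * D) * (8 * (I * w / D) / ((2 * (n:ℂ) + 1) ^ 2 - 4 * (I * w / D) ^ 2)) := by
    intro n
    have := sin_exp_integral (w := w) (m := (2 * n + 1) * D) (by linarith [hm n])
    have e : ∀ y : ℝ, 2 * Complex.sin (2 * (y:ℂ) * w) *
      (2 * Complex.exp (-((((2 * n + 1) * D : ℝ) : ℂ) * (y:ℂ)))) =
      4 * (Complex.sin (2 * (y:ℂ) * w) * Complex.exp (-((((2 * n + 1) * D : ℝ) : ℂ) * (y:ℂ)))) := by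
      intro y; ring
    simp_rw [e]
    rw [integral_const_mul, this]
    have e2 : ((2 * (n:ℂ) + 1) ^ 2 - 4 * (I * w / D) ^ 2) =
        ((((2 * n + 1) * D : ℝ) : ℂ)^2 + 4 * w^2) / D^2 := by
      push_cast; field_simp; rw [I_sq]; ring
    rw [e2, div_div_eq_mul_div]
    field_simp
    ring
  simp_rw [hterm] at key
  rw [key.unique ts]
  have e3 : (Real.pi:ℂ) * (I * w / D) = (Real.pi * w / D) * I := by ring
  rw [e3, Complex.tan_mul_I]
  field_simp


theorem inv_sub_inv_sinh {x : ℝ} (hx : 0 < x) :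
    0 ≤ 1 / x - 1 / Real.sinh x ∧ 1 / x - 1 / Real.sinh x ≤ x := by
  have hs : 0 < Real.sinh x := Real.sinh_pos_iff.2 hx
  have h1 : x < Real.sinh x := Real.self_lt_sinh_iff.2 hx
  constructor
  · rw [sub_nonneg]; exact one_div_le_one_div_of_le hx h1.le
  · have e1 : Real.sinh x ≤ x * Real.cosh x := by
      have := Real.sinh_pos_iff.2 hx
      have hm : MonotoneOn (fun t => t * Real.cosh t - Real.sinh t) (Set.Ici 0) := by
        apply monotoneOn_of_deriv_nonneg (convex_Ici 0) (by fun_prop) (by fun_prop)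
        intro t ht
        rw [interior_Ici] at ht
        have : HasDerivAt (fun t => t * Real.cosh t - Real.sinh t)
            (1 * Real.cosh t + t * Real.sinh t - Real.cosh t) t :=
          ((hasDerivAt_id t).mul (Real.hasDerivAt_cosh t)).sub (Real.hasDerivAt_sinh t)
        rw [this.deriv]
        have := mul_pos (Set.mem_Ioi.1 ht) (Real.sinh_pos_iff.2 ht)
        linarith
      have := hm (Set.mem_Ici.2 le_rfl) (Set.mem_Ici.2 hx.le) hx.le
      simp at this; linarith
    have e2 : Real.cosh x - 1 ≤ x * Real.sinh x := by
      have hm : MonotoneOn (fun t => t * Real.sinh t - Real.cosh t) (Set.Ici 0) := by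
        apply monotoneOn_of_deriv_nonneg (convex_Ici 0) (by fun_prop) (by fun_prop)
        intro t ht
        rw [interior_Ici] at ht
        have : HasDerivAt (fun t => t * Real.sinh t - Real.cosh t)
            (1 * Real.sinh t + t * Real.cosh t - Real.sinh t) t :=
          ((hasDerivAt_id t).mul (Real.hasDerivAt_sinh t)).sub (Real.hasDerivAt_cosh t)
        rw [this.deriv]
        have := mul_pos (Set.mem_Ioi.1 ht) (Real.cosh_pos t)
        linarith
      have := hm (Set.mem_Ici.2 le_rfl) (Set.mem_Ici.2 hx.le) hx.le
      simp at this; linarith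
    rw [div_sub_div _ _ hx.ne' hs.ne', div_le_iff₀ (by positivity)]
    nlinarith

theorem inv_sub_inv_sinh_c {D y : ℝ} (hD : 0 < D) (hy : 0 < y) :
    ‖1 / ((D:ℂ) * y) - 1 / Complex.sinh ((D:ℂ) * y)‖ ≤ D * y := by
  have e : 1 / ((D:ℂ) * y) - 1 / Complex.sinh ((D:ℂ) * y) =
      ((1 / (D * y) - 1 / Real.sinh (D * y) : ℝ) : ℂ) := by push_cast; rfl
  have := inv_sub_inv_sinh (mul_pos hD hy)
  rw [e, Complex.norm_real, Real.norm_of_nonneg this.1]; exact this.2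

theorem norm_inv_sinh_le {D y : ℝ} (hD : 0 < D) (hy : 0 < y) :
    ‖1 / Complex.sinh ((D:ℂ) * y)‖ ≤ 1 / (D * y) := by
  rw [norm_div, norm_one, norm_sinh_real hD hy]
  exact one_div_le_one_div_of_le (by positivity) (Real.self_lt_sinh_iff.2 (by positivity)).le

theorem norm_inv_sinh_le_exp {D y : ℝ} (hD : 0 < D) (hy : 0 < y) :
    ‖1 / Complex.sinh ((D:ℂ) * y)‖ ≤ Real.exp (-(D * y)) * (2 + 1 / (D * y)) := by
  rw [norm_div, norm_one, norm_sinh_real hD hy, one_div]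
  exact inv_sinh_le (by positivity)

theorem norm_sin_sub_le (v : ℂ) : ‖Complex.sin v - v‖ ≤ ‖v‖ ^ 3 * Real.exp |v.im| := by
  have := ((convex_imband |v.im|).inter (convex_closedBall (0:ℂ) ‖v‖)).norm_image_sub_le_of_norm_hasDerivWithin_le
    (f := fun v => Complex.sin v - v) (f' := fun v => Complex.cos v - 1)
    (C := ‖v‖ ^ 2 * Real.exp |v.im|) (x := 0) (y := v)
    (fun x _ => ((Complex.hasDerivAt_sin x).sub (hasDerivAt_id x)).hasDerivWithinAt)
    (fun x hx => by
      rw [norm_sub_rev]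
      refine (norm_one_sub_cos_le x).trans ?_
      have h1 : ‖x‖ ≤ ‖v‖ := by simpa using hx.2
      have h2 : |x.im| ≤ |v.im| := hx.1
      gcongr)
    (by simp) (by simp)
  simp at this
  calc _ ≤ _ := this
    _ = _ := by ring

/-- difference of reciprocal products -/
theorem inv_prod_sub {c d y : ℝ} (hc : 0 < c) (hd : 0 < d) (hy : 0 < y) :
    ‖1 / (((c:ℂ) * y) * ((d:ℂ) * y)) -
      1 / (Complex.sinh ((c:ℂ) * y) * Complex.sinh ((d:ℂ) * y))‖ ≤ c / d + d / c := by
  have h1 := inv_sub_inv_sinh_c hc hy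
  have h2 := inv_sub_inv_sinh_c hd hy
  have h3 := norm_inv_sinh_le hc hy
  have e : 1 / (((c:ℂ) * y) * ((d:ℂ) * y)) -
      1 / (Complex.sinh ((c:ℂ) * y) * Complex.sinh ((d:ℂ) * y)) =
      (1 / ((c:ℂ) * y) - 1 / Complex.sinh ((c:ℂ) * y)) * (1 / ((d:ℂ) * y)) +
      (1 / Complex.sinh ((c:ℂ) * y)) * (1 / ((d:ℂ) * y) - 1 / Complex.sinh ((d:ℂ) * y)) := by
    simp only [one_div, mul_inv]; ring
  have h4 : ‖1 / ((d:ℂ) * y)‖ = 1 / (d * y) := by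
    rw [← ofReal_mul, norm_div, norm_one, Complex.norm_real, Real.norm_of_nonneg (by positivity)]
  rw [e]
  calc _ ≤ (c * y) * (1 / (d * y)) + (1 / (c * y)) * (d * y) := by
        refine (norm_add_le _ _).trans ?_
        rw [norm_mul, norm_mul, h4]
        gcongr
    _ = _ := by field_simp

noncomputable def Phi (c d γ : ℝ) (y : ℝ) : ℝ :=
  (Set.Ioc (0:ℝ) 1).indicator (fun _ => 1 / (c * d) + (c / d + d / c)) y +
  (Set.Ioi (1:ℝ)).indicator (fun y => (2 + 1 / c) * (2 + 1 / d) * Real.exp (-((c + d - γ) * y))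
    + 1 / (c * d) * y ^ (-2:ℝ)) y

theorem exp_neg_int {m : ℝ} (hm : 0 < m) (A : ℝ) :
    IntegrableOn (fun y : ℝ => Real.exp (-(m * y))) (Set.Ioi A) := by
  have := exp_neg_integrableOn_Ioi A hm
  simpa only [neg_mul] using this

theorem Phi_int {c d γ : ℝ} (hγ : γ < c + d) : Integrable (Phi c d γ) := by
  refine Integrable.add ?_ ?_
  · rw [integrable_indicator_iff measurableSet_Ioc]
    exact integrableOn_const (by simp)
  · rw [integrable_indicator_iff measurableSet_Ioi]
    refine Integrable.add ((exp_neg_int (by linarith) 1).const_mul _) ?_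
    exact (integrableOn_Ioi_rpow_of_lt (by norm_num) one_pos).const_mul _

theorem Phi_bound {c d γ K y : ℝ} (hc : 0 < c) (hd : 0 < d) (hy : 0 < y) {P lam : ℂ}
    (h1 : y ≤ 1 → ‖P - lam * y‖ ≤ K * y ^ 3) (h2 : ‖P‖ ≤ K * Real.exp (γ * y)) (h3 : ‖lam‖ ≤ K) :
    ‖(1 / (y:ℂ)) * (P / (Complex.sinh ((c:ℂ) * y) * Complex.sinh ((d:ℂ) * y))
      - lam / ((c:ℂ) * d * y))‖ ≤ K * Phi c d γ y := by
  have hK : 0 ≤ K := (norm_nonneg _).trans h3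
  have hyc : (y:ℂ) ≠ 0 := by exact_mod_cast hy.ne'
  have hcc : (c:ℂ) ≠ 0 := by exact_mod_cast hc.ne'
  have hdc : (d:ℂ) ≠ 0 := by exact_mod_cast hd.ne'
  have ny : ‖(1 / (y:ℂ))‖ = 1 / y := by
    rw [norm_div, norm_one, Complex.norm_real, Real.norm_of_nonneg hy.le]
  rw [norm_mul, ny]
  unfold Phi
  rcases le_or_gt y 1 with h | h
  · rw [Set.indicator_of_mem (by exact ⟨hy, h⟩), Set.indicator_of_notMem (by simpa using h)]
    have e : P / (Complex.sinh ((c:ℂ) * y) * Complex.sinh ((d:ℂ) * y)) - lam / ((c:ℂ) * d * y) =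
        (P - lam * y) * (1 / Complex.sinh ((c:ℂ) * y)) * (1 / Complex.sinh ((d:ℂ) * y)) -
        lam * y * (1 / (((c:ℂ) * y) * ((d:ℂ) * y)) -
      1 / (Complex.sinh ((c:ℂ) * y) * Complex.sinh ((d:ℂ) * y))) := by
      have := sinh_real_ne hc hy
      have := sinh_real_ne hd hy
      field_simp
      ring
    rw [e]
    have n1 : ‖(y:ℂ)‖ = y := by rw [Complex.norm_real, Real.norm_of_nonneg hy.le]
    calc _ ≤ 1 / y * (K * y ^ 3 * (1 / (c * y)) * (1 / (d * y)) + K * y * (c / d + d / c)) := by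
          gcongr
          refine (norm_sub_le _ _).trans ?_
          rw [norm_mul, norm_mul, norm_mul, norm_mul, n1]
          have := norm_inv_sinh_le hc hy
          have := norm_inv_sinh_le hd hy
          have := inv_prod_sub hc hd hy
          have := h1 h
          gcongr
      _ = _ := by field_simp; ring
  · rw [Set.indicator_of_notMem (by simp [h]), Set.indicator_of_mem (by simpa using h)]
    have i1 := norm_inv_sinh_le_exp hc hy
    have i2 := norm_inv_sinh_le_exp hd hy
    have n1 : ‖lam / ((c:ℂ) * d * y)‖ = ‖lam‖ / (c * d * y) := by
      rw [norm_div]; congr 1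
      rw [← ofReal_mul, ← ofReal_mul, Complex.norm_real, Real.norm_of_nonneg (by positivity)]
    have n2 : P / (Complex.sinh ((c:ℂ) * y) * Complex.sinh ((d:ℂ) * y)) =
      P * (1 / Complex.sinh ((c:ℂ) * y)) * (1 / Complex.sinh ((d:ℂ) * y)) := by
      simp only [div_eq_mul_inv, mul_inv]; ring
    have yi : 1 / y ≤ 1 := by rw [div_le_one hy]; exact h.le
    have j1 : 1 / (c * y) ≤ 1 / c := one_div_le_one_div_of_le hc (by nlinarith)
    have j2 : 1 / (d * y) ≤ 1 / d := one_div_le_one_div_of_le hd (by nlinarith)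
    have r2 : y ^ (-2:ℝ) = (1 / y) * (1 / y) := by
      rw [Real.rpow_neg hy.le]; norm_num; rw [pow_two, mul_inv]
    calc _ ≤ 1 / y * (K * Real.exp (γ * y) * (Real.exp (-(c * y)) * (2 + 1 / c)) *
            (Real.exp (-(d * y)) * (2 + 1 / d)) + K / (c * d * y)) := by
          gcongr
          refine (norm_sub_le _ _).trans ?_
          rw [n1, n2, norm_mul, norm_mul]
          gcongr
          · exact i1.trans (by gcongr)
          · exact i2.trans (by gcongr)
      _ = (1 / y) * (K * ((2 + 1 / c) * (2 + 1 / d) * (Real.exp (γ * y) * Real.exp (-(c * y)) *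
          Real.exp (-(d * y))))) + K * (1 / (c * d) * ((1 / y) * (1 / y))) := by field_simp
      _ ≤ 1 * (K * ((2 + 1 / c) * (2 + 1 / d) * (Real.exp (γ * y) * Real.exp (-(c * y)) *
          Real.exp (-(d * y))))) + K * (1 / (c * d) * ((1 / y) * (1 / y))) := by
          gcongr
      _ = _ := by
          rw [← Real.exp_add, ← Real.exp_add, r2]
          rw [show γ * y + -(c * y) + -(d * y) = -((c + d - γ) * y) by ring]
          ring

/-- the ghyp integrand -/
noncomputable def gint (ap am : ℝ) (z : ℂ) (y : ℝ) : ℂ :=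
    (1 / (y : ℂ)) *
      (Complex.sin (2 * (y : ℂ) * z) /
          (2 * Complex.sinh ((ap : ℂ) * (y : ℂ)) * Complex.sinh ((am : ℂ) * (y : ℂ))) -
        z / ((ap : ℂ) * (am : ℂ) * (y : ℂ)))

theorem gint_bound {ap am : ℝ} (hap : 0 < ap) (ham : 0 < am) {M ρ : ℝ} (hM : 0 ≤ M) {z : ℂ}
    (hz : ‖z‖ ≤ M) (hρ : |z.im| ≤ ρ) {y : ℝ} (hy : 0 < y) :
    ‖gint ap am z y‖ ≤ (4 * M ^ 3 * Real.exp (2 * ρ) + M + 1) * Phi ap am (2 * ρ) y := by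
  have hρ0 : 0 ≤ ρ := (abs_nonneg _).trans hρ
  have e : gint ap am z y = (1 / (y:ℂ)) * ((Complex.sin (2 * (y : ℂ) * z) / 2) /
    (Complex.sinh ((ap:ℂ) * y) * Complex.sinh ((am:ℂ) * y)) - z / ((ap:ℂ) * am * y)) := by
    unfold gint; rw [div_div, ← mul_assoc 2 (Complex.sinh _)]
  have n1 : |(2 * (y:ℂ) * z).im| = 2 * y * |z.im| := by
    rw [im_two_mul, abs_mul, abs_of_pos (by positivity)]
  have n2 : ‖2 * (y:ℂ) * z‖ = 2 * y * ‖z‖ := by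
    rw [norm_mul, norm_mul, Complex.norm_real, Real.norm_of_nonneg hy.le]; simp
  rw [e]
  refine Phi_bound hap ham hy (fun hy1 => ?_) ?_ ?_
  · have e2 : Complex.sin (2 * (y : ℂ) * z) / 2 - z * y =
      (Complex.sin (2 * (y : ℂ) * z) - 2 * y * z) / 2 := by ring
    have := norm_sin_sub_le (2 * y * z)
    rw [n1, n2] at this
    rw [e2, norm_div]; simp only [RCLike.norm_ofNat]
    have h5 : 2 * y * |z.im| ≤ 2 * ρ := by nlinarith [abs_nonneg z.im]
    calc _ ≤ ((2 * y * ‖z‖) ^ 3 * Real.exp (2 * y * |z.im|)) / 2 := by gcongr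
      _ ≤ ((2 * y * M) ^ 3 * Real.exp (2 * ρ)) / 2 := by gcongr
      _ = (4 * M ^ 3 * Real.exp (2 * ρ)) * y ^ 3 := by ring
      _ ≤ _ := by gcongr; linarith
  · have := norm_sin_le_exp (2 * y * z)
    rw [n1] at this
    rw [norm_div]; simp only [RCLike.norm_ofNat]
    calc _ ≤ Real.exp (2 * y * |z.im|) := by linarith [norm_nonneg (Complex.sin (2 * y * z))]
      _ ≤ 1 * Real.exp (2 * ρ * y) := by
        rw [one_mul]; apply Real.exp_le_exp.2; nlinarith
      _ ≤ _ := by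
        gcongr
        have : 0 ≤ 4 * M ^ 3 * Real.exp (2 * ρ) := by positivity
        linarith
  · have : 0 ≤ 4 * M ^ 3 * Real.exp (2 * ρ) := by positivity
    linarith

theorem gint_cont {ap am : ℝ} (hap : 0 < ap) (ham : 0 < am) (z : ℂ) :
    ContinuousOn (gint ap am z) (Set.Ioi 0) := by
  unfold gint
  have h0 : ∀ y ∈ Set.Ioi (0:ℝ), (y:ℂ) ≠ 0 := fun y hy => by
    exact_mod_cast (Set.mem_Ioi.1 hy).ne'
  have hcc : (ap:ℂ) ≠ 0 := by exact_mod_cast hap.ne'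
  have hdc : (am:ℂ) ≠ 0 := by exact_mod_cast ham.ne'
  refine ContinuousOn.mul (ContinuousOn.div (by fun_prop) (by fun_prop) h0)
    (ContinuousOn.sub (ContinuousOn.div (by fun_prop) (by fun_prop) ?_)
      (ContinuousOn.div (by fun_prop) (by fun_prop) ?_))
  · intro y hy
    exact mul_ne_zero (mul_ne_zero two_ne_zero (sinh_real_ne hap hy)) (sinh_real_ne ham hy)
  · intro y hy; exact mul_ne_zero (mul_ne_zero hcc hdc) (h0 y hy)

theorem gint_int {ap am : ℝ} (hap : 0 < ap) (ham : 0 < am) {z : ℂ}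
    (hz : |z.im| < (ap + am) / 2) : IntegrableOn (gint ap am z) (Set.Ioi 0) := by
  refine (((Phi_int (c := ap) (d := am) (γ := 2 * |z.im|) (by linarith)).integrableOn).const_mul
    (4 * ‖z‖ ^ 3 * Real.exp (2 * |z.im|) + ‖z‖ + 1)).mono'
    ((gint_cont hap ham z).aestronglyMeasurable measurableSet_Ioi) ?_
  filter_upwards [ae_restrict_mem measurableSet_Ioi] with y hy
  exact gint_bound hap ham (norm_nonneg _) le_rfl le_rfl hy

theorem isOpen_imband (ρ : ℝ) : IsOpen {z : ℂ | |z.im| < ρ} :=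
  isOpen_lt (by fun_prop) continuous_const

theorem ghyp_diff {ap am : ℝ} (hap : 0 < ap) (ham : 0 < am) :
    DifferentiableOn ℂ (ghyp ap am) {z : ℂ | |z.im| < (ap + am) / 2} := by
  refine hol_param (μ := volume.restrict (Set.Ioi 0)) (h := gint ap am) (isOpen_imband _) ?_ ?_ ?_
  · intro ζ _; exact (gint_cont hap ham ζ).aestronglyMeasurable measurableSet_Ioi
  · intro y; unfold gint
    apply Differentiable.differentiableOn
    refine Differentiable.const_mul (Differentiable.sub ?_ ?_) _
    · exact Differentiable.div_const (by fun_prop) _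
    · exact Differentiable.div_const (by fun_prop) _
  · intro ζ₀ h0
    have h0 : |ζ₀.im| < (ap + am) / 2 := h0
    refine ⟨((ap + am) / 2 - |ζ₀.im|) / 2, by linarith, _, ((Phi_int (c := ap) (d := am)
      (γ := 2 * (|ζ₀.im| + ((ap + am) / 2 - |ζ₀.im|) / 2)) (by linarith)).integrableOn).const_mul
      (4 * (‖ζ₀‖ + ((ap + am) / 2 - |ζ₀.im|) / 2) ^ 3 *
        Real.exp (2 * (|ζ₀.im| + ((ap + am) / 2 - |ζ₀.im|) / 2)) +
        (‖ζ₀‖ + ((ap + am) / 2 - |ζ₀.im|) / 2) + 1), ?_⟩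
    filter_upwards [ae_restrict_mem measurableSet_Ioi] with y hy ζ hζ hr
    refine gint_bound hap ham (by have := norm_nonneg ζ₀; linarith) ?_ ?_ hy
    · have := norm_sub_norm_le ζ ζ₀; linarith
    · have h3 := abs_im_le_norm (ζ - ζ₀)
      rw [sub_im] at h3
      have := abs_sub_abs_le_abs_sub ζ.im ζ₀.im
      linarith

theorem ghyp_neg (ap am : ℝ) (z : ℂ) : ghyp ap am (-z) = - ghyp ap am z := by
  unfold ghyp
  rw [← integral_neg]
  congr 1; funext y
  rw [mul_neg, Complex.sin_neg]; ring

theorem Ghyp_neg (ap am : ℝ) (z : ℂ) : Ghyp ap am (-z) = (Ghyp ap am z)⁻¹ := by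
  unfold Ghyp; rw [ghyp_neg, mul_neg, Complex.exp_neg]

theorem Ghyp_ne (ap am : ℝ) (z : ℂ) : Ghyp ap am z ≠ 0 := Complex.exp_ne_zero _

theorem ghyp_symm (ap am : ℝ) (z : ℂ) : ghyp ap am z = ghyp am ap z := by
  unfold ghyp
  congr 1; funext y
  rw [mul_right_comm 2 (Complex.sinh _) (Complex.sinh _), mul_comm (ap:ℂ) (am:ℂ)]

theorem Ghyp_symm (ap am : ℝ) (z : ℂ) : Ghyp ap am z = Ghyp am ap z := by
  unfold Ghyp; rw [ghyp_symm]

noncomputable def eint (D : ℝ) (w : ℂ) (y : ℝ) : ℂ :=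
  (1 / (y:ℂ)) * (1 / ((D:ℂ) * y) - Complex.cos (2 * y * w) / Complex.sinh ((D:ℂ) * y))

noncomputable def ellD (D : ℝ) (w : ℂ) : ℂ := ∫ y in Set.Ioi (0:ℝ), eint D w y

/-- functional equation -/
theorem ghyp_shift {ap am : ℝ} (hap : 0 < ap) (ham : 0 < am) {z : ℂ} (hz : |z.im| < ap / 2) :
    I * (ghyp ap am (z + I * am / 2) - ghyp ap am (z - I * am / 2)) = ellD ap z := by
  have hb := abs_lt.1 hz
  have i1 : (z + I * am / 2).im = z.im + am / 2 := by simp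
  have i2 : (z - I * am / 2).im = z.im - am / 2 := by simp
  have h1 : |(z + I * am / 2).im| < (ap + am) / 2 := by rw [i1, abs_lt]; constructor <;> linarith
  have h2 : |(z - I * am / 2).im| < (ap + am) / 2 := by rw [i2, abs_lt]; constructor <;> linarith
  have := integral_sub (gint_int hap ham h1) (gint_int hap ham h2)
  have e : ∀ z, ghyp ap am z = ∫ y in Set.Ioi (0:ℝ), gint ap am z y := fun z => rfl
  rw [e, e, ← this, ← integral_const_mul, ellD]
  refine setIntegral_congr_fun measurableSet_Ioi fun y hy => ?_
  have hy : 0 < y := hy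
  have s1 := sinh_real_ne hap hy
  have s2 := sinh_real_ne ham hy
  have hyc : (y:ℂ) ≠ 0 := by exact_mod_cast hy.ne'
  have hcc : (ap:ℂ) ≠ 0 := by exact_mod_cast hap.ne'
  have hdc : (am:ℂ) ≠ 0 := by exact_mod_cast ham.ne'
  have t1 : Complex.sin (2 * y * (z + I * am / 2)) = Complex.sin (2 * y * z) *
      Complex.cosh (am * y) + Complex.cos (2 * y * z) * (Complex.sinh (am * y) * I) := by
    rw [show 2 * (y:ℂ) * (z + I * am / 2) = 2 * y * z + (am * y) * I by ring, Complex.sin_add,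
      Complex.cos_mul_I, Complex.sin_mul_I]
  have t2 : Complex.sin (2 * y * (z - I * am / 2)) = Complex.sin (2 * y * z) *
      Complex.cosh (am * y) - Complex.cos (2 * y * z) * (Complex.sinh (am * y) * I) := by
    rw [show 2 * (y:ℂ) * (z - I * am / 2) = 2 * y * z - (am * y) * I by ring, Complex.sin_sub,
      Complex.cos_mul_I, Complex.sin_mul_I]
  simp only [gint, eint, t1, t2]
  generalize Complex.sinh ((ap:ℂ) * y) = S1 at *
  generalize Complex.sinh ((am:ℂ) * y) = S2 at *
  generalize Complex.sin (2 * (y:ℂ) * z) = s0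
  generalize Complex.cos (2 * (y:ℂ) * z) = c0
  generalize Complex.cosh ((am:ℂ) * y) = C2
  field_simp
  linear_combination (am * S2 * (2 * y * ap * c0 - 2 * S1)) * I_sq


theorem eint_cont {D : ℝ} (hD : 0 < D) (w : ℂ) : ContinuousOn (eint D w) (Set.Ioi 0) := by
  unfold eint
  have h0 : ∀ y ∈ Set.Ioi (0:ℝ), (y:ℂ) ≠ 0 := fun y hy => by
    exact_mod_cast (Set.mem_Ioi.1 hy).ne'
  have hcc : (D:ℂ) ≠ 0 := by exact_mod_cast hD.ne'
  refine ContinuousOn.mul (ContinuousOn.div (by fun_prop) (by fun_prop) h0)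
    (ContinuousOn.sub (ContinuousOn.div (by fun_prop) (by fun_prop) ?_)
      (ContinuousOn.div (by fun_prop) (by fun_prop) ?_))
  · intro y hy; exact mul_ne_zero hcc (h0 y hy)
  · intro y hy; exact sinh_real_ne hD hy

theorem eint_zero_int {D : ℝ} (hD : 0 < D) : IntegrableOn (eint D 0) (Set.Ioi 0) := by
  have e : ∀ y : ℝ, eint D 0 y = (1 / (y:ℂ)) * (1 / ((D:ℂ) * y) - 1 / Complex.sinh ((D:ℂ) * y)) := by
    intro y; simp [eint]
  refine integrable_tool (eint_cont hD 0) ?_ ?_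
  · refine Asymptotics.IsBigO.of_bound D ?_
    filter_upwards [self_mem_nhdsWithin] with y hy
    have hy : 0 < y := hy
    rw [e, norm_mul, norm_div, norm_one, Complex.norm_real, Real.norm_of_nonneg hy.le]
    calc _ ≤ 1 / y * (D * y) := by gcongr; exact inv_sub_inv_sinh_c hD hy
      _ = _ := by field_simp; simp
  · refine Asymptotics.IsBigO.of_bound (1 / D) ?_
    filter_upwards [Filter.eventually_gt_atTop 0] with y hy
    have r2 : y ^ (-2:ℝ) = (1 / y) * (1 / y) := by
      rw [Real.rpow_neg hy.le]; norm_num; rw [pow_two, mul_inv]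
    have e2 : 1 / ((D:ℂ) * y) - 1 / Complex.sinh ((D:ℂ) * y) =
      ((1 / (D * y) - 1 / Real.sinh (D * y) : ℝ) : ℂ) := by push_cast; rfl
    have h := inv_sub_inv_sinh (mul_pos hD hy)
    have hs : 0 < Real.sinh (D * y) := Real.sinh_pos_iff.2 (by positivity)
    have hs' : 0 < 1 / Real.sinh (D * y) := by positivity
    rw [e, e2, r2, norm_mul, norm_div, norm_one, Complex.norm_real, Complex.norm_real,
      Real.norm_of_nonneg hy.le, Real.norm_of_nonneg h.1, Real.norm_of_nonneg (by positivity)]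
    calc _ ≤ 1 / y * (1 / (D * y)) := by gcongr; linarith
      _ = _ := by field_simp

theorem exp_dom_int {m : ℝ} (hm : 0 < m) (A B : ℝ) :
    IntegrableOn (fun y : ℝ => A * (y * Real.exp (-(m * y))) + B * Real.exp (-(m * y))) (Set.Ioi 0) :=
  ((int_y_exp hm).1.const_mul A).add ((exp_neg_int hm 0).const_mul B)

theorem eint_int {D : ℝ} (hD : 0 < D) {w : ℂ} (hw : |w.im| < D / 2) :
    IntegrableOn (eint D w) (Set.Ioi 0) := by
  have h1 : IntegrableOn (fun y => eint D w y - eint D 0 y) (Set.Ioi 0) := by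
    refine (exp_dom_int (m := D - 2 * |w.im|) (by linarith) (8 * ‖w‖ ^ 2) (4 * ‖w‖ ^ 2 / D)).mono'
      (((eint_cont hD w).sub (eint_cont hD 0)).aestronglyMeasurable measurableSet_Ioi) ?_
    filter_upwards [ae_restrict_mem measurableSet_Ioi] with y hy
    have hy : 0 < y := hy
    have e : eint D w y - eint D 0 y = (1 / (y:ℂ)) * ((1 - Complex.cos (2 * y * w)) *
        (1 / Complex.sinh ((D:ℂ) * y))) := by
      simp only [eint, mul_zero, Complex.cos_zero]; ring
    have h1 := norm_one_sub_cos_le (2 * y * w)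
    have h2 := norm_inv_sinh_le_exp hD hy
    rw [im_two_mul, abs_mul, abs_of_pos (by positivity : (0:ℝ) < 2 * y), norm_mul, norm_mul,
      Complex.norm_real, Real.norm_of_nonneg hy.le, RCLike.norm_ofNat] at h1
    rw [e, norm_mul, norm_mul, norm_div, norm_one, Complex.norm_real, Real.norm_of_nonneg hy.le]
    calc _ ≤ 1 / y * (((2 * y * ‖w‖) ^ 2 * Real.exp (2 * y * |w.im|)) *
          (Real.exp (-(D * y)) * (2 + 1 / (D * y)))) := by gcongr
      _ = (8 * ‖w‖ ^ 2 * y + 4 * ‖w‖ ^ 2 / D) *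
          (Real.exp (2 * y * |w.im|) * Real.exp (-(D * y))) := by field_simp; ring
      _ = (8 * ‖w‖ ^ 2 * y + 4 * ‖w‖ ^ 2 / D) * Real.exp (-((D - 2 * |w.im|) * y)) := by
          rw [← Real.exp_add]; congr 2; ring
      _ = _ := by ring
  have := h1.add (eint_zero_int hD)
  refine this.congr_fun (fun y _ => ?_) measurableSet_Ioi
  simp

theorem ellD_deriv {D : ℝ} (hD : 0 < D) {w : ℂ} (hw : |w.im| < D / 2) :
    HasDerivAt (ellD D) ((Real.pi / D) * Complex.tanh (Real.pi * w / D)) w := by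
  rw [← tanh_integral hD (by linarith)]
  set r := (D / 2 - |w.im|) / 2 with hr
  have hr0 : 0 < r := by linarith
  have him : ∀ v ∈ Metric.ball w r, |v.im| ≤ |w.im| + r := by
    intro v hv
    rw [Metric.mem_ball, dist_eq_norm] at hv
    have h3 := abs_im_le_norm (v - w)
    rw [sub_im] at h3
    have := abs_sub_abs_le_abs_sub v.im w.im
    linarith
  refine (hasDerivAt_integral_of_dominated_loc_of_deriv_le (μ := volume.restrict (Set.Ioi 0))
    (F := eint D) (F' := fun w y => 2 * Complex.sin (2 * (y:ℂ) * w) / Complex.sinh ((D:ℂ) * (y:ℂ)))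
    (x₀ := w) (s := Metric.ball w r) (bound := fun y => (8 * (‖w‖ + r)) *
      (y * Real.exp (-((D - 2 * (|w.im| + r)) * y))) + (4 * (‖w‖ + r) / D) *
        Real.exp (-((D - 2 * (|w.im| + r)) * y)))
    (Metric.ball_mem_nhds _ hr0) ?_ (eint_int hD hw) ?_ ?_ ?_ ?_).2
  · exact Filter.Eventually.of_forall fun v =>
      (eint_cont hD v).aestronglyMeasurable measurableSet_Ioi
  · refine ContinuousOn.aestronglyMeasurable ?_ measurableSet_Ioi
    refine ContinuousOn.div (by fun_prop) (by fun_prop) fun y hy => sinh_real_ne hD hy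
  · filter_upwards [ae_restrict_mem measurableSet_Ioi] with y hy v hv
    have hy : 0 < y := hy
    have h1 := norm_sin_le_mul (2 * y * v)
    have h2 := norm_inv_sinh_le_exp hD hy
    have h4 := him v hv
    have h5 : ‖v‖ ≤ ‖w‖ + r := by
      rw [Metric.mem_ball, dist_eq_norm] at hv
      have := norm_sub_norm_le v w; linarith
    rw [im_two_mul, abs_mul, abs_of_pos (by positivity : (0:ℝ) < 2 * y), norm_mul, norm_mul,
      Complex.norm_real, Real.norm_of_nonneg hy.le, RCLike.norm_ofNat] at h1
    rw [div_eq_mul_one_div, norm_mul, norm_mul, RCLike.norm_ofNat]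
    calc _ ≤ 2 * (2 * y * (‖w‖ + r) * Real.exp (2 * y * (|w.im| + r))) *
          (Real.exp (-(D * y)) * (2 + 1 / (D * y))) := by
            gcongr; exact h1.trans (by gcongr)
      _ = (8 * (‖w‖ + r) * y + 4 * (‖w‖ + r) / D) *
          (Real.exp (2 * y * (|w.im| + r)) * Real.exp (-(D * y))) := by field_simp; ring
      _ = (8 * (‖w‖ + r) * y + 4 * (‖w‖ + r) / D) * Real.exp (-((D - 2 * (|w.im| + r)) * y)) := by
          rw [← Real.exp_add]; congr 2; ring
      _ = _ := by ring
  · exact exp_dom_int (by linarith) _ _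
  · filter_upwards [ae_restrict_mem measurableSet_Ioi] with y hy v hv
    have hy : 0 < y := hy
    have hyc : (y:ℂ) ≠ 0 := by exact_mod_cast hy.ne'
    unfold eint
    have h1 : HasDerivAt (fun v : ℂ => Complex.cos (2 * y * v))
        (-Complex.sin (2 * y * v) * (2 * y * 1)) v :=
      (Complex.hasDerivAt_cos _).comp v ((hasDerivAt_id v).const_mul _)
    have := ((h1.div_const (Complex.sinh ((D:ℂ) * y))).const_sub (1 / ((D:ℂ) * y))).const_mul (1 / (y:ℂ))
    refine this.congr_deriv ?_
    have hs := sinh_real_ne hD hy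
    generalize Complex.sin (2 * (y:ℂ) * v) = s0
    generalize Complex.sinh ((D:ℂ) * (y:ℂ)) = s1 at *
    field_simp

theorem cosh_ne {D : ℝ} (hD : 0 < D) {w : ℂ} (hw : |w.im| < D / 2) :
    Complex.cosh (Real.pi * w / D) ≠ 0 := by
  intro h
  have him : (Real.pi * w / D).im = Real.pi * w.im / D := by
    rw [Complex.div_ofReal_im]; simp
  have hre : (Complex.cosh (Real.pi * w / D)).re =
      Real.cosh (Real.pi * w / D).re * Real.cos (Real.pi * w / D).im := by
    rw [← Complex.cos_mul_I, ← Complex.re_add_im (Real.pi * w / D : ℂ)]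
    generalize (Real.pi * w / D).re = p
    generalize (Real.pi * w / D).im = q
    rw [show ((p:ℂ) + q * I) * I = p * I - q by
      rw [add_mul, mul_assoc, I_mul_I]; ring, Complex.cos_sub, Complex.cos_mul_I, Complex.sin_mul_I]
    simp [← Complex.ofReal_cosh, ← Complex.ofReal_sinh, ← Complex.ofReal_cos, ← Complex.ofReal_sin]
  rw [h, zero_re, him] at hre
  have hc : 0 < Real.cos (Real.pi * w.im / D) := by
    have hb := abs_lt.1 hw
    have hpi := Real.pi_pos
    apply Real.cos_pos_of_mem_Ioo
    constructor
    · rw [lt_div_iff₀ hD]; nlinarith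
    · rw [div_lt_iff₀ hD]; nlinarith
  have := mul_pos (Real.cosh_pos (Real.pi * w / D).re) hc
  linarith

theorem ellD_const {D : ℝ} (hD : 0 < D) {w : ℂ} (hw : |w.im| < D / 2) :
    Complex.exp (ellD D w) = Complex.exp (ellD D 0) * Complex.cosh (Real.pi * w / D) := by
  have hconv : Convex ℝ {z : ℂ | |z.im| < D / 2} := by
    have : {z : ℂ | |z.im| < D / 2} = Complex.imLm ⁻¹' (Set.Ioo (-(D/2)) (D/2)) := by
      ext z; simp [abs_lt]
    rw [this]
    exact (convex_Ioo _ _).linear_preimage _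
  have hDc : (D:ℂ) ≠ 0 := by exact_mod_cast hD.ne'
  have key : ∀ z ∈ {z : ℂ | |z.im| < D / 2}, HasDerivWithinAt
      (fun z => Complex.exp (-ellD D z) * Complex.cosh (Real.pi * z / D)) 0
      {z : ℂ | |z.im| < D / 2} z := by
    intro z hz
    have h1 := ((ellD_deriv hD hz).neg.cexp)
    have h2 : HasDerivAt (fun z : ℂ => Real.pi * z / D) (Real.pi * 1 / D) z :=
      ((hasDerivAt_id z).const_mul _).div_const _
    have h3 := h1.mul h2.ccosh
    have hc := cosh_ne hD hz
    refine (h3.congr_deriv ?_).hasDerivWithinAt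
    rw [Complex.tanh_eq_sinh_div_cosh]
    field_simp
    simp
  have := hconv.is_const_of_fderivWithin_eq_zero (𝕜 := ℂ)
    (f := fun z => Complex.exp (-ellD D z) * Complex.cosh (Real.pi * z / D))
    (fun z hz => (key z hz).differentiableWithinAt) (fun z hz => by
      have hu := (isOpen_imband (D/2)).uniqueDiffWithinAt (𝕜 := ℂ) hz
      have := (key z hz).hasFDerivWithinAt.fderivWithin hu
      rw [this]; ext; simp) (x := w) (y := 0) hw (by simp; positivity)
  simp only [mul_zero, zero_div, Complex.cosh_zero, mul_one, Complex.exp_neg] at this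
  rw [inv_mul_eq_div, div_eq_iff (Complex.exp_ne_zero _), inv_mul_eq_div,
    eq_div_iff (Complex.exp_ne_zero _)] at this
  rw [← this]; ring

theorem ellD_dup {D : ℝ} (hD : 0 < D) : 2 * ellD D (I * D / 4) = ellD D 0 := by
  have hw : |(I * (D:ℂ) / 4).im| < D / 2 := by
    have : (I * (D:ℂ) / 4).im = D / 4 := by
      rw [show I * (D:ℂ) / 4 = ((D / 4 : ℝ) : ℂ) * I by push_cast; ring]; simp
    rw [this, abs_of_pos (by positivity)]; linarith
  have e : ∀ y ∈ Set.Ioi (0:ℝ), 2 * eint D (I * D / 4) y = (2:ℝ)⁻¹ * eint D 0 (2⁻¹ * y) := by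
    intro y hy
    have hy : 0 < y := hy
    have hyc : (y:ℂ) ≠ 0 := by exact_mod_cast hy.ne'
    have hDc : (D:ℂ) ≠ 0 := by exact_mod_cast hD.ne'
    have s1 := sinh_real_ne hD hy
    have s2 := sinh_real_ne hD (half_pos hy)
    have s3 : Complex.sinh (D * y) = 2 * Complex.sinh (D * (y/2 : ℝ)) * Complex.cosh (D * (y/2 : ℝ)) := by
      rw [← Complex.sinh_two_mul]; congr 1; push_cast; ring
    have s4 : Complex.cos (2 * y * (I * D / 4)) = Complex.cosh (D * (y/2 : ℝ)) := by
      rw [← Complex.cos_mul_I]; congr 1; push_cast; ring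
    have s5 : Complex.cosh (D * (y/2 : ℝ)) ≠ 0 := by
      intro h; rw [s3, h, mul_zero] at s1; exact s1 rfl
    have s6 : (2⁻¹ * y : ℝ) = y / 2 := by ring
    rw [s6]
    simp only [eint, s4, s3, mul_zero, Complex.cos_zero]
    generalize Complex.cosh ((D:ℂ) * (y/2 : ℝ)) = C0 at *
    generalize Complex.sinh ((D:ℂ) * (y/2 : ℝ)) = S0 at *
    push_cast
    field_simp
  unfold ellD
  rw [← integral_const_mul, setIntegral_congr_fun measurableSet_Ioi e, integral_const_mul]
  have := integral_comp_mul_left_Ioi (fun y => eint D 0 y) 0 (b := 2⁻¹) (by norm_num)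
  rw [this]
  simp

theorem ellD_exp {D : ℝ} (hD : 0 < D) {w : ℂ} (hw : |w.im| < D / 2) :
    Complex.exp (ellD D w) = 2 * Complex.cosh (Real.pi * w / D) := by
  rw [ellD_const hD hw]
  congr 1
  have hDc : (D:ℂ) ≠ 0 := by exact_mod_cast hD.ne'
  have hw : |(I * (D:ℂ) / 4).im| < D / 2 := by
    have : (I * (D:ℂ) / 4).im = D / 4 := by
      rw [show I * (D:ℂ) / 4 = ((D / 4 : ℝ) : ℂ) * I by push_cast; ring]; simp
    rw [this, abs_of_pos (by positivity)]; linarith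
  have h1 := ellD_const hD hw
  have h2 := ellD_dup hD
  have h3 : Complex.exp (ellD D 0) = Complex.exp (ellD D (I * D / 4)) ^ 2 := by
    rw [← h2, ← Complex.exp_nat_mul]; norm_num
  have h4 : Complex.cosh (Real.pi * (I * D / 4) / D) ^ 2 = 1 / 2 := by
    have : (Real.pi * (I * D / 4) / D : ℂ) = ((Real.pi / 4 : ℝ) : ℂ) * I := by
      push_cast; field_simp
    rw [this, Complex.cosh_mul_I, ← Complex.ofReal_cos, Real.cos_pi_div_four]
    rw [← Complex.ofReal_pow, div_pow, Real.sq_sqrt (by norm_num)]; norm_num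
  rw [h1, mul_pow, h4] at h3
  have h0 := Complex.exp_ne_zero (ellD D 0)
  have : Complex.exp (ellD D 0) * (Complex.exp (ellD D 0) - 2) = 0 := by linear_combination (-2) * h3
  rcases mul_eq_zero.1 this with h | h
  · exact absurd h h0
  · linear_combination h


theorem sinh_eq_sin (v : ℂ) : Complex.sinh v = -I * Complex.sin (v * I) := by
  rw [Complex.sin_mul_I]; linear_combination (Complex.sinh v) * I_sq

theorem norm_sinh_le_exp (v : ℂ) : ‖Complex.sinh v‖ ≤ Real.exp |v.re| := by
  have := norm_sin_le_exp (v * I)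
  rw [sinh_eq_sin, norm_mul, norm_neg, norm_I, one_mul]
  simpa using this

theorem norm_sinh_sub_le (v : ℂ) : ‖Complex.sinh v - v‖ ≤ ‖v‖ ^ 3 * Real.exp |v.re| := by
  have := norm_sin_sub_le (v * I)
  have e : Complex.sinh v - v = -I * (Complex.sin (v * I) - v * I) := by
    rw [sinh_eq_sin]; linear_combination (-v) * I_sq
  rw [e, norm_mul, norm_neg, norm_I, one_mul]
  simpa using this

noncomputable def qf (c d : ℝ) (β : ℂ) (y : ℝ) : ℂ :=
  (1 / (y:ℂ)) * (Complex.sinh (β * y) / (Complex.sinh ((c:ℂ) * y) * Complex.sinh ((d:ℂ) * y))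
    - (β * (c + d) / (c * d)) / Complex.sinh (((c + d : ℝ) : ℂ) * y))

theorem qf_cont {c d : ℝ} (hc : 0 < c) (hd : 0 < d) (β : ℂ) : ContinuousOn (qf c d β) (Set.Ioi 0) := by
  unfold qf
  have h0 : ∀ y ∈ Set.Ioi (0:ℝ), (y:ℂ) ≠ 0 := fun y hy => by
    exact_mod_cast (Set.mem_Ioi.1 hy).ne'
  refine ContinuousOn.mul (ContinuousOn.div (by fun_prop) (by fun_prop) h0)
    (ContinuousOn.sub (ContinuousOn.div (by fun_prop) (by fun_prop) ?_)
      (ContinuousOn.div (by fun_prop) (by fun_prop) ?_))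
  · intro y hy; exact mul_ne_zero (sinh_real_ne hc hy) (sinh_real_ne hd hy)
  · intro y hy; exact sinh_real_ne (add_pos hc hd) hy

theorem qf_int {c d : ℝ} (hc : 0 < c) (hd : 0 < d) {β : ℂ} {ρ : ℝ} (hρ0 : 0 ≤ ρ)
    (hρ : 2 * ρ + |β.re| < c + d) :
    IntegrableOn (fun y => qf c d β y * Real.exp (2 * ρ * y)) (Set.Ioi 0) := by
  have hcc : (c:ℂ) ≠ 0 := by exact_mod_cast hc.ne'
  have hdc : (d:ℂ) ≠ 0 := by exact_mod_cast hd.ne'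
  have hD : 0 < c + d := by positivity
  have nb : ∀ y : ℝ, 0 < y → ‖β * (y:ℂ)‖ = ‖β‖ * y := fun y hy => by
    rw [norm_mul, Complex.norm_real, Real.norm_of_nonneg hy.le]
  have rb : ∀ y : ℝ, 0 < y → |(β * (y:ℂ)).re| = |β.re| * y := fun y hy => by
    rw [show (β * (y:ℂ)).re = β.re * y by simp, abs_mul, abs_of_pos hy]
  set κ := (β * (c + d) / (c * d)) with hκ
  refine integrable_tool ((qf_cont hc hd β).mul (by fun_prop)) ?_ ?_
  · set K := ‖β‖ ^ 3 * Real.exp |β.re| + ‖β‖ + 1 with hK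
    have hK0 : 0 ≤ ‖β‖ ^ 3 * Real.exp |β.re| := by positivity
    refine Asymptotics.IsBigO.of_bound
      ((K * (1 / (c * d) + (c / d + d / c)) + ‖κ‖ * (c + d)) * Real.exp (2 * ρ)) ?_
    filter_upwards [Ioo_mem_nhdsGT (zero_lt_one)] with y hy
    obtain ⟨hy, hy1⟩ := hy
    have hyc : (y:ℂ) ≠ 0 := by exact_mod_cast hy.ne'
    have hDc : ((c + d : ℝ):ℂ) ≠ 0 := by exact_mod_cast hD.ne'
    have e : qf c d β y = (1 / (y:ℂ)) * (Complex.sinh (β * y) /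
        (Complex.sinh ((c:ℂ) * y) * Complex.sinh ((d:ℂ) * y)) - β / ((c:ℂ) * d * y)) +
        κ * ((1 / (y:ℂ)) * (1 / (((c + d : ℝ):ℂ) * y) - 1 / Complex.sinh (((c + d : ℝ) : ℂ) * y))) := by
      have : β / ((c:ℂ) * d * y) = κ * (1 / (((c + d : ℝ):ℂ) * y)) := by
        rw [hκ]; push_cast; push_cast at hDc; field_simp
      rw [this, qf]; ring
    have b1 := Phi_bound (γ := |β.re|) (K := K) hc hd hy (P := Complex.sinh (β * y)) (lam := β)
      (fun _ => by
        refine (norm_sinh_sub_le _).trans ?_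
        rw [nb y hy, rb y hy, mul_pow, hK]
        have : |β.re| * y ≤ |β.re| := by nlinarith [abs_nonneg β.re]
        calc ‖β‖ ^ 3 * y ^ 3 * Real.exp (|β.re| * y) ≤ ‖β‖ ^ 3 * y ^ 3 * Real.exp (|β.re|) := by gcongr
          _ = (‖β‖ ^ 3 * Real.exp (|β.re|)) * y ^ 3 := by ring
          _ ≤ _ := by gcongr; linarith [norm_nonneg β])
      (by
        refine (norm_sinh_le_exp _).trans ?_
        rw [rb y hy]
        have : 1 ≤ K := by linarith [norm_nonneg β]
        nlinarith [Real.exp_pos (|β.re| * y)])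
      (by linarith [norm_nonneg β])
    have p1 : Phi c d |β.re| y = 1 / (c * d) + (c / d + d / c) := by
      unfold Phi
      rw [Set.indicator_of_mem (by exact ⟨hy, hy1.le⟩), Set.indicator_of_notMem (by simpa using hy1.le)]
      simp
    rw [p1] at b1
    have b2 := inv_sub_inv_sinh_c hD hy
    have b3 : ‖κ * ((1 / (y:ℂ)) * (1 / (((c + d : ℝ):ℂ) * y) -
        1 / Complex.sinh (((c + d : ℝ) : ℂ) * y)))‖ ≤ ‖κ‖ * (c + d) := by
      rw [norm_mul, norm_mul, norm_div (1:ℂ), norm_one, Complex.norm_real, Real.norm_of_nonneg hy.le]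
      gcongr
      calc _ ≤ 1 / y * ((c + d) * y) := by gcongr
        _ = _ := by field_simp
    have b4 : Real.exp (2 * ρ * y) ≤ Real.exp (2 * ρ) := Real.exp_le_exp.2 (by nlinarith)
    rw [norm_mul, Complex.norm_real, Real.norm_of_nonneg (Real.exp_pos _).le, norm_one, mul_one]
    gcongr
    rw [e]
    exact (norm_add_le _ _).trans (add_le_add b1 b3)
  · set m := c + d - |β.re| - 2 * ρ with hm
    have hm0 : 0 < m := by linarith
    refine Asymptotics.IsBigO.trans (g := fun y : ℝ => Real.exp (-m * y)) ?_
      (isLittleO_exp_neg_mul_rpow_atTop hm0 (-2)).isBigO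
    refine Asymptotics.IsBigO.of_bound ((2 + 1 / c) * (2 + 1 / d) + ‖κ‖ * (2 + 1 / (c + d))) ?_
    filter_upwards [Filter.eventually_ge_atTop 1] with y hy1
    have hy : 0 < y := by linarith
    have i1 := norm_inv_sinh_le_exp hc hy
    have i2 := norm_inv_sinh_le_exp hd hy
    have i3 := norm_inv_sinh_le_exp hD hy
    have yi : 1 / y ≤ 1 := by rw [div_le_one hy]; exact hy1
    have j1 : 1 / (c * y) ≤ 1 / c := one_div_le_one_div_of_le hc (by nlinarith)
    have j2 : 1 / (d * y) ≤ 1 / d := one_div_le_one_div_of_le hd (by nlinarith)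
    have j3 : 1 / ((c + d) * y) ≤ 1 / (c + d) := one_div_le_one_div_of_le hD (by nlinarith)
    have e : qf c d β y = (1 / (y:ℂ)) * (Complex.sinh (β * y) * (1 / Complex.sinh ((c:ℂ) * y)) *
      (1 / Complex.sinh ((d:ℂ) * y)) - κ * (1 / Complex.sinh (((c + d : ℝ) : ℂ) * y))) := by
      rw [qf]; simp only [div_eq_mul_inv, mul_inv]; ring
    have i4 := norm_sinh_le_exp (β * y)
    rw [rb y hy] at i4
    rw [norm_mul, Complex.norm_real, Real.norm_of_nonneg (Real.exp_pos _).le, 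
      Real.norm_of_nonneg (Real.exp_pos _).le, e, norm_mul, norm_div, norm_one, Complex.norm_real,
      Real.norm_of_nonneg hy.le]
    have k1 : Real.exp (|β.re| * y) * Real.exp (-(c * y)) * Real.exp (-(d * y)) * Real.exp (2 * ρ * y)
        = Real.exp (-m * y) := by
      rw [← Real.exp_add, ← Real.exp_add, ← Real.exp_add]; congr 1; rw [hm]; ring
    have k2 : Real.exp (-((c + d) * y)) * Real.exp (2 * ρ * y) ≤ Real.exp (-m * y) := by
      rw [← Real.exp_add]; apply Real.exp_le_exp.2; rw [hm]; nlinarith [abs_nonneg β.re]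
    calc _ ≤ 1 * (Real.exp (|β.re| * y) * (Real.exp (-(c * y)) * (2 + 1 / c)) *
          (Real.exp (-(d * y)) * (2 + 1 / d)) + ‖κ‖ * (Real.exp (-((c + d) * y)) * (2 + 1 / (c + d))))
          * Real.exp (2 * ρ * y) := by
          gcongr
          refine (norm_sub_le _ _).trans ?_
          rw [norm_mul, norm_mul, norm_mul]
          gcongr
          · exact i1.trans (by gcongr)
          · exact i2.trans (by gcongr)
          · exact i3.trans (by gcongr)
      _ = (2 + 1 / c) * (2 + 1 / d) * (Real.exp (|β.re| * y) * Real.exp (-(c * y)) *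
          Real.exp (-(d * y)) * Real.exp (2 * ρ * y)) + ‖κ‖ * (2 + 1 / (c + d)) *
          (Real.exp (-((c + d) * y)) * Real.exp (2 * ρ * y)) := by ring
      _ ≤ (2 + 1 / c) * (2 + 1 / d) * Real.exp (-m * y) + ‖κ‖ * (2 + 1 / (c + d)) *
          Real.exp (-m * y) := by rw [k1]; gcongr
      _ = _ := by ring

theorem log_rker {c d : ℝ} (hc : 0 < c) (hd : 0 < d) {β w : ℂ}
    (hw : 2 * |w.im| + |β.re| < c + d) :
    I * (ghyp c d (w - I * β / 2) - ghyp c d (w + I * β / 2)) =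
      (∫ y in Set.Ioi (0:ℝ), Complex.cos (2 * y * w) * qf c d β y)
        - (β * (c + d) / (c * d)) * ellD (c + d) w := by
  have hD : 0 < c + d := by positivity
  have hr1 := abs_le.1 (le_refl |w.im|)
  have hr2 := abs_le.1 (le_refl |β.re|)
  have i1 : (w - I * β / 2).im = w.im - β.re / 2 := by simp
  have i2 : (w + I * β / 2).im = w.im + β.re / 2 := by simp
  have h1 : |(w - I * β / 2).im| < (c + d) / 2 := by rw [i1, abs_lt]; constructor <;> linarith
  have h2 : |(w + I * β / 2).im| < (c + d) / 2 := by rw [i2, abs_lt]; constructor <;> linarith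
  have e : ∀ z, ghyp c d z = ∫ y in Set.Ioi (0:ℝ), gint c d z y := fun z => rfl
  rw [eq_sub_iff_add_eq, e, e, ← integral_sub (gint_int hc hd h1) (gint_int hc hd h2),
    ← integral_const_mul, ellD, ← integral_const_mul, ← integral_add]
  · refine setIntegral_congr_fun measurableSet_Ioi fun y hy => ?_
    have hy : 0 < y := hy
    have s1 := sinh_real_ne hc hy
    have s2 := sinh_real_ne hd hy
    have s3 := sinh_real_ne hD hy
    have hyc : (y:ℂ) ≠ 0 := by exact_mod_cast hy.ne'
    have hcc : (c:ℂ) ≠ 0 := by exact_mod_cast hc.ne'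
    have hdc : (d:ℂ) ≠ 0 := by exact_mod_cast hd.ne'
    have hDc : (c:ℂ) + d ≠ 0 := by exact_mod_cast hD.ne'
    have t1 : Complex.sin (2 * y * (w + I * β / 2)) = Complex.sin (2 * y * w) *
        Complex.cosh (β * y) + Complex.cos (2 * y * w) * (Complex.sinh (β * y) * I) := by
      rw [show 2 * (y:ℂ) * (w + I * β / 2) = 2 * y * w + (β * y) * I by ring, Complex.sin_add,
        Complex.cos_mul_I, Complex.sin_mul_I]
    have t2 : Complex.sin (2 * y * (w - I * β / 2)) = Complex.sin (2 * y * w) *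
        Complex.cosh (β * y) - Complex.cos (2 * y * w) * (Complex.sinh (β * y) * I) := by
      rw [show 2 * (y:ℂ) * (w - I * β / 2) = 2 * y * w - (β * y) * I by ring, Complex.sin_sub,
        Complex.cos_mul_I, Complex.sin_mul_I]
    simp only [gint, eint, qf, t1, t2]
    generalize Complex.sinh (((c + d : ℝ):ℂ) * y) = S3 at *
    generalize Complex.sinh ((c:ℂ) * y) = S1 at *
    generalize Complex.sinh ((d:ℂ) * y) = S2 at *
    generalize Complex.sinh (β * y) = S4 at *
    generalize Complex.sin (2 * (y:ℂ) * w) = s0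
    generalize Complex.cos (2 * (y:ℂ) * w) = c0
    generalize Complex.cosh (β * y) = C2
    push_cast
    field_simp
    linear_combination (-(y * c * d * S3 * S4 * c0 * 2) + β * 2 * S1 * S2 * S3) * I_sq
  · exact ((gint_int hc hd h1).sub (gint_int hc hd h2)).const_mul I
  · exact (eint_int hD (by linarith [abs_nonneg β.re])).const_mul _

theorem norm_sinh_le_cosh (z : ℂ) : ‖Complex.sinh z‖ ≤ Real.cosh z.re := by
  rw [Complex.sinh, norm_div, Real.cosh_eq, RCLike.norm_ofNat]
  gcongr
  refine (norm_sub_le _ _).trans ?_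
  rw [Complex.norm_exp, Complex.norm_exp]; simp

theorem norm_cosh_le_cosh (z : ℂ) : ‖Complex.cosh z‖ ≤ Real.cosh z.re := by
  rw [Complex.cosh, norm_div, Real.cosh_eq, RCLike.norm_ofNat]
  gcongr
  refine (norm_add_le _ _).trans ?_
  rw [Complex.norm_exp, Complex.norm_exp]; simp

theorem cosh_re_im (z : ℂ) : (Complex.cosh z).re = Real.cosh z.re * Real.cos z.im := by
    rw [← Complex.cos_mul_I, ← Complex.re_add_im z]
    generalize z.re = p
    generalize z.im = q
    rw [show ((p:ℂ) + q * I) * I = p * I - q by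
      rw [add_mul, mul_assoc, I_mul_I]; ring, Complex.cos_sub, Complex.cos_mul_I, Complex.sin_mul_I]
    simp [← Complex.ofReal_cosh, ← Complex.ofReal_sinh, ← Complex.ofReal_cos, ← Complex.ofReal_sin]

theorem ellD_real {D : ℝ} (hD : 0 < D) (t : ℝ) :
    ‖ellD D t - ((Real.pi * |t| / D : ℝ) : ℂ)‖ ≤ Real.log 2 := by
  obtain ⟨r, hr⟩ : ∃ r : ℝ, ellD D t = (r : ℂ) := by
    refine ⟨∫ y in Set.Ioi (0:ℝ), (1 / y) * (1 / (D * y) - Real.cos (2 * y * t) / Real.sinh (D * y)), ?_⟩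
    unfold ellD
    rw [← integral_complex_ofReal]
    congr 1; funext y; simp [eint]
  have h := ellD_exp hD (w := (t:ℂ)) (by simp; positivity)
  rw [hr] at h ⊢
  have h2 : Real.exp r = 2 * Real.cosh (Real.pi * t / D) := by exact_mod_cast h
  have h3 : Real.exp r = Real.exp (Real.pi * |t| / D) + Real.exp (-(Real.pi * |t| / D)) := by
    rw [h2, ← Real.cosh_abs, Real.cosh_eq]
    have : |Real.pi * t / D| = Real.pi * |t| / D := by
      rw [abs_div, abs_mul, abs_of_pos Real.pi_pos, abs_of_pos hD]
    rw [this]; ring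
  rw [← Complex.ofReal_sub, Complex.norm_real, Real.norm_eq_abs, abs_le]
  have hp : 0 ≤ Real.pi * |t| / D := by have := Real.pi_pos; positivity
  have hl := Real.log_pos (one_lt_two)
  constructor
  · have : Real.pi * |t| / D ≤ r := by
      rw [← Real.exp_le_exp, h3]; linarith [Real.exp_pos (-(Real.pi * |t| / D))]
    linarith
  · have : r ≤ Real.log 2 + Real.pi * |t| / D := by
      rw [← Real.exp_le_exp, h3, Real.exp_add, Real.exp_log two_pos]
      have : Real.exp (-(Real.pi * |t| / D)) ≤ Real.exp (Real.pi * |t| / D) :=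
        Real.exp_le_exp.2 (by linarith)
      linarith
    linarith

theorem ellD_bound {D ρ : ℝ} (hD : 0 < D) (hρ : ρ < D / 2) : ∃ C, ∀ w : ℂ, |w.im| ≤ ρ →
    ‖ellD D w - ((Real.pi * |w.re| / D : ℝ) : ℂ)‖ ≤ C := by
  have hpi := Real.pi_pos
  refine ⟨(Real.pi / D) * (1 / Real.cos (Real.pi * ρ / D)) * ρ + Real.log 2, fun w hw => ?_⟩
  have hρ0 : 0 ≤ ρ := (abs_nonneg _).trans hw
  have hlt : Real.pi * ρ / D < Real.pi / 2 := by rw [div_lt_iff₀ hD]; nlinarith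
  have hcos : 0 < Real.cos (Real.pi * ρ / D) := by
    apply Real.cos_pos_of_mem_Ioo
    have : 0 ≤ Real.pi * ρ / D := by positivity
    exact ⟨by linarith, hlt⟩
  have hd : ∀ z ∈ {z : ℂ | |z.im| ≤ ρ}, HasDerivWithinAt (ellD D)
      ((Real.pi / D) * Complex.tanh (Real.pi * z / D)) {z : ℂ | |z.im| ≤ ρ} z := fun z hz =>
    (ellD_deriv hD (lt_of_le_of_lt hz hρ)).hasDerivWithinAt
  have hb : ∀ z ∈ {z : ℂ | |z.im| ≤ ρ}, ‖(Real.pi / D : ℂ) * Complex.tanh (Real.pi * z / D)‖ ≤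
      (Real.pi / D) * (1 / Real.cos (Real.pi * ρ / D)) := by
    intro z hz
    have hz : |z.im| ≤ ρ := hz
    rw [← Complex.ofReal_div, norm_mul, Complex.norm_real, Real.norm_of_nonneg (by positivity)]
    gcongr
    rw [Complex.tanh_eq_sinh_div_cosh, norm_div]
    have him : (Real.pi * z / D).im = Real.pi * z.im / D := by
      rw [Complex.div_ofReal_im]; simp
    have h1 := norm_sinh_le_cosh (Real.pi * z / D)
    have h2 := (le_abs_self _).trans (Complex.abs_re_le_norm (Complex.cosh (Real.pi * z / D)))
    rw [cosh_re_im, him] at h2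
    have h3 : Real.cos (Real.pi * ρ / D) ≤ Real.cos (Real.pi * z.im / D) := by
      rw [← Real.cos_abs (Real.pi * z.im / D)]
      have e : |Real.pi * z.im / D| = Real.pi * |z.im| / D := by
        rw [abs_div, abs_mul, abs_of_pos hpi, abs_of_pos hD]
      rw [e]
      apply Real.cos_le_cos_of_nonneg_of_le_pi (by positivity) (by linarith)
      gcongr
    have hch := Real.cosh_pos (Real.pi * z / D).re
    rw [div_le_div_iff₀ (lt_of_lt_of_le (mul_pos hch (lt_of_lt_of_le hcos h3)) h2) hcos]
    nlinarith
  have := (convex_imband ρ).norm_image_sub_le_of_norm_hasDerivWithin_le hd hb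
    (x := (w.re : ℂ)) (y := w) (by simpa using hρ0) hw
  have e2 : ‖w - (w.re:ℂ)‖ ≤ ρ := by
    have : w - (w.re:ℂ) = w.im * I := by
      nth_rw 1 [← Complex.re_add_im w]; ring
    rw [this, norm_mul, norm_I, Complex.norm_real, mul_one]; exact hw
  have h4 := ellD_real hD w.re
  calc _ = ‖(ellD D w - ellD D w.re) + (ellD D w.re - ((Real.pi * |w.re| / D : ℝ) : ℂ))‖ := by
        congr 1; ring
    _ ≤ _ := (norm_add_le _ _).trans (add_le_add (this.trans (by gcongr)) h4)

theorem rker_eq_exp (ap am : ℝ) (β w : ℂ) : rker ap am β w =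
    Complex.exp (I * (ghyp ap am (w - I * β / 2) - ghyp ap am (w + I * β / 2))) := by
  rw [rker, Ghyp, Ghyp, ← Complex.exp_sub, mul_sub]

theorem rker_bound {c d : ℝ} (hc : 0 < c) (hd : 0 < d) {β : ℂ} {ρ : ℝ}
    (hρ : 2 * ρ + |β.re| < c + d) : ∃ C, 0 < C ∧ ∀ w : ℂ, |w.im| ≤ ρ →
    ‖rker c d β w‖ ≤ C * Real.exp (-(Real.pi * β.re / (c * d)) * |w.re|) := by
  rcases lt_or_ge ρ 0 with h0 | hρ0
  · exact ⟨1, one_pos, fun w hw => absurd ((abs_nonneg _).trans hw) (by linarith)⟩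
  have hD : 0 < c + d := by positivity
  have hcc : (c:ℂ) ≠ 0 := by exact_mod_cast hc.ne'
  have hdc : (d:ℂ) ≠ 0 := by exact_mod_cast hd.ne'
  have hDc : (c:ℂ) + d ≠ 0 := by exact_mod_cast hD.ne'
  obtain ⟨C, hC⟩ := ellD_bound (D := c + d) (ρ := ρ) hD (by linarith [abs_nonneg β.re])
  set κ := (β * (c + d) / (c * d)) with hκ
  set Q := ∫ y in Set.Ioi (0:ℝ), ‖qf c d β y * Real.exp (2 * ρ * y)‖ with hQ
  refine ⟨Real.exp (Q + ‖κ‖ * C), Real.exp_pos _, fun w hw => ?_⟩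
  rw [rker_eq_exp, log_rker hc hd (by linarith), Complex.norm_exp, ← Real.exp_add]
  apply Real.exp_le_exp.2
  have b1 : ‖∫ y in Set.Ioi (0:ℝ), Complex.cos (2 * y * w) * qf c d β y‖ ≤ Q := by
    refine norm_integral_le_of_norm_le (qf_int hc hd hρ0 hρ).norm ?_
    filter_upwards [ae_restrict_mem measurableSet_Ioi] with y hy
    have hy : 0 < y := hy
    have := norm_cos_le_exp (2 * y * w)
    rw [im_two_mul, abs_mul, abs_of_pos (by positivity : (0:ℝ) < 2 * y)] at this
    rw [norm_mul, norm_mul, Complex.norm_real, Real.norm_of_nonneg (Real.exp_pos _).le, mul_comm]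
    gcongr
    refine this.trans (Real.exp_le_exp.2 ?_)
    nlinarith
  have b2 := hC w hw
  have e : κ * ellD (c + d) w = κ * (ellD (c + d) w - ((Real.pi * |w.re| / (c + d) : ℝ) : ℂ)) +
      κ * ((Real.pi * |w.re| / (c + d) : ℝ) : ℂ) := by ring
  have e2 : (κ * ((Real.pi * |w.re| / (c + d) : ℝ) : ℂ)).re = (Real.pi * β.re / (c * d)) * |w.re| := by
    have : κ * ((Real.pi * |w.re| / (c + d) : ℝ) : ℂ) = ((Real.pi * |w.re| / (c * d) : ℝ) : ℂ) * β := by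
      rw [hκ]; push_cast; field_simp
    rw [this, Complex.re_ofReal_mul]; ring
  rw [← hκ, e, sub_re, add_re, e2]
  have a1 := (le_abs_self _).trans (Complex.abs_re_le_norm (∫ y in Set.Ioi (0:ℝ), Complex.cos (2 * y * w) * qf c d β y))
  have a2 := (neg_le_abs _).trans (Complex.abs_re_le_norm (κ * (ellD (c + d) w - ((Real.pi * |w.re| / (c + d) : ℝ) : ℂ))))
  rw [norm_mul] at a2
  have a3 : ‖κ‖ * ‖ellD (c + d) w - ((Real.pi * |w.re| / (c + d) : ℝ) : ℂ)‖ ≤ ‖κ‖ * C := by gcongr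
  linarith


theorem rker_symm (c d : ℝ) (β w : ℂ) : rker c d β w = rker d c β w := by
  unfold rker; rw [Ghyp_symm, Ghyp_symm c d]

theorem rker_even (c d : ℝ) (β w : ℂ) : rker c d β (-w) = rker c d β w := by
  unfold rker
  rw [show -w - I * β / 2 = -(w + I * β / 2) by ring, show -w + I * β / 2 = -(w - I * β / 2) by ring,
    Ghyp_neg, Ghyp_neg, inv_div_inv]

theorem Ghyp_diffAt {c d : ℝ} (hc : 0 < c) (hd : 0 < d) {z : ℂ} (hz : |z.im| < (c + d) / 2) :
    DifferentiableAt ℂ (Ghyp c d) z := by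
  unfold Ghyp
  exact (((ghyp_diff hc hd).differentiableAt ((isOpen_imband _).mem_nhds hz)).const_mul I).cexp

theorem rker_diffAt {c d : ℝ} (hc : 0 < c) (hd : 0 < d) {β w : ℂ}
    (hw : 2 * |w.im| + |β.re| < c + d) : DifferentiableAt ℂ (rker c d β) w := by
  have hr1 := abs_le.1 (le_refl |w.im|)
  have hr2 := abs_le.1 (le_refl |β.re|)
  have i1 : (w - I * β / 2).im = w.im - β.re / 2 := by simp
  have i2 : (w + I * β / 2).im = w.im + β.re / 2 := by simp
  have h1 : |(w - I * β / 2).im| < (c + d) / 2 := by rw [i1, abs_lt]; constructor <;> linarith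
  have h2 : |(w + I * β / 2).im| < (c + d) / 2 := by rw [i2, abs_lt]; constructor <;> linarith
  unfold rker
  refine DifferentiableAt.div ?_ ?_ (Ghyp_ne _ _ _)
  · exact DifferentiableAt.comp (f := fun w : ℂ => w - I * β / 2) (g := Ghyp c d) w
      (Ghyp_diffAt hc hd h1) (by fun_prop)
  · exact DifferentiableAt.comp (f := fun w : ℂ => w + I * β / 2) (g := Ghyp c d) w
      (Ghyp_diffAt hc hd h2) (by fun_prop)

theorem Ghyp_shift {c d : ℝ} (hc : 0 < c) (hd : 0 < d) {z : ℂ} (hz : |z.im| < c / 2) :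
    Ghyp c d (z + I * d / 2) = 2 * Complex.cosh (Real.pi * z / c) * Ghyp c d (z - I * d / 2) := by
  rw [← ellD_exp hc hz, ← ghyp_shift hc hd hz, Ghyp, Ghyp, ← Complex.exp_add]
  congr 1; ring

theorem rker_shift {c d : ℝ} (hc : 0 < c) (hd : 0 < d) {b w : ℂ}
    (hw : |w.im| + |b.re| / 2 < c / 2) :
    rker c d b (w - I * d / 2) * Complex.cosh (Real.pi * (w - I * b / 2) / c) =
    rker c d b (w + I * d / 2) * Complex.cosh (Real.pi * (w + I * b / 2) / c) := by
  have hr1 := abs_le.1 (le_refl |w.im|)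
  have hr2 := abs_le.1 (le_refl |b.re|)
  have i1 : (w - I * b / 2).im = w.im - b.re / 2 := by simp
  have i2 : (w + I * b / 2).im = w.im + b.re / 2 := by simp
  have h1 : |(w - I * b / 2).im| < c / 2 := by rw [i1, abs_lt]; constructor <;> linarith
  have h2 : |(w + I * b / 2).im| < c / 2 := by rw [i2, abs_lt]; constructor <;> linarith
  unfold rker
  rw [show w + I * d / 2 - I * b / 2 = (w - I * b / 2) + I * d / 2 by ring,
    show w + I * d / 2 + I * b / 2 = (w + I * b / 2) + I * d / 2 by ring,
    show w - I * d / 2 - I * b / 2 = (w - I * b / 2) - I * d / 2 by ring,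
    show w - I * d / 2 + I * b / 2 = (w + I * b / 2) - I * d / 2 by ring,
    Ghyp_shift hc hd h1, Ghyp_shift hc hd h2]
  have n1 := Ghyp_ne c d (w + I * b / 2 - I * d / 2)
  have n2 := cosh_ne hc h2
  generalize Ghyp c d (w + I * b / 2 - I * d / 2) = A1 at *
  generalize Ghyp c d (w - I * b / 2 - I * d / 2) = A2 at *
  generalize Complex.cosh (Real.pi * (w + I * b / 2) / c) = A3 at *
  field_simp

theorem cosh_quarter {c : ℝ} (hc : 0 < c) (v : ℂ) :
    Complex.cosh (Real.pi * (v - I * c / 2) / c) = -I * Complex.sinh (Real.pi * v / c) := by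
  have hcc : (c:ℂ) ≠ 0 := by exact_mod_cast hc.ne'
  rw [show (Real.pi * (v - I * c / 2) / c : ℂ) = Real.pi * v / c - (Real.pi / 2) * I by field_simp]
  rw [Complex.cosh_sub, Complex.cosh_mul_I, Complex.sinh_mul_I, Complex.cos_pi_div_two,
    Complex.sin_pi_div_two]
  ring

theorem cosh_quarter' {c : ℝ} (hc : 0 < c) (v : ℂ) :
    Complex.cosh (Real.pi * (v + I * c / 2) / c) = I * Complex.sinh (Real.pi * v / c) := by
  have hcc : (c:ℂ) ≠ 0 := by exact_mod_cast hc.ne'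
  rw [show (Real.pi * (v + I * c / 2) / c : ℂ) = Real.pi * v / c + (Real.pi / 2) * I by field_simp]
  rw [Complex.cosh_add, Complex.cosh_mul_I, Complex.sinh_mul_I, Complex.cos_pi_div_two,
    Complex.sin_pi_div_two]
  ring

open Filter Topology in
theorem sinh_rker {c d : ℝ} (hc : 0 < c) (hd : 0 < d) (t : ℝ) :
    Complex.sinh (Real.pi * t / d) * rker c d (c - d) t = Complex.sinh (Real.pi * t / c) := by
  have hm : |c - d| < c + d := by rw [abs_lt]; constructor <;> linarith
  set f : ℂ → ℂ := fun w => Complex.cosh (Real.pi * (w - I * d / 2) / d) * rker c d (c - d) w -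
    Complex.cosh (Real.pi * (w - I * c / 2) / c) with hf
  have hcont : ContinuousAt f t := by
    refine ContinuousAt.sub (ContinuousAt.mul (by fun_prop) ?_) (by fun_prop)
    refine (rker_diffAt hc hd ?_).continuousAt
    simpa using hm
  have hz : ∀ᶠ ε : ℝ in 𝓝[>] 0, f (t + I * ε) = 0 := by
    filter_upwards [Ioo_mem_nhdsGT (lt_min hc hd)] with ε hε
    have h1 := hε.1
    have h2 : ε < c := hε.2.trans_le (min_le_left _ _)
    have h3 : ε < d := hε.2.trans_le (min_le_right _ _)
    have g1 := Ghyp_shift hc hd (z := t + I * ε - I * c / 2) (by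
      simp [abs_lt]; constructor <;> linarith)
    have g2 := Ghyp_shift hd hc (z := t + I * ε - I * d / 2) (by
      simp [abs_lt]; constructor <;> linarith)
    rw [Ghyp_symm d c, Ghyp_symm d c] at g2
    have k1 : (t:ℂ) + I * ε - I * c / 2 - I * d / 2 = t + I * ε - I * d / 2 - I * c / 2 := by ring
    rw [k1] at g1
    simp only [hf]
    rw [rker, show (t:ℂ) + I * ε - I * (c - d) / 2 = t + I * ε - I * c / 2 + I * d / 2 by ring,
      show (t:ℂ) + I * ε + I * (c - d) / 2 = t + I * ε - I * d / 2 + I * c / 2 by ring, sub_eq_zero,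
      ← mul_div_assoc, div_eq_iff (Ghyp_ne _ _ _), g1, g2]
    ring
  have hl : Tendsto (fun ε : ℝ => f (t + I * ε)) (𝓝[>] 0) (𝓝 (f t)) := by
    refine hcont.tendsto.comp ?_
    have : Continuous (fun ε : ℝ => (t:ℂ) + I * ε) := by fun_prop
    have h := this.tendsto 0
    simp only [ofReal_zero, mul_zero, add_zero] at h
    exact h.mono_left nhdsWithin_le_nhds
  have h0 : f t = 0 := tendsto_nhds_unique hl ((tendsto_congr' hz).2 tendsto_const_nhds)
  simp only [hf] at h0
  rw [cosh_quarter hc, cosh_quarter hd] at h0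
  have : (-I) * (Complex.sinh (Real.pi * t / d) * rker c d (c - d) t - Complex.sinh (Real.pi * t / c)) = 0 := by
    linear_combination h0
  rcases mul_eq_zero.1 this with h | h
  · simp at h
  · linear_combination h

theorem wfun_eq {c d : ℝ} (hc : 0 < c) (hd : 0 < d) (b : ℂ) (t : ℝ) :
    wfun c d b t = 4 * Complex.sinh (Real.pi * t / c) * Complex.sinh (Real.pi * t / d) *
      rker c d (c + d - 2 * b) t := by
  rw [← sinh_rker hc hd t]
  unfold wfun rker
  rw [show -(t:ℂ) + I * ((d - c : ℝ) : ℂ) / 2 = -((t:ℂ) + I * (c - d) / 2) by push_cast; ring,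
    show -(t:ℂ) + I * (((c + d) / 2 : ℝ) : ℂ) - I * b = -((t:ℂ) - I * (c + d - 2 * b) / 2) by
      push_cast; ring,
    show (t:ℂ) + I * ((d - c : ℝ) : ℂ) / 2 = (t:ℂ) - I * (c - d) / 2 by push_cast; ring,
    show (t:ℂ) + I * (((c + d) / 2 : ℝ) : ℂ) - I * b = (t:ℂ) + I * (c + d - 2 * b) / 2 by
      push_cast; ring, Ghyp_neg, Ghyp_neg]
  have n1 := Ghyp_ne c d ((t:ℂ) + I * (c - d) / 2)
  have n2 := Ghyp_ne c d ((t:ℂ) + I * (c + d - 2 * b) / 2)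
  have n3 := Ghyp_ne c d ((t:ℂ) - I * (c + d - 2 * b) / 2)
  push_cast
  field_simp

theorem wfun_symm {c d : ℝ} (hc : 0 < c) (hd : 0 < d) (b : ℂ) (t : ℝ) :
    wfun c d b t = wfun d c b t := by
  rw [wfun_eq hc hd, wfun_eq hd hc, rker_symm, add_comm (c:ℂ) d]; ring

theorem alphaPar_symm (c d : ℝ) : alphaPar c d = alphaPar d c := by
  unfold alphaPar; rw [mul_comm c d]

theorem Jrec_symm {c d : ℝ} (hc : 0 < c) (hd : 0 < d) (b : ℂ) :
    ∀ (N : ℕ) (x y : Fin N → ℝ), Jrec c d b N x y = Jrec d c b N x y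
  | 0, _, _ => rfl
  | 1, x, y => by rw [Jrec, Jrec, alphaPar_symm]
  | (N + 2), x, y => by
    rw [Jrec, Jrec, alphaPar_symm]
    congr 2; funext z
    rw [Jrec_symm hc hd b (N + 1)]
    simp_rw [wfun_symm hc hd b, fun w => rker_symm c d b w]

theorem wfun_even {c d : ℝ} (hc : 0 < c) (hd : 0 < d) (b : ℂ) (t : ℝ) :
    wfun c d b (-t) = wfun c d b t := by
  rw [wfun_eq hc hd, wfun_eq hc hd, ofReal_neg, rker_even]
  simp only [mul_neg, neg_div, Complex.sinh_neg]; ring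

theorem wfun_cont {c d : ℝ} (hc : 0 < c) (hd : 0 < d) {b : ℂ} (hb0 : 0 < b.re) (hb : b.re < c + d) :
    Continuous (wfun c d b) := by
  have e : wfun c d b = fun t : ℝ => 4 * Complex.sinh (Real.pi * t / c) * Complex.sinh (Real.pi * t / d) *
      rker c d (c + d - 2 * b) t := funext fun t => wfun_eq hc hd b t
  rw [e]
  refine Continuous.mul (by fun_prop) ?_
  rw [continuous_iff_continuousAt]
  intro t
  have : ContinuousAt (rker c d (c + d - 2 * b)) t := by
    refine (rker_diffAt hc hd ?_).continuousAt
    have : |c + d - 2 * b.re| < c + d := by rw [abs_lt]; constructor <;> linarith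
    simpa using this
  exact ContinuousAt.comp (f := fun t : ℝ => (t:ℂ)) this (by fun_prop)

theorem norm_sinh_pi_le {c : ℝ} (hc : 0 < c) (v : ℂ) :
    ‖Complex.sinh (Real.pi * v / c)‖ ≤ Real.exp (Real.pi / c * |v.re|) := by
  refine (norm_sinh_le_exp _).trans (le_of_eq ?_)
  have : (Real.pi * v / c).re = Real.pi / c * v.re := by
    rw [Complex.div_ofReal_re]; simp; ring
  rw [this, abs_mul, abs_of_pos (by have := Real.pi_pos; positivity)]

theorem norm_cosh_pi_le {c : ℝ} (hc : 0 < c) (v : ℂ) :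
    ‖Complex.cosh (Real.pi * v / c)‖ ≤ Real.exp (Real.pi / c * |v.re|) := by
  have h := (norm_cos_le_exp ((Real.pi * v / c) * I))
  rw [Complex.cos_mul_I] at h
  refine h.trans (le_of_eq ?_)
  have : (Real.pi * v / c * I).im = Real.pi / c * v.re := by
    rw [Complex.mul_I_im, Complex.div_ofReal_re]; simp; ring
  rw [this, abs_mul, abs_of_pos (by have := Real.pi_pos; positivity)]

/-- the decay exponent -/
noncomputable def kap (c d : ℝ) (b : ℂ) : ℝ := 2 * Real.pi * b.re / (c * d)

theorem wfun_bound {c d : ℝ} (hc : 0 < c) (hd : 0 < d) {b : ℂ} (hb0 : 0 < b.re) (hb : b.re < c + d) :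
    ∃ C, 0 < C ∧ ∀ t : ℝ, ‖wfun c d b t‖ ≤ C * Real.exp (kap c d b * |t|) := by
  obtain ⟨C, hC, h⟩ := rker_bound hc hd (β := c + d - 2 * b) (ρ := 0) (by
    have : |c + d - 2 * b.re| < c + d := by rw [abs_lt]; constructor <;> linarith
    simpa using this)
  refine ⟨4 * C, by positivity, fun t => ?_⟩
  have h1 := h t (by simp)
  have h2 := norm_sinh_pi_le hc t
  have h3 := norm_sinh_pi_le hd t
  rw [wfun_eq hc hd, norm_mul, norm_mul, norm_mul, RCLike.norm_ofNat]
  simp only [ofReal_re] at h1 h2 h3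
  calc _ ≤ 4 * Real.exp (Real.pi / c * |t|) * Real.exp (Real.pi / d * |t|) *
        (C * Real.exp (-(Real.pi * (c + d - 2 * b : ℂ).re / (c * d)) * |t|)) := by gcongr
    _ = 4 * C * (Real.exp (Real.pi / c * |t|) * Real.exp (Real.pi / d * |t|) *
        Real.exp (-(Real.pi * (c + d - 2 * b : ℂ).re / (c * d)) * |t|)) := by ring
    _ = _ := by
      rw [← Real.exp_add, ← Real.exp_add]; congr 2
      simp [kap]; field_simp; ring

noncomputable def Theta (c d : ℝ) (b : ℂ) (v : ℂ) : ℂ :=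
  2 * Complex.cosh (Real.pi * v / d) * rker c d (c - 2 * b) v

theorem Theta_even (c d : ℝ) (b v : ℂ) : Theta c d b (-v) = Theta c d b v := by
  unfold Theta; rw [rker_even]; simp only [mul_neg, neg_div, Complex.cosh_neg]

theorem Theta_diffAt {c d : ℝ} (hc : 0 < c) (hd : 0 < d) {b v : ℂ}
    (hv : 2 * |v.im| + |c - 2 * b.re| < c + d) : DifferentiableAt ℂ (Theta c d b) v := by
  unfold Theta
  refine DifferentiableAt.mul (by fun_prop) (rker_diffAt hc hd ?_)
  simpa using hv

theorem Theta_bound {c d : ℝ} (hc : 0 < c) (hd : 0 < d) {b : ℂ} {ρ : ℝ}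
    (hρ : 2 * ρ + |c - 2 * b.re| < c + d) : ∃ C, 0 < C ∧ ∀ v : ℂ, |v.im| ≤ ρ →
    ‖Theta c d b v‖ ≤ C * Real.exp (kap c d b * |v.re|) := by
  obtain ⟨C, hC, h⟩ := rker_bound hc hd (β := c - 2 * b) (ρ := ρ) (by simpa using hρ)
  refine ⟨2 * C, by positivity, fun v hv => ?_⟩
  have h1 := h v hv
  have h2 := norm_cosh_pi_le hd v
  rw [Theta, norm_mul, norm_mul, RCLike.norm_ofNat]
  calc _ ≤ 2 * Real.exp (Real.pi / d * |v.re|) *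
        (C * Real.exp (-(Real.pi * (c - 2 * b : ℂ).re / (c * d)) * |v.re|)) := by gcongr
    _ = 2 * C * (Real.exp (Real.pi / d * |v.re|) *
        Real.exp (-(Real.pi * (c - 2 * b : ℂ).re / (c * d)) * |v.re|)) := by ring
    _ = _ := by
      rw [← Real.exp_add]; congr 2
      simp [kap]; field_simp; ring

theorem sinh_pi_ne {c : ℝ} (hc : 0 < c) {t : ℝ} (ht : t ≠ 0) : Complex.sinh (Real.pi * t / c) ≠ 0 := by
  have : Real.sinh (Real.pi * t / c) ≠ 0 := by
    rw [Ne, Real.sinh_eq_zero]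
    have := Real.pi_pos
    positivity
  exact_mod_cast this

theorem wfun_Theta_minus {c d : ℝ} (hc : 0 < c) (hd : 0 < d) {b : ℂ} (hb0 : 0 < b.re) (hb : b.re < c)
    {t : ℝ} (ht : t ≠ 0) :
    wfun c d b t * (Complex.sinh (Real.pi * (t - I * b) / c) / Complex.sinh (Real.pi * t / c)) =
      Theta c d b (t - I * d / 2) := by
  have hs := sinh_pi_ne hc ht
  have g := Ghyp_shift hc hd (z := t - I * b + I * c / 2) (by
      simp [abs_lt]; constructor <;> linarith)
  rw [cosh_quarter' hc] at g
  rw [wfun_eq hc hd, Theta, cosh_quarter hd, rker, rker,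
    show (t:ℂ) - I * (c + d - 2 * b) / 2 = t - I * d / 2 - I * (c - 2 * b) / 2 by ring,
    show (t:ℂ) + I * (c + d - 2 * b) / 2 = t - I * b + I * c / 2 + I * d / 2 by ring, g,
    show (t:ℂ) - I * d / 2 + I * (c - 2 * b) / 2 = t - I * b + I * c / 2 - I * d / 2 by ring]
  have n1 := Ghyp_ne c d ((t:ℂ) - I * b + I * c / 2 - I * d / 2)
  rcases eq_or_ne (Complex.sinh (Real.pi * (t - I * b) / c)) 0 with h0 | h0
  · exfalso
    have gn := Ghyp_ne c d ((t:ℂ) - I * b + I * c / 2 + I * d / 2)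
    rw [g, h0] at gn; simp at gn
  · have hI := I_ne_zero
    generalize Ghyp c d ((t:ℂ) - I * b + I * c / 2 - I * d / 2) = A1 at *
    generalize Ghyp c d ((t:ℂ) - I * d / 2 - I * (c - 2 * b) / 2) = A2 at *
    generalize Complex.sinh (Real.pi * (t - I * b) / c) = A3 at *
    field_simp
    linear_combination (4 * Complex.sinh (Real.pi * t / d) * A2) * I_sq

theorem wfun_Theta_plus {c d : ℝ} (hc : 0 < c) (hd : 0 < d) {b : ℂ} (hb0 : 0 < b.re) (hb : b.re < c)
    {t : ℝ} (ht : t ≠ 0) :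
    wfun c d b t * (Complex.sinh (Real.pi * (t + I * b) / c) / Complex.sinh (Real.pi * t / c)) =
      Theta c d b (t + I * d / 2) := by
  have := wfun_Theta_minus hc hd hb0 hb (neg_ne_zero.2 ht)
  rw [wfun_even hc hd, show ((-t:ℝ):ℂ) - I * d / 2 = -(t + I * d / 2) by push_cast; ring, Theta_even] at this
  rw [← this]
  rw [show ((-t:ℝ):ℂ) - I * b = -(t + I * b) by push_cast; ring, ofReal_neg]
  simp only [mul_neg, neg_div, Complex.sinh_neg, div_neg, neg_neg]


section kernelid

lemma pairs_prod {n : ℕ} (T : Finset (Fin n)) (c : Fin n → Fin n → ℂ) :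
    ∏ m ∈ T, ∏ l ∈ Tᶜ, c m l =
      ∏ q ∈ Finset.univ.filter (fun q : Fin n × Fin n => q.1 < q.2),
        (if q.1 ∈ T ∧ q.2 ∉ T then c q.1 q.2 else
          if q.2 ∈ T ∧ q.1 ∉ T then c q.2 q.1 else 1) := by
  classical
  set g : Fin n × Fin n → ℂ := fun q => if q.1 ∈ T ∧ q.2 ∉ T then c q.1 q.2 else 1 with hg
  have h1 : ∏ m ∈ T, ∏ l ∈ Tᶜ, c m l = ∏ q : Fin n × Fin n, g q := by
    rw [← Finset.prod_product' T Tᶜ c]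
    rw [Finset.prod_ite]
    simp only [Finset.prod_const_one, mul_one]
    refine Finset.prod_congr ?_ (fun _ _ => rfl)
    ext q; simp
  have h2 : ∏ q : Fin n × Fin n, g q =
      (∏ q ∈ Finset.univ.filter (fun q : Fin n × Fin n => q.1 < q.2), g q) *
      ∏ q ∈ Finset.univ.filter (fun q : Fin n × Fin n => ¬ q.1 < q.2), g q := by
    rw [Finset.prod_filter_mul_prod_filter_not]
  have h3 : ∏ q ∈ Finset.univ.filter (fun q : Fin n × Fin n => ¬ q.1 < q.2), g q =
      ∏ q ∈ Finset.univ.filter (fun q : Fin n × Fin n => q.2 < q.1), g q := by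
    symm
    apply Finset.prod_subset
    · intro q; simp only [Finset.mem_filter, Finset.mem_univ, true_and]; intro h; exact not_lt.mpr h.le
    · intro q hq hq2
      simp only [Finset.mem_filter, Finset.mem_univ, true_and, not_lt] at hq hq2
      have : q.1 = q.2 := le_antisymm hq2 hq
      simp [hg, this]
  have h4 : ∏ q ∈ Finset.univ.filter (fun q : Fin n × Fin n => q.2 < q.1), g q =
      ∏ q ∈ Finset.univ.filter (fun q : Fin n × Fin n => q.1 < q.2), g q.swap := by
    refine Finset.prod_equiv (Equiv.prodComm _ _) ?_ ?_
    · intro q; simp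
    · intro q _; simp
  rw [h1, h2, h3, h4, ← Finset.prod_mul_distrib]
  refine Finset.prod_congr rfl fun q _ => ?_
  simp only [hg, Prod.fst_swap, Prod.snd_swap]
  by_cases h : q.1 ∈ T <;> by_cases h' : q.2 ∈ T <;> simp [h, h']

lemma prod_Ioi_filter {n : ℕ} (h : Fin n → Fin n → ℂ) :
    ∏ i : Fin n, ∏ j ∈ Finset.Ioi i, h i j =
      ∏ q ∈ Finset.univ.filter (fun q : Fin n × Fin n => q.1 < q.2), h q.1 q.2 := by
  rw [Finset.prod_sigma']
  refine Finset.prod_bij' (fun s _ => (s.1, s.2)) (fun q _ => ⟨q.1, q.2⟩) ?_ ?_ ?_ ?_ ?_ <;>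
    simp

noncomputable def LM {n : ℕ} (p q : Fin n → ℂ) : Matrix (Fin n) (Fin n) ℂ :=
  Matrix.of fun k j => ∑ t ∈ Finset.powersetCard (k : ℕ) (Finset.univ.erase j),
    (∏ l ∈ t, p l) * ∏ l ∈ (Finset.univ.erase j) \ t, (-q l)

noncomputable def EM {n : ℕ} (v w p q : Fin n → ℂ) : Matrix (Fin n) (Fin n) ℂ :=
  Matrix.of fun i j => ∏ l ∈ Finset.univ.erase j, (v i * p l - w i * q l)

noncomputable def AM {n : ℕ} (v w p q : Fin n → ℂ) : Matrix (Fin n) (Fin n) ℂ :=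
  Matrix.of fun i j => (v i * p j - w i * q j)⁻¹

lemma EM_eq {n : ℕ} (v w p q : Fin n → ℂ) :
    EM v w p q = Matrix.projVandermonde v w * LM p q := by
  classical
  ext i j
  rw [Matrix.mul_apply]
  simp only [EM, LM, Matrix.of_apply, Matrix.projVandermonde_apply]
  have h0 : ∀ l ∈ Finset.univ.erase j, v i * p l - w i * q l = v i * p l + w i * (-q l) := by
    intros; ring
  rw [Finset.prod_congr rfl h0, Finset.prod_add, Finset.sum_powerset]
  have hc : (Finset.univ.erase j).card + 1 = n := by
    rw [Finset.card_erase_add_one (Finset.mem_univ j)]; simp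
  rw [hc, Finset.sum_range]
  refine Finset.sum_congr rfl fun k _ => ?_
  rw [Finset.mul_sum]
  refine Finset.sum_congr rfl fun t ht => ?_
  rw [Finset.mem_powersetCard] at ht
  rw [Finset.prod_mul_distrib, Finset.prod_mul_distrib, Finset.prod_const, Finset.prod_const,
    Finset.card_sdiff_of_subset ht.1, ht.2]
  have : ((Finset.univ.erase j).card - (k : ℕ)) = (Fin.rev k : ℕ) := by
    rw [Fin.val_rev]; omega
  rw [this]; ring

noncomputable def PV {n : ℕ} (v w : Fin n → ℂ) : ℂ :=
  ∏ q ∈ Finset.univ.filter (fun q : Fin n × Fin n => q.1 < q.2), (v q.2 * w q.1 - v q.1 * w q.2)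

lemma detAM {n : ℕ} (v w p q : Fin n → ℂ) (h : ∀ i j, v i * p j - w i * q j ≠ 0) :
    (AM v w p q).det = PV v w * (LM p q).det * (∏ i, ∏ j, (v i * p j - w i * q j))⁻¹ := by
  classical
  have h1 : AM v w p q = Matrix.diagonal (fun i => (∏ l, (v i * p l - w i * q l))⁻¹) * EM v w p q := by
    ext i j
    rw [Matrix.diagonal_mul]
    simp only [AM, EM, Matrix.of_apply]
    rw [← Finset.mul_prod_erase Finset.univ _ (Finset.mem_univ j), mul_inv]
    have : ∏ l ∈ Finset.univ.erase j, (v i * p l - w i * q l) ≠ 0 :=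
      Finset.prod_ne_zero_iff.mpr fun l _ => h i l
    field_simp
  rw [h1, Matrix.det_mul, Matrix.det_diagonal, EM_eq, Matrix.det_mul, Matrix.det_projVandermonde,
    Finset.prod_inv_distrib, prod_Ioi_filter (fun i j => v j * w i - v i * w j)]
  unfold PV
  ring

lemma detLM_ne {n : ℕ} (p q : Fin n → ℂ) (h : ∀ i j, i ≠ j → q i * p j - p i * q j ≠ 0) :
    (LM p q).det ≠ 0 := by
  classical
  intro h0
  have h1 : (EM q p p q).det = 0 := by rw [EM_eq, Matrix.det_mul, h0, mul_zero]
  have h2 : EM q p p q = Matrix.diagonal (fun i => ∏ l ∈ Finset.univ.erase i, (q i * p l - p i * q l)) := by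
    ext i j
    simp only [EM, Matrix.of_apply]
    by_cases hij : i = j
    · subst hij; simp
    · rw [Matrix.diagonal_apply_ne _ hij]
      refine Finset.prod_eq_zero (i := i) (by simp [hij]) (by ring)
  rw [h2, Matrix.det_diagonal] at h1
  revert h1
  apply Finset.prod_ne_zero_iff.mpr
  intro i _
  apply Finset.prod_ne_zero_iff.mpr
  intro l hl
  exact h i l (by simpa [eq_comm] using hl)

lemma AM_transpose {n : ℕ} (v w p q : Fin n → ℂ) : (AM v w p q).transpose = AM p q v w := by
  ext i j; simp only [AM, Matrix.transpose_apply, Matrix.of_apply]; congr 1; ring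

lemma det_expand {n : ℕ} (A B : Fin n → Fin n → ℂ) (u : ℂ) :
    (Matrix.of A + u • Matrix.of B).det =
      ∑ T : Finset (Fin n), u ^ T.card * (Matrix.of (T.piecewise B A)).det := by
  classical
  have h := (Matrix.detRowAlternating (n := Fin n) (R := ℂ)).toMultilinearMap.map_add_univ (u • B) A
  have e1 : (Matrix.of A + u • Matrix.of B).det = (Matrix.detRowAlternating (n := Fin n) (R := ℂ)).toMultilinearMap (u • B + A) := by
    rw [add_comm]; rfl
  refine e1.trans (h.trans ?_)
  refine Finset.sum_congr rfl fun T _ => ?_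
  have e2 : T.piecewise (u • B) A =
      T.piecewise (fun i => u • (T.piecewise B A) i) (T.piecewise B A) := by
    ext i j
    by_cases hi : i ∈ T <;> simp [hi]
  rw [e2, MultilinearMap.map_piecewise_smul]
  simp only [Finset.prod_const, smul_eq_mul]
  rfl

noncomputable def RT {n n' : ℕ} (τ : ℂ) (v w : Fin n → ℂ) (p q : Fin n' → ℂ) (T : Finset (Fin n)) : ℂ :=
  (∏ m ∈ T, ∏ l ∈ Tᶜ, (v m * τ⁻¹ * w l - v l * (w m * τ)) / (v m * w l - v l * w m)) *
    ∏ m ∈ T, ∏ j, (v m * p j - w m * q j) / (v m * τ⁻¹ * p j - w m * τ * q j)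

lemma row_ratio {n : ℕ} {τ : ℂ} (hτ : τ ≠ 0) (v w p q : Fin n → ℂ)
    (h : ∀ i j, v i * p j - w i * q j ≠ 0) (h' : ∀ i j, v i * τ⁻¹ * p j - w i * τ * q j ≠ 0)
    (hx : ∀ i j, i ≠ j → v i * w j - v j * w i ≠ 0) (T : Finset (Fin n)) :
    (AM (T.piecewise (fun i => v i * τ⁻¹) v) (T.piecewise (fun i => w i * τ) w) p q).det =
      (AM v w p q).det * RT τ v w p q T := by
  classical
  set v' := T.piecewise (fun i => v i * τ⁻¹) v with hv'
  set w' := T.piecewise (fun i => w i * τ) w with hw'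
  have hb : ∀ i j, v' i * p j - w' i * q j ≠ 0 := by
    intro i j
    by_cases hi : i ∈ T
    · simpa [hv', hw', hi] using h' i j
    · simpa [hv', hw', hi] using h i j
  rw [detAM _ _ _ _ hb, detAM _ _ _ _ h]
  have hPV : PV v' w' = PV v w *
      ∏ m ∈ T, ∏ l ∈ Tᶜ, (v m * τ⁻¹ * w l - v l * (w m * τ)) / (v m * w l - v l * w m) := by
    rw [pairs_prod T (fun m l => (v m * τ⁻¹ * w l - v l * (w m * τ)) / (v m * w l - v l * w m))]
    unfold PV
    rw [← Finset.prod_mul_distrib]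
    refine Finset.prod_congr rfl fun a ha => ?_
    simp only [Finset.mem_filter, Finset.mem_univ, true_and] at ha
    have n1 := hx a.1 a.2 ha.ne
    have n2 := hx a.2 a.1 ha.ne'
    by_cases h1 : a.1 ∈ T <;> by_cases h2 : a.2 ∈ T <;> simp only [hv', hw', h1, h2,
      Finset.piecewise_eq_of_mem, Finset.piecewise_eq_of_notMem, not_true_eq_false,
      not_false_eq_true, and_true, and_false, if_true, if_false, and_self]
    · field_simp
    · rw [mul_div_assoc', eq_div_iff n1]; ring
    · rw [mul_div_assoc', eq_div_iff n2]; ring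
    · simp
  have hBr : (∏ i, ∏ j, (v' i * p j - w' i * q j))⁻¹ = (∏ i, ∏ j, (v i * p j - w i * q j))⁻¹ *
      ∏ m ∈ T, ∏ j, (v m * p j - w m * q j) / (v m * τ⁻¹ * p j - w m * τ * q j) := by
    rw [← Finset.prod_inv_distrib, ← Finset.prod_inv_distrib]
    have : ∏ m ∈ T, ∏ j, (v m * p j - w m * q j) / (v m * τ⁻¹ * p j - w m * τ * q j) =
        ∏ m, (if m ∈ T then ∏ j, (v m * p j - w m * q j) / (v m * τ⁻¹ * p j - w m * τ * q j) else 1) := by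
      rw [Finset.prod_ite_mem, Finset.univ_inter]
    rw [this, ← Finset.prod_mul_distrib]
    refine Finset.prod_congr rfl fun m _ => ?_
    by_cases hm : m ∈ T
    · simp only [hv', hw', hm, Finset.piecewise_eq_of_mem, if_true]
      rw [← Finset.prod_inv_distrib, ← Finset.prod_inv_distrib, ← Finset.prod_mul_distrib]
      refine Finset.prod_congr rfl fun j _ => ?_
      have := h m j
      field_simp
    · simp [hv', hw', hm]
  rw [hPV, hBr, RT]
  ring

lemma det_row_expand {n : ℕ} {τ : ℂ} (hτ : τ ≠ 0) (v w p q : Fin n → ℂ)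
    (h : ∀ i j, v i * p j - w i * q j ≠ 0) (h' : ∀ i j, v i * τ⁻¹ * p j - w i * τ * q j ≠ 0)
    (hx : ∀ i j, i ≠ j → v i * w j - v j * w i ≠ 0) (u : ℂ) :
    (AM v w p q + u • AM (fun i => v i * τ⁻¹) (fun i => w i * τ) p q).det =
      (AM v w p q).det * ∑ T : Finset (Fin n), u ^ T.card * RT τ v w p q T := by
  classical
  have := det_expand (fun i j => (v i * p j - w i * q j)⁻¹)
    (fun i j => (v i * τ⁻¹ * p j - w i * τ * q j)⁻¹) u
  refine this.trans ?_
  rw [Finset.mul_sum]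
  refine Finset.sum_congr rfl fun T _ => ?_
  have e := row_ratio hτ v w p q h h' hx T
  rw [mul_left_comm, ← e]
  congr 2
  ext i j
  by_cases hi : i ∈ T <;> simp [AM, hi]

lemma coeff_cmp {n : ℕ} (f g : Finset (Fin n) → ℂ)
    (h : ∀ u : ℂ, ∑ T : Finset (Fin n), u ^ T.card * f T = ∑ T : Finset (Fin n), u ^ T.card * g T)
    (k : ℕ) : ∑ T ∈ Finset.powersetCard k Finset.univ, f T =
      ∑ T ∈ Finset.powersetCard k Finset.univ, g T := by
  classical
  have key : ∀ f : Finset (Fin n) → ℂ, ∑ T ∈ Finset.powersetCard k Finset.univ, f T =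
      (∑ T : Finset (Fin n), Polynomial.C (f T) * Polynomial.X ^ T.card).coeff k := by
    intro f
    rw [Polynomial.finsetSum_coeff]
    simp only [Polynomial.coeff_C_mul_X_pow]
    rw [← Finset.sum_filter]
    refine Finset.sum_congr ?_ (fun _ _ => rfl)
    ext T; simp [Finset.mem_powersetCard, eq_comm]
  rw [key, key]
  congr 1
  refine Polynomial.funext fun u => ?_
  simp only [Polynomial.eval_finsetSum, Polynomial.eval_mul, Polynomial.eval_C, Polynomial.eval_pow,
    Polynomial.eval_X]
  simpa [mul_comm] using h u

lemma balanced {n : ℕ} {τ : ℂ} (hτ : τ ≠ 0) (v w p q : Fin n → ℂ)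
    (h : ∀ i j, v i * p j - w i * q j ≠ 0) (h' : ∀ i j, v i * τ⁻¹ * p j - w i * τ * q j ≠ 0)
    (hx : ∀ i j, i ≠ j → v i * w j - v j * w i ≠ 0)
    (hy : ∀ i j, i ≠ j → p i * q j - p j * q i ≠ 0) (k : ℕ) :
    ∑ T ∈ Finset.powersetCard k Finset.univ, RT τ v w p q T =
      ∑ T ∈ Finset.powersetCard k Finset.univ, RT τ p q v w T := by
  apply coeff_cmp
  intro u
  have hD : (AM v w p q).det ≠ 0 := by
    rw [detAM _ _ _ _ h]
    refine mul_ne_zero (mul_ne_zero ?_ (detLM_ne p q ?_)) (inv_ne_zero ?_)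
    · unfold PV
      apply Finset.prod_ne_zero_iff.mpr
      intro a ha
      simp only [Finset.mem_filter, Finset.mem_univ, true_and] at ha
      exact hx _ _ ha.ne'
    · intro i j hij
      have := hy j i hij.symm
      intro h0; apply this; linear_combination h0
    · exact Finset.prod_ne_zero_iff.mpr fun i _ => Finset.prod_ne_zero_iff.mpr fun j _ => h i j
  have e1 := det_row_expand hτ v w p q h h' hx u
  have e2 := det_row_expand hτ p q v w (fun i j h0 => h j i (by linear_combination h0))
    (fun i j h0 => h' j i (by linear_combination h0)) hy u
  have e3 : (AM v w p q).det = (AM p q v w).det := by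
    rw [← AM_transpose, Matrix.det_transpose]
  have e4 : (AM v w p q + u • AM (fun i => v i * τ⁻¹) (fun i => w i * τ) p q).det =
      (AM p q v w + u • AM (fun i => p i * τ⁻¹) (fun i => q i * τ) v w).det := by
    rw [← Matrix.det_transpose]
    congr 1
    ext i j
    simp only [AM, Matrix.transpose_apply, Matrix.add_apply, Matrix.smul_apply, Matrix.of_apply]
    congr 2
    · ring
    · congr 1; ring
  rw [e4, e2, ← e3] at e1
  exact (mul_left_cancel₀ hD e1).symm

end kernelid


section kernelid2

lemma mem_map_castSucc {N : ℕ} (T : Finset (Fin N)) (i : Fin N) :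
    i.castSucc ∈ T.map Fin.castSuccEmb ↔ i ∈ T := by
  rw [← Fin.coe_castSuccEmb, Finset.mem_map']

lemma last_notMem_map {N : ℕ} (T : Finset (Fin N)) : Fin.last N ∉ T.map Fin.castSuccEmb := by
  simp [Fin.ext_iff]; intro a _; exact a.2.ne

lemma compl_map_castSucc {N : ℕ} (T : Finset (Fin N)) :
    (T.map Fin.castSuccEmb)ᶜ = insert (Fin.last N) (Tᶜ.map Fin.castSuccEmb) := by
  ext i
  refine Fin.lastCases ?_ (fun i => ?_) i
  · simp
  · rw [Finset.mem_compl, Finset.mem_insert, mem_map_castSucc, mem_map_castSucc, Finset.mem_compl]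
    simp [Fin.ext_iff, i.2.ne]

lemma compl_insert_castSucc {N : ℕ} (T : Finset (Fin N)) :
    (insert (Fin.last N) (T.map Fin.castSuccEmb))ᶜ = (Tᶜ.map Fin.castSuccEmb) := by
  ext i
  refine Fin.lastCases ?_ (fun i => ?_) i
  · simp
  · rw [Finset.mem_compl, Finset.mem_insert, mem_map_castSucc, mem_map_castSucc, Finset.mem_compl]
    simp [Fin.ext_iff, i.2.ne]

lemma RT_snoc1 {N M : ℕ} {τ : ℂ} (hτ : τ ≠ 0) (v w : Fin M → ℂ) (p q : Fin N → ℂ) (hw : ∀ i, w i ≠ 0)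
    (T : Finset (Fin M)) :
    RT τ v w (Fin.snoc p 0 : Fin (N+1) → ℂ) (Fin.snoc q 1 : Fin (N+1) → ℂ) T = τ⁻¹ ^ T.card * RT τ v w p q T := by
  unfold RT
  rw [mul_left_comm, ← Finset.prod_const (s := T) τ⁻¹]
  congr 1
  rw [← Finset.prod_mul_distrib]
  refine Finset.prod_congr rfl fun m _ => ?_
  rw [Fin.prod_univ_castSucc, mul_comm]
  simp only [Fin.snoc_castSucc, Fin.snoc_last]
  congr 1
  have := hw m
  field_simp
  ring

lemma RT_snoc2 {N M : ℕ} {τ : ℂ} (v w : Fin M → ℂ) (p q : Fin N → ℂ) (hp : ∀ i, p i ≠ 0)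
    (T : Finset (Fin N)) :
    RT τ (Fin.snoc p 0 : Fin (N+1) → ℂ) (Fin.snoc q 1 : Fin (N+1) → ℂ) v w (T.map Fin.castSuccEmb) =
      τ⁻¹ ^ T.card * RT τ p q v w T := by
  unfold RT
  rw [compl_map_castSucc, Finset.prod_map, Finset.prod_map, ← mul_assoc, ← Finset.prod_const (s := T) τ⁻¹]
  simp only [Fin.coe_castSuccEmb, Fin.snoc_castSucc]
  congr 1
  rw [← Finset.prod_mul_distrib]
  refine Finset.prod_congr rfl fun m _ => ?_
  rw [Finset.prod_insert (last_notMem_map _), Finset.prod_map]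
  simp only [Fin.coe_castSuccEmb, Fin.snoc_castSucc, Fin.snoc_last]
  congr 1
  have := hp m
  rw [div_eq_iff (by simpa using this)]
  ring

lemma RT_snoc3 {N : ℕ} {τ : ℂ} (hτ : τ ≠ 0) (v w : Fin (N+1) → ℂ) (p q : Fin N → ℂ) (hp : ∀ i, p i ≠ 0)
    (hw : ∀ i, w i ≠ 0) (T : Finset (Fin N)) :
    RT τ (Fin.snoc p 0 : Fin (N+1) → ℂ) (Fin.snoc q 1 : Fin (N+1) → ℂ) v w
      (insert (Fin.last N) (T.map Fin.castSuccEmb)) =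
      τ⁻¹ ^ (T.card + 1) * RT τ p q v w T := by
  unfold RT
  rw [compl_insert_castSucc, Finset.prod_insert (last_notMem_map _),
    Finset.prod_insert (last_notMem_map _), Finset.prod_map, Finset.prod_map, Finset.prod_map]
  simp only [Fin.coe_castSuccEmb, Fin.snoc_castSucc, Fin.snoc_last]
  simp only [Finset.prod_map, Fin.coe_castSuccEmb, Fin.snoc_castSucc]
  have h1 : ∏ l ∈ Tᶜ, (0 * τ⁻¹ * q l - p l * (1 * τ)) / (0 * q l - p l * 1) = τ ^ (N - T.card) := by
    rw [Finset.prod_congr rfl (g := fun _ => τ), Finset.prod_const, Finset.card_compl, Fintype.card_fin]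
    intro l _
    have := hp l
    rw [div_eq_iff (by simpa using this)]; ring
  have h2 : ∏ j, (0 * v j - 1 * w j) / (0 * τ⁻¹ * v j - 1 * τ * w j) = τ⁻¹ ^ (N + 1) := by
    rw [Finset.prod_congr rfl (g := fun _ => τ⁻¹), Finset.prod_const, Finset.card_univ, Fintype.card_fin]
    intro l _
    have := hw l
    field_simp; ring
  rw [h1, h2]
  have h3 : τ ^ (N - T.card) * τ⁻¹ ^ (N + 1) = τ⁻¹ ^ (T.card + 1) := by
    have hc : T.card ≤ N := by simpa using Finset.card_le_univ T
    have : N + 1 = (N - T.card) + (T.card + 1) := by omega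
    rw [this, pow_add τ⁻¹, ← mul_assoc, ← mul_pow, mul_inv_cancel₀ hτ, one_pow, one_mul]
  rw [← h3]; ring

lemma sum_powersetCard_last {N k : ℕ} (f : Finset (Fin (N+1)) → ℂ) :
    ∑ T ∈ Finset.powersetCard (k+1) Finset.univ, f T =
      ∑ T ∈ Finset.powersetCard (k+1) (Finset.univ : Finset (Fin N)), f (T.map Fin.castSuccEmb) +
      ∑ T ∈ Finset.powersetCard k (Finset.univ : Finset (Fin N)),
        f (insert (Fin.last N) (T.map Fin.castSuccEmb)) := by
  classical
  have hu : (Finset.univ : Finset (Fin (N+1))) = insert (Fin.last N) (Finset.univ.map Fin.castSuccEmb) := by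
    ext i
    refine Fin.lastCases ?_ (fun i => ?_) i <;> simp
  have hl := last_notMem_map (Finset.univ : Finset (Fin N))
  rw [hu, Finset.powersetCard_succ_insert hl, Finset.sum_union, Finset.sum_image,
    Finset.powersetCard_map, Finset.powersetCard_map, Finset.sum_map, Finset.sum_map]
  · rfl
  · intro A hA B hB hAB
    have hA' : Fin.last N ∉ A := fun h => hl ((Finset.mem_powersetCard.mp hA).1 h)
    have hB' : Fin.last N ∉ B := fun h => hl ((Finset.mem_powersetCard.mp hB).1 h)
    rw [← Finset.erase_insert hA', ← Finset.erase_insert hB']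
    exact congrArg (fun S => S.erase (Fin.last N)) hAB
  · rw [Finset.disjoint_left]
    intro A hA hA2
    obtain ⟨B, hB, rfl⟩ := Finset.mem_image.mp hA2
    exact hl ((Finset.mem_powersetCard.mp hA).1 (Finset.mem_insert_self _ _))

lemma unbalanced {N : ℕ} {τ : ℂ} (hτ : τ ≠ 0) (v w : Fin (N+1) → ℂ) (p q : Fin N → ℂ)
    (hp : ∀ i, p i ≠ 0) (hw : ∀ i, w i ≠ 0)
    (h : ∀ i j, v i * p j - w i * q j ≠ 0) (h' : ∀ i j, v i * τ⁻¹ * p j - w i * τ * q j ≠ 0)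
    (hx : ∀ i j, i ≠ j → v i * w j - v j * w i ≠ 0)
    (hy : ∀ i j, i ≠ j → p i * q j - p j * q i ≠ 0) (k : ℕ) :
    ∑ T ∈ Finset.powersetCard (k+1) Finset.univ, RT τ v w p q T =
      ∑ T ∈ Finset.powersetCard (k+1) Finset.univ, RT τ p q v w T +
      ∑ T ∈ Finset.powersetCard k Finset.univ, RT τ p q v w T := by
  have hb := balanced hτ v w (Fin.snoc p 0 : Fin (N+1) → ℂ) (Fin.snoc q 1 : Fin (N+1) → ℂ)
    (fun i j => by refine Fin.lastCases ?_ (fun j => ?_) j <;> simp [hw, h])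
    (fun i j => by refine Fin.lastCases ?_ (fun j => ?_) j <;> simp [hw, h', hτ]) hx
    (fun i j => by
      refine Fin.lastCases ?_ (fun j => ?_) j <;> refine Fin.lastCases ?_ (fun i => ?_) i
      · simp
      · simp [hp]
      · simp [hp]
      · intro hij; simpa using hy i j (by rintro rfl; exact hij rfl)) (k+1)
  rw [sum_powersetCard_last (fun T => RT τ (Fin.snoc p 0 : Fin (N+1) → ℂ) (Fin.snoc q 1 : Fin (N+1) → ℂ) v w T)] at hb
  have e0 : ∀ T ∈ Finset.powersetCard (k+1) (Finset.univ : Finset (Fin (N+1))),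
      RT τ v w (Fin.snoc p 0 : Fin (N+1) → ℂ) (Fin.snoc q 1 : Fin (N+1) → ℂ) T = τ⁻¹ ^ (k+1) * RT τ v w p q T := by
    intro T hT; rw [RT_snoc1 hτ _ _ _ _ hw, (Finset.mem_powersetCard.mp hT).2]
  have e1 : ∀ T ∈ Finset.powersetCard (k+1) (Finset.univ : Finset (Fin N)),
      RT τ (Fin.snoc p 0 : Fin (N+1) → ℂ) (Fin.snoc q 1 : Fin (N+1) → ℂ) v w (T.map Fin.castSuccEmb) = τ⁻¹ ^ (k+1) * RT τ p q v w T := by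
    intro T hT; rw [RT_snoc2 _ _ _ _ hp, (Finset.mem_powersetCard.mp hT).2]
  have e2 : ∀ T ∈ Finset.powersetCard k (Finset.univ : Finset (Fin N)),
      RT τ (Fin.snoc p 0 : Fin (N+1) → ℂ) (Fin.snoc q 1 : Fin (N+1) → ℂ) v w (insert (Fin.last N) (T.map Fin.castSuccEmb)) = τ⁻¹ ^ (k+1) * RT τ p q v w T := by
    intro T hT; rw [RT_snoc3 hτ _ _ _ _ hp hw, (Finset.mem_powersetCard.mp hT).2]
  rw [Finset.sum_congr rfl e0, Finset.sum_congr rfl e1, Finset.sum_congr rfl e2,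
    ← Finset.mul_sum, ← Finset.mul_sum, ← Finset.mul_sum, ← mul_add] at hb
  exact mul_left_cancel₀ (pow_ne_zero _ (inv_ne_zero hτ)) hb

end kernelid2


section kernelid3

noncomputable def coef (c : ℝ) (b : ℂ) {n : ℕ} (x : Fin n → ℂ) (T : Finset (Fin n)) : ℂ :=
  ∏ m ∈ T, ∏ l ∈ Tᶜ, Complex.sinh ((Real.pi : ℂ) * (x m - x l - I * b) / (c : ℂ)) /
            Complex.sinh ((Real.pi : ℂ) * (x m - x l) / (c : ℂ))

noncomputable def fker (c : ℝ) (b v : ℂ) : ℂ :=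
  cosh (Real.pi * (v + I * b / 2) / c) / cosh (Real.pi * (v - I * b / 2) / c)

lemma my_two_sinh (A : ℂ) : exp A - exp (-A) = 2 * sinh A := by
  rw [sinh]; ring

lemma my_two_cosh (A : ℂ) : exp A + exp (-A) = 2 * cosh A := by
  rw [cosh]; ring

lemma kernel_id {c : ℝ} (hc : 0 < c) {b : ℂ} (hb : |b.re| < c) {N : ℕ} (x : Fin (N+1) → ℝ)
    (z : Fin N → ℝ) (hx : Function.Injective x) (hz : Function.Injective z) (k : ℕ) :
    ∑ T ∈ Finset.powersetCard (k+1) Finset.univ,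
      coef c b (fun i => (x i : ℂ)) T * ∏ m ∈ T, ∏ j, fker c b ((x m : ℂ) - z j) =
    ∑ T ∈ Finset.powersetCard (k+1) Finset.univ,
      coef c (-b) (fun i => (z i : ℂ)) T * ∏ m ∈ T, ∏ i, fker c b ((x i : ℂ) - z m) +
    ∑ T ∈ Finset.powersetCard k Finset.univ,
      coef c (-b) (fun i => (z i : ℂ)) T * ∏ m ∈ T, ∏ i, fker c b ((x i : ℂ) - z m) := by
  have hc0 : (c : ℂ) ≠ 0 := by exact_mod_cast hc.ne'
  set V : Fin (N+1) → ℂ := fun i => exp (Real.pi * x i / c) with hV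
  set W : Fin (N+1) → ℂ := fun i => exp (-(Real.pi * x i / c)) with hW
  set P : Fin N → ℂ := fun j => exp (-(Real.pi * z j / c) + Real.pi * (I * b / 2) / c) with hP
  set Q : Fin N → ℂ := fun j => -exp (Real.pi * z j / c - Real.pi * (I * b / 2) / c) with hQ
  set τ : ℂ := exp (Real.pi * (I * b) / c) with hτ
  have hτi : τ⁻¹ = exp (-(Real.pi * (I * b) / c)) := by rw [hτ, exp_neg]
  have b1 : ∀ i j, V i * P j - W i * Q j = 2 * cosh (Real.pi * ((x i : ℂ) - z j + I * b / 2) / c) := by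
    intro i j
    simp only [hV, hW, hP, hQ, mul_neg, sub_neg_eq_add, ← exp_add]
    rw [← my_two_cosh]; congr 2 <;> ring
  have b2 : ∀ i j, V i * τ⁻¹ * P j - W i * τ * Q j = 2 * cosh (Real.pi * ((x i : ℂ) - z j - I * b / 2) / c) := by
    intro i j
    simp only [hV, hW, hP, hQ, hτi, mul_neg, sub_neg_eq_add, ← exp_add]
    simp only [hτ, ← exp_add]
    rw [← my_two_cosh]; congr 2 <;> ring
  have b3 : ∀ m l, V m * τ⁻¹ * W l - V l * (W m * τ) = 2 * sinh (Real.pi * ((x m : ℂ) - x l - I * b) / c) := by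
    intro i j
    simp only [hV, hW, hτi, ← exp_add]
    simp only [hτ, ← exp_add]
    rw [← my_two_sinh]; congr 2 <;> ring
  have b4 : ∀ m l, V m * W l - V l * W m = 2 * sinh (Real.pi * ((x m : ℂ) - x l) / c) := by
    intro i j
    simp only [hV, hW, ← exp_add]
    rw [← my_two_sinh]; congr 2 <;> ring
  have b5 : ∀ m l, P m * τ⁻¹ * Q l - P l * (Q m * τ) = 2 * sinh (Real.pi * ((z m : ℂ) - z l - I * (-b)) / c) := by
    intro i j
    simp only [hP, hQ, hτi, mul_neg, neg_mul, ← exp_add]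
    simp only [hτ, ← exp_add]
    rw [← my_two_sinh, sub_neg_eq_add, neg_add_eq_sub]; congr 2 <;> ring
  have b6 : ∀ m l, P m * Q l - P l * Q m = 2 * sinh (Real.pi * ((z m : ℂ) - z l) / c) := by
    intro i j
    simp only [hP, hQ, mul_neg, ← exp_add]
    rw [← my_two_sinh, sub_neg_eq_add, neg_add_eq_sub]; congr 2 <;> ring
  have him : ∀ i j, |((x i : ℂ) - z j + I * b / 2).im| < c / 2 := by
    intro i j
    have : ((x i : ℂ) - z j + I * b / 2).im = b.re / 2 := by simp
    rw [this, abs_div, abs_two]; linarith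
  have him2 : ∀ i j, |((x i : ℂ) - z j - I * b / 2).im| < c / 2 := by
    intro i j
    have : ((x i : ℂ) - z j - I * b / 2).im = -(b.re / 2) := by simp
    rw [this, abs_neg, abs_div, abs_two]; linarith
  have hu := unbalanced (exp_ne_zero _) V W P Q (fun _ => exp_ne_zero _) (fun _ => exp_ne_zero _)
    (fun i j => by rw [b1]; exact mul_ne_zero two_ne_zero (cosh_ne hc (him i j)))
    (fun i j => by rw [b2]; exact mul_ne_zero two_ne_zero (cosh_ne hc (him2 i j)))
    (fun i j hij => by
      rw [b4]; refine mul_ne_zero two_ne_zero ?_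
      have := sinh_pi_ne hc (t := x i - x j) (sub_ne_zero.mpr fun h => hij (hx h))
      simpa using this)
    (fun i j hij => by
      rw [b6]; refine mul_ne_zero two_ne_zero ?_
      have := sinh_pi_ne hc (t := z i - z j) (sub_ne_zero.mpr fun h => hij (hz h))
      simpa using this) k (τ := τ)
  have e1 : ∀ T, RT τ V W P Q T = coef c b (fun i => (x i : ℂ)) T * ∏ m ∈ T, ∏ j, fker c b ((x m : ℂ) - z j) := by
    intro T
    unfold RT coef fker
    simp only [b1, b2, b3, b4]
    simp only [mul_div_mul_left _ _ (two_ne_zero : (2:ℂ) ≠ 0)]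
  have e2 : ∀ T, RT τ P Q V W T = coef c (-b) (fun i => (z i : ℂ)) T * ∏ m ∈ T, ∏ i, fker c b ((x i : ℂ) - z m) := by
    intro T
    have b1' : ∀ j i, P j * V i - Q j * W i = 2 * cosh (Real.pi * ((x i : ℂ) - z j + I * b / 2) / c) := by
      intro j i; rw [← b1]; ring
    have b2' : ∀ j i, P j * τ⁻¹ * V i - Q j * τ * W i = 2 * cosh (Real.pi * ((x i : ℂ) - z j - I * b / 2) / c) := by
      intro j i; rw [← b2]; ring
    unfold RT coef fker
    simp only [b1', b2', b5, b6]
    simp only [mul_div_mul_left _ _ (two_ne_zero : (2:ℂ) ≠ 0)]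
  simp only [e1, e2] at hu
  exact hu

end kernelid3


section metric

noncomputable def Dsum {n : ℕ} (x : Fin n → ℝ) : ℝ :=
  ∑ q ∈ Finset.univ.filter (fun q : Fin n × Fin n => q.1 < q.2), |x q.1 - x q.2|

noncomputable def Xsum {n m : ℕ} (x : Fin n → ℝ) (z : Fin m → ℝ) : ℝ := ∑ j, ∑ k, |x j - z k|

noncomputable def stp (u t : ℝ) : ℝ := if u ≤ t then 1 else 0

lemma two_Dsum {n : ℕ} (f : Fin n → Fin n → ℝ) (hs : ∀ i j, f i j = f j i) (h0 : ∀ i, f i i = 0) :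
    2 * ∑ q ∈ Finset.univ.filter (fun q : Fin n × Fin n => q.1 < q.2), f q.1 q.2 = ∑ i, ∑ j, f i j := by
  classical
  rw [← Finset.sum_product', Finset.univ_product_univ,
    ← Finset.sum_filter_add_sum_filter_not Finset.univ (fun q : Fin n × Fin n => q.1 < q.2)]
  have h3 : ∑ q ∈ Finset.univ.filter (fun q : Fin n × Fin n => ¬ q.1 < q.2), f q.1 q.2 =
      ∑ q ∈ Finset.univ.filter (fun q : Fin n × Fin n => q.2 < q.1), f q.1 q.2 := by
    symm
    apply Finset.sum_subset
    · intro q; simp only [Finset.mem_filter, Finset.mem_univ, true_and]; intro h; exact not_lt.mpr h.le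
    · intro q hq hq2
      simp only [Finset.mem_filter, Finset.mem_univ, true_and, not_lt] at hq hq2
      have : q.1 = q.2 := le_antisymm hq2 hq
      rw [this, h0]
  have h4 : ∑ q ∈ Finset.univ.filter (fun q : Fin n × Fin n => q.2 < q.1), f q.1 q.2 =
      ∑ q ∈ Finset.univ.filter (fun q : Fin n × Fin n => q.1 < q.2), f q.1 q.2 := by
    refine Finset.sum_equiv (Equiv.prodComm _ _) ?_ ?_
    · intro q; simp
    · intro q _; simp [hs]
  rw [h3, h4]; ring

lemma stp_abs (u v t : ℝ) : |stp u t - stp v t| = stp u t + stp v t - 2 * stp u t * stp v t := by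
  unfold stp; split_ifs <;> norm_num

lemma stp_ind (u v : ℝ) : (fun t => |stp u t - stp v t|) = (Set.Ico (min u v) (max u v)).indicator (fun _ => (1:ℝ)) := by
  ext t
  unfold stp
  rw [Set.indicator_apply]
  simp only [Set.mem_Ico, min_le_iff, lt_max_iff]
  by_cases h1 : u ≤ t <;> by_cases h2 : v ≤ t <;> simp [h1, h2, not_lt.mpr, not_le.mp]

lemma stp_integrable (u v : ℝ) : Integrable (fun t => |stp u t - stp v t|) := by
  rw [stp_ind, integrable_indicator_iff measurableSet_Ico]
  exact integrableOn_const (by simp)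

lemma stp_integral (u v : ℝ) : ∫ t, |stp u t - stp v t| = |u - v| := by
  rw [stp_ind, integral_indicator measurableSet_Ico]
  simp only [integral_const, MeasurableSet.univ, measureReal_restrict_apply, Set.univ_inter,
    Real.volume_real_Ico, smul_eq_mul, mul_one]
  rw [max_sub_min_eq_abs', max_eq_left (abs_nonneg _)]

lemma stp_sum_nat {n : ℕ} (x : Fin n → ℝ) (t : ℝ) : ∃ A : ℤ, ∑ j, stp (x j) t = (A : ℝ) := by
  classical
  refine ⟨∑ j, if x j ≤ t then 1 else 0, ?_⟩
  push_cast
  rfl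

lemma stp_pt {N : ℕ} (x : Fin (N+1) → ℝ) (z : Fin N → ℝ) (t : ℝ) :
    ∑ i, ∑ k, |stp (z i) t - stp (z k) t| + ∑ i, ∑ k, |stp (x i) t - stp (x k) t| ≤
      2 * ∑ j, ∑ k, |stp (x j) t - stp (z k) t| := by
  simp only [stp_abs]
  obtain ⟨A, hA⟩ := stp_sum_nat x t
  obtain ⟨B, hB⟩ := stp_sum_nat z t
  simp only [Finset.sum_sub_distrib, Finset.sum_add_distrib, Finset.sum_const, Finset.card_univ,
    Fintype.card_fin, nsmul_eq_mul, ← Finset.mul_sum, ← Finset.sum_mul, hA, hB, mul_assoc]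
  have h : ((A - B : ℤ) : ℝ) ≤ ((A - B : ℤ) : ℝ) ^ 2 := by exact_mod_cast Int.le_self_sq _
  push_cast at h ⊢
  nlinarith

lemma metric1 {N : ℕ} (x : Fin (N+1) → ℝ) (z : Fin N → ℝ) : Dsum z + Dsum x ≤ Xsum x z := by
  have hi : ∀ {n m : ℕ} (x : Fin n → ℝ) (z : Fin m → ℝ),
      Integrable (fun t => ∑ i, ∑ k, |stp (x i) t - stp (z k) t|) := fun x z =>
    integrable_finsetSum _ fun i _ => integrable_finsetSum _ fun j _ => stp_integrable _ _
  have he : ∀ {n m : ℕ} (x : Fin n → ℝ) (z : Fin m → ℝ),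
      ∫ t, ∑ i, ∑ k, |stp (x i) t - stp (z k) t| = ∑ i, ∑ k, |x i - z k| := by
    intro n m x z
    rw [integral_finsetSum _ fun i _ => integrable_finsetSum _ fun j _ => stp_integrable _ _]
    refine Finset.sum_congr rfl fun i _ => ?_
    rw [integral_finsetSum _ fun i _ => stp_integrable _ _]
    exact Finset.sum_congr rfl fun k _ => stp_integral _ _
  have h := integral_mono ((hi z z).add (hi x x)) ((hi x z).const_mul 2) (fun t => stp_pt x z t)
  simp only [Pi.add_apply] at h
  rw [integral_add (hi z z) (hi x x), integral_const_mul, he, he, he] at h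
  have e1 := two_Dsum (fun i j => |z i - z j|) (fun i j => abs_sub_comm _ _) (by simp)
  have e2 := two_Dsum (fun i j => |x i - x j|) (fun i j => abs_sub_comm _ _) (by simp)
  rw [← e1, ← e2] at h
  unfold Dsum Xsum
  linarith

lemma metric2 {N : ℕ} (x : Fin (N+1) → ℝ) (z : Fin N → ℝ) :
    (N + 1) * Dsum z ≤ (N - 1) * Xsum x z := by
  have e1 := two_Dsum (fun i j => |z i - z j|) (fun i j => abs_sub_comm _ _) (by simp)
  have h : ∀ j, ∑ i, ∑ k, |z i - z k| ≤ (2 * N - 2) * ∑ k, |x j - z k| := by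
    intro j
    have h1 : ∀ i, ∑ k, |z i - z k| ≤ (N - 2) * |x j - z i| + ∑ k, |x j - z k| := by
      intro i
      rw [← Finset.add_sum_erase Finset.univ _ (Finset.mem_univ i), sub_self, abs_zero, zero_add,
        ← Finset.add_sum_erase Finset.univ (fun k => |x j - z k|) (Finset.mem_univ i)]
      have : ∑ k ∈ Finset.univ.erase i, |z i - z k| ≤ ∑ k ∈ Finset.univ.erase i, (|x j - z i| + |x j - z k|) := by
        refine Finset.sum_le_sum fun k _ => ?_
        rw [abs_sub_comm (x j) (z i)]
        exact abs_sub_le _ _ _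
      rw [Finset.sum_add_distrib, Finset.sum_const, Finset.card_erase_of_mem (Finset.mem_univ i),
        Finset.card_univ, Fintype.card_fin, nsmul_eq_mul, Nat.cast_sub (by have := i.2; omega)] at this
      push_cast at this
      linarith
    refine (Finset.sum_le_sum fun i _ => h1 i).trans ?_
    rw [Finset.sum_add_distrib, ← Finset.mul_sum, Finset.sum_const, Finset.card_univ, Fintype.card_fin,
      nsmul_eq_mul]
    linarith
  have h2 := Finset.sum_le_sum fun j (_ : j ∈ (Finset.univ : Finset (Fin (N+1)))) => h j
  rw [← e1, Finset.sum_const, Finset.card_univ, Fintype.card_fin, nsmul_eq_mul, ← Finset.mul_sum] at h2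
  unfold Dsum Xsum
  push_cast at h2
  linarith

lemma Dsum_nonneg {n : ℕ} (x : Fin n → ℝ) : 0 ≤ Dsum x := Finset.sum_nonneg fun _ _ => abs_nonneg _

lemma metric3 {N : ℕ} (hN : 0 < N) {ε : ℝ} (h0 : 0 < ε) (h1 : ε < 1) (x : Fin (N+1) → ℝ) (z : Fin N → ℝ) :
    (1 + ε / N) * Dsum z - Xsum x z ≤ -(ε / N) * ∑ k, |x 0 - z k| - (1 - ε) * Dsum x := by
  have m1 := metric1 x z
  have m2 := metric2 x z
  have m3 : ∑ k, |x 0 - z k| ≤ Xsum x z :=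
    Finset.single_le_sum (f := fun j => ∑ k, |x j - z k|) (fun j _ => Finset.sum_nonneg fun _ _ => abs_nonneg _) (Finset.mem_univ 0)
  have hN' : (0:ℝ) < N := by exact_mod_cast hN
  have h4 : (1 - ε) * (Dsum z + Dsum x) ≤ (1 - ε) * Xsum x z := mul_le_mul_of_nonneg_left m1 (by linarith)
  have h5 : ε / N * ((N+1) * Dsum z) ≤ ε / N * ((N - 1) * Xsum x z) := mul_le_mul_of_nonneg_left m2 (by positivity)
  have h6 : ε / N * ∑ k, |x 0 - z k| ≤ ε / N * Xsum x z := mul_le_mul_of_nonneg_left m3 (by positivity)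
  have e1 : ε / N * ((N+1) * Dsum z) = ε * Dsum z + ε / N * Dsum z := by field_simp
  have e2 : ε / N * ((N - 1) * Xsum x z) = ε * Xsum x z - ε / N * Xsum x z := by field_simp
  nlinarith

lemma integrable_exp_abs {η : ℝ} (h : 0 < η) : Integrable (fun t : ℝ => Real.exp (-η * |t|)) := by
  rw [← integrableOn_univ, ← Set.Iic_union_Ioi (a := (0:ℝ))]
  refine IntegrableOn.union ?_ ?_
  · refine (integrableOn_exp_mul_Iic h 0).congr_fun (fun t ht => ?_) measurableSet_Iic
    simp only [Set.mem_Iic] at ht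
    simp only [abs_of_nonpos ht]; congr 1; ring
  · refine (integrableOn_exp_mul_Ioi (neg_lt_zero.mpr h) 0).congr_fun (fun t ht => ?_) measurableSet_Ioi
    simp only [Set.mem_Ioi] at ht
    simp only [abs_of_pos ht]

lemma integrable_exp_sum {n : ℕ} {η : ℝ} (h : 0 < η) :
    Integrable (fun z : Fin n → ℝ => Real.exp (-η * ∑ k, |z k|)) := by
  have := Integrable.fintype_prod (ι := Fin n) (𝕜 := ℝ) (f := fun _ (t:ℝ) => Real.exp (-η * |t|)) (fun _ => integrable_exp_abs h)
  refine this.congr (ae_of_all _ fun z => ?_)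
  simp only [Finset.mul_sum, Real.exp_sum]

end metric


section core

def tube (M : ℕ) (σ : ℝ) : Set (Fin M → ℂ) := {x | ∀ j, |(x j).im| < σ}

noncomputable def pairF (c d : ℝ) (b : ℂ) {M : ℕ} (J : Finset (Fin M)) (ζ : ℂ) (z : Fin M → ℝ) : ℂ :=
  ∏ q ∈ Finset.univ.filter (fun q : Fin M × Fin M => q.1 < q.2),
    (if q.1 ∈ J ∧ q.2 ∉ J then Theta c d b ((z q.1 : ℂ) - z q.2 + ζ) else
      if q.2 ∈ J ∧ q.1 ∉ J then Theta c d b ((z q.2 : ℂ) - z q.1 + ζ) else wfun c d b (z q.1 - z q.2))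

noncomputable def Hint (c d : ℝ) (b : ℂ) {M : ℕ} (F : (Fin M → ℂ) → ℂ) (J : Finset (Fin M)) (ζ : ℂ)
    (x : Fin (M+1) → ℂ) (s s' : Fin M → ℂ) (z : Fin M → ℝ) : ℂ :=
  pairF c d b J ζ z * (∏ j, ∏ k, rker c d b (x j - z k - s k)) * F (fun k => z k + s' k)

structure Good (c d : ℝ) (b : ℂ) (M : ℕ) (y : Fin M → ℝ) (F : (Fin M → ℂ) → ℂ) : Prop where
  agree : ∀ x : Fin M → ℝ, F (fun j => (x j : ℂ)) = Jrec c d b M x y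
  cont : ContinuousOn F (tube M ((c + d - b.re) / 2))
  line : ∀ p v : Fin M → ℂ, DifferentiableOn ℂ (fun ζ : ℂ => F (fun j => p j + ζ * v j))
    {ζ | (fun j => p j + ζ * v j) ∈ tube M ((c + d - b.re) / 2)}
  bound : ∀ ε ρ : ℝ, 0 < ε → ε < 1 → ρ < (c + d - b.re) / 2 → ∃ C, 0 < C ∧ ∀ x : Fin M → ℂ,
    (∀ j, |(x j).im| ≤ ρ) → ‖F x‖ ≤ C * Real.exp (-(kap c d b / 2) * ((1 - ε) * Dsum (fun j => (x j).re)))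
  cov : ∀ (X : Fin M → ℝ) (t : ℝ), F (fun j => ((X j + t : ℝ) : ℂ)) =
    exp (I * alphaPar c d * t * ∑ j, (y j : ℂ)) * F (fun j => (X j : ℂ))
  eig : ∀ k : ℕ, ∀ X : Fin M → ℝ, Function.Injective X →
    ∑ T ∈ Finset.powersetCard k (Finset.univ : Finset (Fin M)), coef c b (fun j => (X j : ℂ)) T *
      F (fun j => X j + I * d / 2 - I * d * (if j ∈ T then 1 else 0)) =
    (∑ T ∈ Finset.powersetCard k (Finset.univ : Finset (Fin M)),
          ∏ j ∈ T, Complex.exp (((2 * Real.pi * y j / c : ℝ) : ℂ))) * F (fun j => X j + I * d / 2)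

variable {c d : ℝ} {b : ℂ}

lemma pairF_bound (hc : 0 < c) (hd : 0 < d) (hb0 : 0 < b.re) (hb : b.re < c + d) {ρ : ℝ}
    (hρ : 2 * ρ + |c - 2 * b.re| < c + d) (M : ℕ) :
    ∃ C, 0 < C ∧ ∀ (J : Finset (Fin M)) (ζ : ℂ) (z : Fin M → ℝ), |ζ.im| ≤ ρ →
      ‖pairF c d b J ζ z‖ ≤ C * Real.exp (kap c d b * Dsum (fun k => z k + if k ∈ J then ζ.re else 0)) := by
  obtain ⟨C1, hC1, h1⟩ := wfun_bound hc hd hb0 hb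
  obtain ⟨C2, hC2, h2⟩ := Theta_bound hc hd (b := b) hρ
  set C := max C1 C2
  have hC : 0 < C := lt_max_of_lt_left hC1
  refine ⟨C ^ (Finset.univ.filter (fun q : Fin M × Fin M => q.1 < q.2)).card, by positivity, fun J ζ z hζ => ?_⟩
  unfold pairF Dsum
  rw [norm_prod, Finset.mul_sum, Real.exp_sum, ← Finset.prod_const, ← Finset.prod_mul_distrib]
  refine Finset.prod_le_prod (fun _ _ => norm_nonneg _) fun q _ => ?_
  have hT : ∀ v : ℂ, |v.im| ≤ ρ → ‖Theta c d b v‖ ≤ C * Real.exp (kap c d b * |v.re|) := fun v hv =>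
    (h2 v hv).trans (mul_le_mul_of_nonneg_right (le_max_right _ _) (Real.exp_pos _).le)
  have hw : ∀ t, ‖wfun c d b t‖ ≤ C * Real.exp (kap c d b * |t|) := fun t =>
    (h1 t).trans (mul_le_mul_of_nonneg_right (le_max_left _ _) (Real.exp_pos _).le)
  by_cases i1 : q.1 ∈ J <;> by_cases i2 : q.2 ∈ J <;> simp only [i1, i2, not_true_eq_false,
      not_false_eq_true, and_true, and_false, if_true, if_false, and_self]
  · refine (hw _).trans (le_of_eq ?_); congr 4; ring
  · refine (hT _ (by simpa using hζ)).trans (le_of_eq ?_); congr 4; simp; ring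
  · refine (hT _ (by simpa using hζ)).trans (le_of_eq ?_); congr 3; rw [abs_sub_comm]; congr 1; simp; ring
  · refine (hw _).trans (le_of_eq ?_); congr 4; ring

lemma kap_pos (hc : 0 < c) (hd : 0 < d) (hb0 : 0 < b.re) : 0 < kap c d b := by
  unfold kap; positivity

lemma rprod_bound (hc : 0 < c) (hd : 0 < d) (hb0 : 0 < b.re) {ρ : ℝ}
    (hρ : ρ < (c + d - b.re) / 2) (n M : ℕ) :
    ∃ C, 0 < C ∧ ∀ (u : Fin n → Fin M → ℂ), (∀ j k, |(u j k).im| ≤ ρ) →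
      ‖∏ j, ∏ k, rker c d b (u j k)‖ ≤ C * Real.exp (-(kap c d b / 2) * ∑ j, ∑ k, |(u j k).re|) := by
  obtain ⟨C, hC, h⟩ := rker_bound hc hd (β := b) (ρ := ρ) (by rw [abs_of_pos hb0]; linarith)
  refine ⟨(C ^ M) ^ n, by positivity, fun u hu => ?_⟩
  rw [norm_prod, Finset.mul_sum, Real.exp_sum]
  have e : (C ^ M) ^ n = ∏ j : Fin n, C ^ M := by simp
  rw [e, ← Finset.prod_mul_distrib]
  refine Finset.prod_le_prod (fun _ _ => norm_nonneg _) fun j _ => ?_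
  have e : C ^ M = ∏ k : Fin M, C := by simp
  rw [norm_prod, Finset.mul_sum, Real.exp_sum, e, ← Finset.prod_mul_distrib]
  refine Finset.prod_le_prod (fun _ _ => norm_nonneg _) fun k _ => ?_
  refine (h _ (hu j k)).trans (le_of_eq ?_)
  congr 3
  unfold kap; ring

lemma Hint_bound (hc : 0 < c) (hd : 0 < d) (hb0 : 0 < b.re) (hb : b.re < c + d) {ρ ρ' ε : ℝ} {M : ℕ}
    (hM : 0 < M) (hρ : ρ < (c + d - b.re) / 2)
    (hρ' : 2 * ρ' + |c - 2 * b.re| < c + d) (hε : 0 < ε) (hε1 : ε < 1) {y : Fin M → ℝ}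
    {F : (Fin M → ℂ) → ℂ} (hF : Good c d b M y F) :
    ∃ C, 0 < C ∧ ∀ (J : Finset (Fin M)) (ζ : ℂ) (x : Fin (M+1) → ℂ) (s s' : Fin M → ℂ) (z : Fin M → ℝ),
      |ζ.im| ≤ ρ' → (∀ j k, |(x j - s k).im| ≤ ρ) → (∀ k, |(s' k).im| ≤ ρ) →
      (∀ k, (s k).re = if k ∈ J then ζ.re else 0) → (∀ k, (s' k).re = if k ∈ J then ζ.re else 0) →
      ‖Hint c d b F J ζ x s s' z‖ ≤ C * (Real.exp (-(kap c d b / 2 * (ε / M)) * ∑ k, |(x 0).re - z k - (s k).re|)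
        * Real.exp (-(kap c d b / 2) * ((1 - ε) * Dsum (fun j => (x j).re)))) := by
  obtain ⟨C1, hC1, h1⟩ := pairF_bound hc hd hb0 hb hρ' M
  obtain ⟨C2, hC2, h2⟩ := rprod_bound hc hd hb0 hρ (M+1) M
  have hM' : (0:ℝ) < M := by exact_mod_cast hM
  have hM1 : (1:ℝ) ≤ M := by exact_mod_cast hM
  have hεM : ε / M < 1 := by rw [div_lt_one hM']; linarith
  obtain ⟨C3, hC3, h3⟩ := hF.bound (ε / M) ρ (by positivity) hεM hρ
  have hk := kap_pos hc hd hb0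
  refine ⟨C1 * C2 * C3, by positivity, fun J ζ x s s' z a1 a2 a3 a4 a5 => ?_⟩
  unfold Hint
  rw [norm_mul, norm_mul]
  have k1 := h1 J ζ z a1
  have k2 := h2 (fun j k => x j - z k - s k) (fun j k => by
    have := a2 j k
    have e : (x j - z k - s k).im = (x j - s k).im := by simp
    rw [e]; exact this)
  have k3 := h3 (fun k => z k + s' k) (fun k => by simpa using a3 k)
  refine (mul_le_mul (mul_le_mul k1 k2 (norm_nonneg _) (by positivity)) k3 (norm_nonneg _) (by positivity)).trans ?_
  set ξ : Fin M → ℝ := fun k => z k + if k ∈ J then ζ.re else 0 with hξ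
  have e3 : (fun j => ((z j : ℂ) + s' j).re) = ξ := by ext k; simp [hξ, a5]
  have e2 : ∑ j, ∑ k, |(x j - z k - s k).re| = Xsum (fun j => (x j).re) ξ := by
    unfold Xsum
    refine Finset.sum_congr rfl fun j _ => Finset.sum_congr rfl fun k _ => ?_
    congr 1
    simp only [hξ, sub_re, ofReal_re, a4]; ring
  have e4 : ∑ k, |(x 0).re - z k - (s k).re| = ∑ k, |(x 0).re - ξ k| := by
    refine Finset.sum_congr rfl fun k _ => ?_
    congr 1
    simp only [hξ, a4]; ring
  rw [e3, e2, e4]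
  have m := metric3 hM hε hε1 (fun j => (x j).re) ξ
  have m' := mul_le_mul_of_nonneg_left m (by positivity : 0 ≤ kap c d b / 2)
  have : C1 * Real.exp (kap c d b * Dsum ξ) * (C2 * Real.exp (-(kap c d b / 2) * Xsum (fun j => (x j).re) ξ)) *
      (C3 * Real.exp (-(kap c d b / 2) * ((1 - ε / M) * Dsum ξ))) =
      C1 * C2 * C3 * Real.exp (kap c d b * Dsum ξ + (-(kap c d b / 2) * Xsum (fun j => (x j).re) ξ) + -(kap c d b / 2) * ((1 - ε / M) * Dsum ξ)) := by
    rw [Real.exp_add, Real.exp_add]; ring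
  rw [this, ← Real.exp_add]
  refine mul_le_mul_of_nonneg_left (Real.exp_le_exp.mpr ?_) (by positivity)
  nlinarith

lemma exp_shift_le {M : ℕ} {η R : ℝ} (hη : 0 ≤ η) (u z : Fin M → ℝ) (hu : ∀ k, |u k| ≤ R) :
    Real.exp (-η * ∑ k, |u k - z k|) ≤ Real.exp (η * (M * R)) * Real.exp (-η * ∑ k, |z k|) := by
  rw [← Real.exp_add]
  apply Real.exp_le_exp.mpr
  have : ∑ k, |z k| ≤ ∑ k, (R + |u k - z k|) := by
    refine Finset.sum_le_sum fun k _ => ?_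
    have h1 := abs_sub_abs_le_abs_sub (z k) (u k)
    rw [abs_sub_comm (z k)] at h1
    linarith [hu k]
  rw [Finset.sum_add_distrib, Finset.sum_const, Finset.card_univ, Fintype.card_fin, nsmul_eq_mul] at this
  have := mul_le_mul_of_nonneg_left this hη
  linarith

lemma Hint_dom (hc : 0 < c) (hd : 0 < d) (hb0 : 0 < b.re) (hb : b.re < c + d) {ρ ρ' : ℝ} (R : ℝ) {M : ℕ}
    (hM : 0 < M) (hρ : ρ < (c + d - b.re) / 2)
    (hρ' : 2 * ρ' + |c - 2 * b.re| < c + d) {y : Fin M → ℝ}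
    {F : (Fin M → ℂ) → ℂ} (hF : Good c d b M y F) :
    ∃ g : (Fin M → ℝ) → ℝ, Integrable g ∧ ∀ (J : Finset (Fin M)) (ζ : ℂ) (x : Fin (M+1) → ℂ) (s s' : Fin M → ℂ) (z : Fin M → ℝ),
      |ζ.im| ≤ ρ' → (∀ j k, |(x j - s k).im| ≤ ρ) → (∀ k, |(s' k).im| ≤ ρ) →
      (∀ k, (s k).re = if k ∈ J then ζ.re else 0) → (∀ k, (s' k).re = if k ∈ J then ζ.re else 0) →
      |(x 0).re| ≤ R → |ζ.re| ≤ R →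
      ‖Hint c d b F J ζ x s s' z‖ ≤ g z := by
  obtain ⟨C, hC, h⟩ := Hint_bound hc hd hb0 hb hM hρ hρ' (ε := 1/2) (by norm_num) (by norm_num) hF
  have hM' : (0:ℝ) < M := by exact_mod_cast hM
  have hk := kap_pos hc hd hb0
  set η := kap c d b / 2 * (1 / 2 / M) with hη
  have hη0 : 0 < η := by positivity
  refine ⟨fun z => C * Real.exp (η * (M * (R + R))) * Real.exp (-η * ∑ k, |z k|),
    (integrable_exp_sum hη0).const_mul _, fun J ζ x s s' z a1 a2 a3 a4 a5 a6 a7 => ?_⟩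
  refine (h J ζ x s s' z a1 a2 a3 a4 a5).trans ?_
  have e1 : Real.exp (-(kap c d b / 2) * ((1 - 1/2) * Dsum (fun j => (x j).re))) ≤ 1 := by
    rw [Real.exp_le_one_iff]
    have := Dsum_nonneg (fun j => (x j).re)
    have : 0 ≤ kap c d b / 2 * ((1 - 1/2) * Dsum (fun j => (x j).re)) := by positivity
    linarith
  have e2 := exp_shift_le hη0.le (fun k => (x 0).re - (s k).re) z (R := R + R) (fun k => by
    refine (abs_sub _ _).trans (add_le_add a6 ?_)
    rw [a4]; split_ifs
    · exact a7
    · simpa using (abs_nonneg _).trans a7)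
  have e3 : ∑ k, |(x 0).re - z k - (s k).re| = ∑ k, |(x 0).re - (s k).re - z k| :=
    Finset.sum_congr rfl fun k _ => by congr 1; ring
  rw [e3]
  beta_reduce
  rw [mul_assoc C]
  refine mul_le_mul_of_nonneg_left ?_ hC.le
  calc _ ≤ Real.exp (-η * ∑ k, |(x 0).re - (s k).re - z k|) * 1 :=
        mul_le_mul_of_nonneg_left e1 (Real.exp_pos _).le
    _ ≤ _ := by rw [mul_one]; exact e2

lemma rker_cont (hc : 0 < c) (hd : 0 < d) (hb0 : 0 < b.re) {w : ℂ} (hw : |w.im| < (c + d - b.re) / 2) :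
    DifferentiableAt ℂ (rker c d b) w := rker_diffAt hc hd (by rw [abs_of_pos hb0]; linarith)

lemma pairF_cont (hc : 0 < c) (hd : 0 < d) (hb0 : 0 < b.re) (hb : b.re < c + d) {M : ℕ}
    (J : Finset (Fin M)) {ζ : ℂ} (hζ : 2 * |ζ.im| + |c - 2 * b.re| < c + d) :
    Continuous (pairF c d b J ζ) := by
  unfold pairF
  have hw := wfun_cont hc hd hb0 hb
  refine continuous_finsetProd _ fun q _ => ?_
  split_ifs
  · rw [continuous_iff_continuousAt]; intro z
    have := (Theta_diffAt hc hd (b := b) (v := (z q.1 : ℂ) - z q.2 + ζ) (by simpa using hζ)).continuousAt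
    exact ContinuousAt.comp (f := fun z : Fin M → ℝ => (z q.1 : ℂ) - z q.2 + ζ) this (by fun_prop)
  · rw [continuous_iff_continuousAt]; intro z
    have := (Theta_diffAt hc hd (b := b) (v := (z q.2 : ℂ) - z q.1 + ζ) (by simpa using hζ)).continuousAt
    exact ContinuousAt.comp (f := fun z : Fin M → ℝ => (z q.2 : ℂ) - z q.1 + ζ) this (by fun_prop)
  · fun_prop

lemma Hint_cont (hc : 0 < c) (hd : 0 < d) (hb0 : 0 < b.re) (hb : b.re < c + d) {M : ℕ}
    {y : Fin M → ℝ} {F : (Fin M → ℂ) → ℂ} (hF : Good c d b M y F)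
    (J : Finset (Fin M)) {ζ : ℂ} (hζ : 2 * |ζ.im| + |c - 2 * b.re| < c + d)
    {x : Fin (M+1) → ℂ} {s s' : Fin M → ℂ} (hx : ∀ j k, |(x j - s k).im| < (c + d - b.re) / 2)
    (hs : ∀ k, |(s' k).im| < (c + d - b.re) / 2) : Continuous (Hint c d b F J ζ x s s') := by
  unfold Hint
  refine ((pairF_cont hc hd hb0 hb J hζ).mul ?_).mul ?_
  · refine continuous_finsetProd _ fun j _ => continuous_finsetProd _ fun k _ => ?_
    rw [continuous_iff_continuousAt]; intro z
    have := (rker_cont hc hd hb0 (b := b) (w := x j - z k - s k) (by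
      have e : (x j - z k - s k).im = (x j - s k).im := by simp
      rw [e]; exact hx j k)).continuousAt
    exact ContinuousAt.comp (f := fun z : Fin M → ℝ => x j - z k - s k) this (Continuous.continuousAt (by fun_prop))
  · refine hF.cont.comp_continuous (by fun_prop) fun z k => ?_
    simpa using hs k

end core


section step
variable {c d : ℝ} {b : ℂ}

noncomputable def Fnext (c d : ℝ) (b : ℂ) (M : ℕ) (yl : ℝ) (F : (Fin M → ℂ) → ℂ) (x : Fin (M+1) → ℂ) : ℂ :=
  (exp (I * alphaPar c d * yl * ∑ j, x j) / (Nat.factorial M : ℂ)) *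
    ∫ z : Fin M → ℝ, Hint c d b F ∅ 0 x 0 0 z

lemma pairF_empty {M : ℕ} (ζ : ℂ) (z : Fin M → ℝ) : pairF c d b ∅ ζ z =
    ∏ q ∈ Finset.univ.filter (fun q : Fin M × Fin M => q.1 < q.2), wfun c d b (z q.1 - z q.2) := by
  simp [pairF]

lemma Hint_empty {M : ℕ} (F : (Fin M → ℂ) → ℂ) (x : Fin (M+1) → ℂ) (z : Fin M → ℝ) :
    Hint c d b F ∅ 0 x 0 0 z =
      (∏ q ∈ Finset.univ.filter (fun q : Fin M × Fin M => q.1 < q.2), wfun c d b (z q.1 - z q.2)) *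
      (∏ j, ∏ k, rker c d b (x j - z k)) * F (fun k => (z k : ℂ)) := by
  simp [Hint, pairF_empty]

lemma Fnext_agree {N : ℕ} {y : Fin (N+2) → ℝ} {F : (Fin (N+1) → ℂ) → ℂ}
    (hF : Good c d b (N+1) (fun j => y (Fin.castSucc j) - y (Fin.last (N+1))) F) (x : Fin (N+2) → ℝ) :
    Fnext c d b (N+1) (y (Fin.last (N+1))) F (fun j => (x j : ℂ)) = Jrec c d b (N+2) x y := by
  rw [Fnext, Jrec]
  simp only [Hint_empty, hF.agree]

lemma tube_open (M : ℕ) (σ : ℝ) : IsOpen (tube M σ) := by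
  have : tube M σ = ⋂ j, {x : Fin M → ℂ | |(x j).im| < σ} := by
    ext x; simp [tube]
  rw [this]
  exact isOpen_iInter_of_finite fun j => isOpen_lt (by fun_prop) continuous_const

lemma tube_mid {M : ℕ} {σ : ℝ} (hσ : 0 < σ) {x : Fin M → ℂ} (hx : x ∈ tube M σ) : ∃ ρ < σ, 0 ≤ ρ ∧ x ∈ tube M ρ := by
  have : ∀ᶠ ρ in nhdsWithin σ (Set.Iio σ), ρ < σ ∧ 0 ≤ ρ ∧ x ∈ tube M ρ := by
    refine (eventually_mem_nhdsWithin).and ?_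
    refine Filter.Eventually.and ?_ ?_
    · exact nhdsWithin_le_nhds ((eventually_gt_nhds hσ).mono fun _ h => h.le)
    · refine nhdsWithin_le_nhds (Filter.eventually_all.mpr fun j => eventually_gt_nhds (hx j))
  obtain ⟨ρ, h1, h2, h3⟩ := this.exists
  exact ⟨ρ, h1, h2, h3⟩

lemma cm_lt (hc : 0 < c) (hd : 0 < d) (hb0 : 0 < b.re) (hbc : b.re < c) : |c - 2 * b.re| < c + d := by
  rw [abs_lt]; constructor <;> linarith

lemma Hint0_dom (hc : 0 < c) (hd : 0 < d) (hb0 : 0 < b.re) (hbc : b.re < c) {M : ℕ} (hM : 0 < M)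
    {y : Fin M → ℝ} {F : (Fin M → ℂ) → ℂ} (hF : Good c d b M y F) {x₀ : Fin (M+1) → ℂ}
    (hx : x₀ ∈ tube (M+1) ((c + d - b.re) / 2)) :
    ∃ g : (Fin M → ℝ) → ℝ, Integrable g ∧ ∀ᶠ x in nhds x₀, ∀ z, ‖Hint c d b F ∅ 0 x 0 0 z‖ ≤ g z := by
  obtain ⟨ρ, h1, h2, h3⟩ := tube_mid (by linarith) hx
  obtain ⟨g, hg, h⟩ := Hint_dom hc hd hb0 (by linarith) (|(x₀ 0).re| + 1) hM h1 (ρ' := 0)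
    (by simpa using cm_lt hc hd hb0 hbc) hF
  refine ⟨g, hg, ?_⟩
  have e1 : ∀ᶠ x in nhds x₀, x ∈ tube (M+1) ρ := (tube_open _ _).mem_nhds h3
  have e2 : ∀ᶠ x : Fin (M+1) → ℂ in nhds x₀, |(x 0).re| < |(x₀ 0).re| + 1 := by
    have : ContinuousAt (fun x : Fin (M+1) → ℂ => |(x 0).re|) x₀ := Continuous.continuousAt (by fun_prop)
    exact this.eventually_lt continuousAt_const (by linarith)
  filter_upwards [e1, e2] with x hx1 hx2 z
  refine h ∅ 0 x 0 0 z (by simp) (fun j k => by simpa using (hx1 j).le) (fun k => by simpa using h2)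
    (by simp) (by simp) hx2.le (by simp; positivity)

lemma Hint0_cont (hc : 0 < c) (hd : 0 < d) (hb0 : 0 < b.re) (hbc : b.re < c) {M : ℕ}
    {y : Fin M → ℝ} {F : (Fin M → ℂ) → ℂ} (hF : Good c d b M y F) {x : Fin (M+1) → ℂ}
    (hx : x ∈ tube (M+1) ((c + d - b.re) / 2)) : Continuous (Hint c d b F ∅ 0 x 0 0) :=
  Hint_cont hc hd hb0 (by linarith) hF ∅ (by simpa using cm_lt hc hd hb0 hbc)
    (fun j k => by simpa using hx j) (fun k => by simp; linarith)

lemma diffAt_fprod {ι E : Type*} [NormedAddCommGroup E] [NormedSpace ℂ E] (s : Finset ι) (f : ι → E → ℂ) (x : E)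
    (h : ∀ i ∈ s, DifferentiableAt ℂ (f i) x) : DifferentiableAt ℂ (fun x => ∏ i ∈ s, f i x) x := by
  classical
  induction s using Finset.induction_on with
  | empty => simp
  | insert a s ha ih =>
    simp only [Finset.prod_insert ha]
    exact (h a (by simp)).mul (ih fun i hi => h i (by simp [hi]))

lemma norm_int_aux {E : Type*} [MeasurableSpace E] {μ : Measure E} {f : E → ℂ} {g : E → ℝ} {C K P : ℝ}
    (hg : Integrable g μ) (hK : ∫ z, g z ∂μ = K) (h : ∀ z, ‖f z‖ ≤ C * (g z * P)) :
    ‖∫ z, f z ∂μ‖ ≤ C * K * P := by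
  have hi : Integrable (fun z => C * (g z * P)) μ := (hg.mul_const P).const_mul C
  refine (norm_integral_le_of_norm_le hi (ae_of_all _ h)).trans (le_of_eq ?_)
  rw [integral_const_mul, integral_mul_const, hK]; ring

lemma Hint0_diffAt (hc : 0 < c) (hd : 0 < d) (hb0 : 0 < b.re) {M : ℕ}
    {F : (Fin M → ℂ) → ℂ} (z : Fin M → ℝ) {x : Fin (M+1) → ℂ}
    (hx : x ∈ tube (M+1) ((c + d - b.re) / 2)) : DifferentiableAt ℂ (fun x => Hint c d b F ∅ 0 x 0 0 z) x := by
  simp only [Hint_empty]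
  refine DifferentiableAt.mul_const (DifferentiableAt.const_mul ?_ _) _
  refine diffAt_fprod _ _ _ fun j _ => diffAt_fprod _ _ _ fun k _ => ?_
  have := rker_cont hc hd hb0 (b := b) (w := x j - z k) (by simpa using hx j)
  exact DifferentiableAt.comp x (f := fun x : Fin (M+1) → ℂ => x j - z k) this (by fun_prop)

lemma Fnext_cont (hc : 0 < c) (hd : 0 < d) (hb0 : 0 < b.re) (hbc : b.re < c) {M : ℕ} (hM : 0 < M)
    {y : Fin M → ℝ} {F : (Fin M → ℂ) → ℂ} (hF : Good c d b M y F) (yl : ℝ) :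
    ContinuousOn (Fnext c d b M yl F) (tube (M+1) ((c + d - b.re) / 2)) := by
  intro x₀ hx
  refine ContinuousAt.continuousWithinAt ?_
  unfold Fnext
  refine ContinuousAt.mul (Continuous.continuousAt (by fun_prop)) ?_
  obtain ⟨g, hg, h⟩ := Hint0_dom hc hd hb0 hbc hM hF hx
  refine continuousAt_of_dominated (bound := g) ?_ ?_ hg ?_
  · filter_upwards [(tube_open _ _).mem_nhds hx] with x hx
    exact (Hint0_cont hc hd hb0 hbc hF hx).aestronglyMeasurable
  · filter_upwards [h] with x hx using ae_of_all _ hx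
  · exact ae_of_all _ fun z => (Hint0_diffAt hc hd hb0 z hx).continuousAt

lemma Fnext_line (hc : 0 < c) (hd : 0 < d) (hb0 : 0 < b.re) (hbc : b.re < c) {M : ℕ} (hM : 0 < M)
    {y : Fin M → ℝ} {F : (Fin M → ℂ) → ℂ} (hF : Good c d b M y F) (yl : ℝ) (p v : Fin (M+1) → ℂ) :
    DifferentiableOn ℂ (fun ζ : ℂ => Fnext c d b M yl F (fun j => p j + ζ * v j))
    {ζ | (fun j => p j + ζ * v j) ∈ tube (M+1) ((c + d - b.re) / 2)} := by
  unfold Fnext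
  have hcont : Continuous (fun ζ : ℂ => (fun j => p j + ζ * v j : Fin (M+1) → ℂ)) := by fun_prop
  refine DifferentiableOn.mul (Differentiable.differentiableOn (by fun_prop)) ?_
  refine hol_param ((tube_open _ _).preimage hcont) ?_ ?_ ?_
  · intro ζ hζ
    exact (Hint0_cont hc hd hb0 hbc hF hζ).aestronglyMeasurable
  · intro z ζ hζ
    refine DifferentiableAt.differentiableWithinAt ?_
    exact DifferentiableAt.comp ζ (f := fun ζ : ℂ => (fun j => p j + ζ * v j : Fin (M+1) → ℂ))
      (Hint0_diffAt hc hd hb0 z hζ) (by fun_prop)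
  · intro ζ₀ hζ₀
    obtain ⟨g, hg, h⟩ := Hint0_dom hc hd hb0 hbc hM hF hζ₀
    obtain ⟨r, hr, hr2⟩ := Metric.eventually_nhds_iff.mp (hcont.continuousAt.eventually h)
    refine ⟨r, hr, g, hg, ae_of_all _ fun z ζ _ hζ2 => hr2 (by rwa [dist_eq_norm]) z⟩

lemma Fnext_bound (hc : 0 < c) (hd : 0 < d) (hb0 : 0 < b.re) (hbc : b.re < c) {M : ℕ} (hM : 0 < M)
    {y : Fin M → ℝ} {F : (Fin M → ℂ) → ℂ} (hF : Good c d b M y F) (yl : ℝ) (ε ρ : ℝ) (hε : 0 < ε)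
    (hε1 : ε < 1) (hρ : ρ < (c + d - b.re) / 2) : ∃ C, 0 < C ∧ ∀ x : Fin (M+1) → ℂ,
    (∀ j, |(x j).im| ≤ ρ) → ‖Fnext c d b M yl F x‖ ≤ C * Real.exp (-(kap c d b / 2) * ((1 - ε) * Dsum (fun j => (x j).re))) := by
  rcases lt_or_ge ρ 0 with h0 | hρ0
  · exact ⟨1, one_pos, fun x hx => absurd ((abs_nonneg _).trans (hx 0)) (by linarith)⟩
  obtain ⟨C, hC, h⟩ := Hint_bound hc hd hb0 (by linarith) hM hρ (ρ' := 0) (by simpa using cm_lt hc hd hb0 hbc) hε hε1 hF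
  have hM' : (0:ℝ) < M := by exact_mod_cast hM
  have hk := kap_pos hc hd hb0
  set η := kap c d b / 2 * (ε / M) with hη
  have hη0 : 0 < η := by positivity
  set K := ∫ z : Fin M → ℝ, Real.exp (-η * ∑ k, |z k|) with hK
  have hK0 : 0 ≤ K := integral_nonneg fun _ => (Real.exp_pos _).le
  set α := alphaPar c d
  refine ⟨Real.exp (|α * yl| * ((M + 1) * ρ)) * (C * K + 1), by positivity, fun x hx => ?_⟩
  have e1 : ‖∫ z : Fin M → ℝ, Hint c d b F ∅ 0 x 0 0 z‖ ≤
      C * K * Real.exp (-(kap c d b / 2) * ((1 - ε) * Dsum (fun j => (x j).re))) := by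
    have hi : Integrable (fun z : Fin M → ℝ => Real.exp (-η * ∑ k, |(x 0).re - z k|)) :=
      (integrable_exp_sum hη0).comp_sub_left (fun _ => (x 0).re)
    have hK' : ∫ z : Fin M → ℝ, Real.exp (-η * ∑ k, |(x 0).re - z k|) = K :=
      integral_sub_left_eq_self (fun z : Fin M → ℝ => Real.exp (-η * ∑ k, |z k|)) volume (fun _ => (x 0).re)
    refine norm_int_aux hi hK' fun z => ?_
    have := h ∅ 0 x 0 0 z (by simp) (fun j k => by simpa using hx j) (fun k => by simpa using hρ0)
      (by simp) (by simp)
    simp only [Pi.zero_apply, zero_re, sub_zero] at this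
    exact this
  have e2 : ‖exp (I * α * yl * ∑ j, x j)‖ ≤ Real.exp (|α * yl| * ((M + 1) * ρ)) := by
    rw [norm_exp]
    apply Real.exp_le_exp.mpr
    have : (I * α * yl * ∑ j, x j).re = -(α * yl) * ∑ j, (x j).im := by
      rw [show I * α * yl * ∑ j, x j = ((α * yl : ℝ) : ℂ) * (I * ∑ j, x j) by push_cast; ring, re_ofReal_mul]
      simp
    rw [this]
    refine (le_abs_self _).trans ?_
    rw [abs_mul, abs_neg]
    refine mul_le_mul_of_nonneg_left ?_ (abs_nonneg _)
    refine (Finset.abs_sum_le_sum_abs _ _).trans ((Finset.sum_le_sum fun j _ => hx j).trans ?_)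
    simp
  have e3 : ‖(exp (I * α * yl * ∑ j, x j) / (Nat.factorial M : ℂ))‖ ≤ Real.exp (|α * yl| * ((M + 1) * ρ)) := by
    rw [norm_div, Complex.norm_natCast]
    refine (div_le_self (norm_nonneg _) ?_).trans e2
    exact_mod_cast Nat.factorial_pos M
  unfold Fnext
  rw [norm_mul]
  refine (mul_le_mul e3 e1 (norm_nonneg _) (Real.exp_pos _).le).trans ?_
  rw [mul_assoc (Real.exp _)]
  refine mul_le_mul_of_nonneg_left ?_ (Real.exp_pos _).le
  exact mul_le_mul_of_nonneg_right (by linarith) (Real.exp_pos _).le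

end step


section step2
variable {c d : ℝ} {b : ℂ}

lemma Fnext_cov {M : ℕ} {y : Fin M → ℝ} {F : (Fin M → ℂ) → ℂ} (hF : Good c d b M y F) (yl : ℝ)
    (X : Fin (M+1) → ℝ) (t : ℝ) : Fnext c d b M yl F (fun j => ((X j + t : ℝ) : ℂ)) =
    exp (I * alphaPar c d * t * (∑ j, (y j : ℂ) + (M + 1) * yl)) * Fnext c d b M yl F (fun j => (X j : ℂ)) := by
  unfold Fnext
  have h1 : ∫ z : Fin M → ℝ, Hint c d b F ∅ 0 (fun j => ((X j + t : ℝ) : ℂ)) 0 0 z =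
      exp (I * alphaPar c d * t * ∑ j, (y j : ℂ)) * ∫ z : Fin M → ℝ, Hint c d b F ∅ 0 (fun j => (X j : ℂ)) 0 0 z := by
    rw [← integral_const_mul, ← integral_add_right_eq_self _ (fun _ : Fin M => t)]
    congr 1
    ext z
    rw [Hint_empty, Hint_empty]
    have e1 : F (fun k => (((z + (fun _ => t : Fin M → ℝ)) k : ℝ) : ℂ)) = _ := hF.cov z t
    rw [e1]
    have e2 : ∀ j k, (((X j + t : ℝ) : ℂ)) - (((z + (fun _ => t : Fin M → ℝ)) k : ℝ) : ℂ) = X j - z k := by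
      intro j k; simp
    simp only [e2]
    simp only [Pi.add_apply, add_sub_add_right_eq_sub]
    ring
  rw [h1]
  have e : ∑ j, ((X j + t : ℝ) : ℂ) = ∑ j, (X j : ℂ) + (M + 1) * t := by
    push_cast
    rw [Finset.sum_add_distrib]; simp
  rw [e, mul_add, exp_add, mul_add (I * alphaPar c d * t), exp_add,
    show I * alphaPar c d * yl * ((M + 1) * t) = I * alphaPar c d * t * ((M + 1) * yl) by ring]
  ring

lemma Good_trans {M : ℕ} {y : Fin M → ℝ} {F : (Fin M → ℂ) → ℂ} (hF : Good c d b M y F) (hs : b.re < c + d)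
    (X : Fin M → ℝ) (ζ : ℂ) (hζ : |ζ.im| < (c + d - b.re) / 2) :
    F (fun j => X j + ζ) = exp (I * alphaPar c d * ζ * ∑ j, (y j : ℂ)) * F (fun j => (X j : ℂ)) := by
  set σ := (c + d - b.re) / 2 with hσ
  have hσ0 : 0 < σ := by linarith
  have h := strip_id (σ := -σ) (τ := σ) (by linarith) hσ0
    (f := fun ζ => F (fun j => X j + ζ) - exp (I * alphaPar c d * ζ * ∑ j, (y j : ℂ)) * F (fun j => (X j : ℂ))) ?_ ?_
    ζ (abs_lt.mp hζ).1 (abs_lt.mp hζ).2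
  · exact sub_eq_zero.mp h
  · refine DifferentiableOn.sub ?_ (Differentiable.differentiableOn (by fun_prop))
    have := hF.line (fun j => (X j : ℂ)) (fun _ => 1)
    simp only [mul_one] at this
    refine this.mono fun z hz j => ?_
    simpa [abs_lt] using hz
  · refine Filter.Eventually.frequently (Filter.Eventually.of_forall fun t => ?_)
    have := hF.cov X t
    push_cast at this
    simp [this]

end step2


section step3
variable {c d : ℝ} {b : ℂ}

lemma ae_injective (M : ℕ) : ∀ᵐ z : Fin M → ℝ, Function.Injective z := by
  have : ∀ i j : Fin M, i ≠ j → ∀ᵐ z : Fin M → ℝ, z i ≠ z j := by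
    intro i j hij
    let φ : (Fin M → ℝ) →ₗ[ℝ] ℝ := LinearMap.proj (R := ℝ) (φ := fun _ => ℝ) i - LinearMap.proj (R := ℝ) (φ := fun _ => ℝ) j
    have h := Measure.addHaar_submodule (volume : Measure (Fin M → ℝ)) (LinearMap.ker φ) (by
      intro h
      have : (Pi.single i 1 : Fin M → ℝ) ∈ LinearMap.ker φ := h ▸ Submodule.mem_top
      simp [φ, hij.symm, hij] at this)
    refine measure_mono_null (fun z hz => ?_) h
    simp at hz
    simp [φ, hz]
  have h2 : ∀ᵐ z : Fin M → ℝ, ∀ i j : Fin M, i ≠ j → z i ≠ z j := by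
    rw [ae_all_iff]; intro i
    rw [ae_all_iff]; intro j
    by_cases hij : i = j
    · simp [hij]
    · filter_upwards [this i j hij] with z hz _ using hz
  filter_upwards [h2] with z hz i j hij
  by_contra h
  exact hz i j h hij

noncomputable def sJ (d : ℝ) {M : ℕ} (J : Finset (Fin M)) (e : ℝ) (ζ : ℂ) (k : Fin M) : ℂ :=
  if k ∈ J then ζ else I * e * d / 2

lemma sJ_re {M : ℕ} (J : Finset (Fin M)) (e : ℝ) (ζ : ℂ) (k : Fin M) :
    (sJ d J e ζ k).re = if k ∈ J then ζ.re else 0 := by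
  unfold sJ; split_ifs
  · rfl
  · rw [show I * e * d / 2 = ((e * d / 2 : ℝ) : ℂ) * I by push_cast; ring, re_ofReal_mul]; simp

lemma sJ_im (hd : 0 < d) {M : ℕ} (J : Finset (Fin M)) {e : ℝ} (he : |e| = 1) {ζ : ℂ} {τ : ℝ} (h1 : |ζ.im| ≤ τ) (h2 : d / 2 ≤ τ)
    (k : Fin M) : |(sJ d J e ζ k).im| ≤ τ := by
  unfold sJ; split_ifs
  · exact h1
  · rw [show I * e * d / 2 = ((e * d / 2 : ℝ) : ℂ) * I by push_cast; ring, im_ofReal_mul]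
    simp [abs_div, abs_mul, he, abs_of_pos hd]; exact h2

noncomputable def AJ (c d : ℝ) (b : ℂ) {M : ℕ} (F : (Fin M → ℂ) → ℂ) (J : Finset (Fin M)) (X : Fin (M+1) → ℝ) (ζ : ℂ)
    (z : Fin M → ℝ) : ℂ :=
  Hint c d b F J ζ (fun j => (X j : ℂ)) (sJ d J (-1) ζ) (sJ d J 1 ζ) z

lemma AJ_shift {M : ℕ} (F : (Fin M → ℂ) → ℂ) (J : Finset (Fin M)) (X : Fin (M+1) → ℝ) (t : ℝ) (z : Fin M → ℝ) :
    AJ c d b F J X t z = AJ c d b F J X 0 (z + fun k => if k ∈ J then t else 0) := by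
  unfold AJ Hint
  congr 1
  · congr 1
    · unfold pairF
      refine Finset.prod_congr rfl fun q _ => ?_
      by_cases i1 : q.1 ∈ J <;> by_cases i2 : q.2 ∈ J <;> simp [i1, i2] <;> congr 1 <;> ring
    · refine Finset.prod_congr rfl fun j _ => Finset.prod_congr rfl fun k _ => ?_
      congr 1
      by_cases i1 : k ∈ J <;> simp [i1, sJ]; ring
  · congr 1
    ext k
    by_cases i1 : k ∈ J <;> simp [i1, sJ]

lemma exists_tau (hb0 : 0 < b.re) (hbc : b.re < c) : ∃ τ, d / 2 < τ ∧ τ < (c + d - b.re) / 2 ∧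
    2 * τ + |c - 2 * b.re| < c + d := by
  have h1 : |c - 2 * b.re| < c := by rw [abs_lt]; constructor <;> linarith
  obtain ⟨τ, h2, h3⟩ := exists_between (lt_min (by linarith : d / 2 < (c + d - b.re) / 2)
    (by linarith : d / 2 < (c + d - |c - 2 * b.re|) / 2))
  rw [lt_min_iff] at h3
  exact ⟨τ, h2, h3.1, by linarith⟩

lemma AJ_cont (hc : 0 < c) (hd : 0 < d) (hb0 : 0 < b.re) (hbc : b.re < c) {M : ℕ}
    {y : Fin M → ℝ} {F : (Fin M → ℂ) → ℂ} (hF : Good c d b M y F) (J : Finset (Fin M)) (X : Fin (M+1) → ℝ)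
    {τ : ℝ} (h1 : d / 2 ≤ τ) (h2 : τ < (c + d - b.re) / 2) (h3 : 2 * τ + |c - 2 * b.re| < c + d) {ζ : ℂ}
    (hζ : |ζ.im| ≤ τ) : Continuous (AJ c d b F J X ζ) := by
  unfold AJ
  refine Hint_cont hc hd hb0 (by linarith) hF J (by linarith) (fun j k => ?_) (fun k => ?_)
  · have := sJ_im hd J (e := -1) (by simp) hζ h1 k
    simp only [sub_im, ofReal_im, zero_sub, abs_neg]; linarith
  · exact (sJ_im hd J (e := 1) (by simp) hζ h1 k).trans_lt h2

lemma AJ_dom (hc : 0 < c) (hd : 0 < d) (hb0 : 0 < b.re) (hbc : b.re < c) {M : ℕ} (hM : 0 < M)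
    {y : Fin M → ℝ} {F : (Fin M → ℂ) → ℂ} (hF : Good c d b M y F) (J : Finset (Fin M)) (X : Fin (M+1) → ℝ)
    {τ : ℝ} (h1 : d / 2 ≤ τ) (h2 : τ < (c + d - b.re) / 2) (h3 : 2 * τ + |c - 2 * b.re| < c + d) (R : ℝ) :
    ∃ g : (Fin M → ℝ) → ℝ, Integrable g ∧ ∀ ζ : ℂ, |ζ.im| ≤ τ → |ζ.re| ≤ R → ∀ z, ‖AJ c d b F J X ζ z‖ ≤ g z := by
  obtain ⟨g, hg, h⟩ := Hint_dom hc hd hb0 (by linarith) (max R |X 0|) hM h2 h3 hF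
  refine ⟨g, hg, fun ζ k1 k2 z => h J ζ _ _ _ z k1 (fun j k => ?_) (fun k => ?_) (fun k => ?_) (fun k => ?_) ?_ ?_⟩
  · have := sJ_im hd J (e := -1) (by simp) k1 h1 k
    simp only [sub_im, ofReal_im, zero_sub, abs_neg]; linarith
  · exact (sJ_im hd J (e := 1) (by simp) k1 h1 k)
  · exact sJ_re _ _ _ _
  · exact sJ_re _ _ _ _
  · simp
  · exact k2.trans (le_max_left _ _)

lemma AJ_int (hc : 0 < c) (hd : 0 < d) (hb0 : 0 < b.re) (hbc : b.re < c) {M : ℕ} (hM : 0 < M)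
    {y : Fin M → ℝ} {F : (Fin M → ℂ) → ℂ} (hF : Good c d b M y F) (J : Finset (Fin M)) (X : Fin (M+1) → ℝ)
    {ζ : ℂ} (hζ : |ζ.im| ≤ d / 2) : Integrable (AJ c d b F J X ζ) := by
  obtain ⟨τ, t1, t2, t3⟩ := exists_tau (d := d) hb0 hbc
  obtain ⟨g, hg, h⟩ := AJ_dom hc hd hb0 hbc hM hF J X t1.le t2 t3 |ζ.re|
  exact hg.mono' (AJ_cont hc hd hb0 hbc hF J X t1.le t2 t3 (by linarith)).aestronglyMeasurable
    (ae_of_all _ (h ζ (by linarith) le_rfl))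

lemma AJ_diffAt (hc : 0 < c) (hd : 0 < d) {M : ℕ}
    (hb0 : 0 < b.re) {y : Fin M → ℝ} {F : (Fin M → ℂ) → ℂ} (hF : Good c d b M y F) (J : Finset (Fin M)) (X : Fin (M+1) → ℝ)
    {τ : ℝ} (h1 : d / 2 ≤ τ) (h2 : τ < (c + d - b.re) / 2) (h3 : 2 * τ + |c - 2 * b.re| < c + d) {ζ : ℂ}
    (hζ : |ζ.im| ≤ τ) (z : Fin M → ℝ) : DifferentiableAt ℂ (fun ζ => AJ c d b F J X ζ z) ζ := by
  have hs : ∀ e k, DifferentiableAt ℂ (fun ζ => sJ d J e ζ k) ζ := by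
    intro e k; unfold sJ; split_ifs <;> fun_prop
  unfold AJ Hint
  refine DifferentiableAt.mul (DifferentiableAt.mul ?_ ?_) ?_
  · unfold pairF
    refine diffAt_fprod _ _ _ fun q _ => ?_
    split_ifs
    · have := Theta_diffAt hc hd (b := b) (v := (z q.1 : ℂ) - z q.2 + ζ) (by simp; linarith)
      exact DifferentiableAt.comp ζ (f := fun ζ : ℂ => (z q.1 : ℂ) - z q.2 + ζ) this (by fun_prop)
    · have := Theta_diffAt hc hd (b := b) (v := (z q.2 : ℂ) - z q.1 + ζ) (by simp; linarith)
      exact DifferentiableAt.comp ζ (f := fun ζ : ℂ => (z q.2 : ℂ) - z q.1 + ζ) this (by fun_prop)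
    · fun_prop
  · refine diffAt_fprod _ _ _ fun j _ => diffAt_fprod _ _ _ fun k _ => ?_
    have := rker_cont hc hd hb0 (b := b) (w := X j - z k - sJ d J (-1) ζ k) (by
      have := sJ_im hd J (e := -1) (by simp) hζ h1 k
      simp only [sub_im, ofReal_im, zero_sub, abs_neg, sub_zero]; linarith)
    exact DifferentiableAt.comp ζ (f := fun ζ : ℂ => (X j : ℂ) - z k - sJ d J (-1) ζ k) this ((hs _ _).const_sub _)
  · have := hF.line (fun k => z k + if k ∈ J then 0 else I * d / 2) (fun k => if k ∈ J then 1 else 0)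
    have e : ∀ ζ, (fun k => ((z k : ℂ) + if k ∈ J then 0 else I * d / 2) + ζ * (if k ∈ J then 1 else 0)) =
        (fun k => z k + sJ d J 1 ζ k) := by
      intro ζ; ext k; unfold sJ; split_ifs <;> simp
    simp only [e] at this
    refine this.differentiableAt (IsOpen.mem_nhds ?_ ?_)
    · refine (tube_open _ _).preimage (continuous_pi fun k => ?_)
      unfold sJ; split_ifs <;> fun_prop
    · intro k
      have := sJ_im hd J (e := 1) (by simp) hζ h1 k
      simp only [add_im, ofReal_im, zero_add]; linarith

lemma AJ_const (hc : 0 < c) (hd : 0 < d) (hb0 : 0 < b.re) (hbc : b.re < c) {M : ℕ} (hM : 0 < M)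
    {y : Fin M → ℝ} {F : (Fin M → ℂ) → ℂ} (hF : Good c d b M y F) (J : Finset (Fin M)) (X : Fin (M+1) → ℝ)
    {ζ : ℂ} (hζ : |ζ.im| ≤ d / 2) : ∫ z, AJ c d b F J X ζ z = ∫ z, AJ c d b F J X 0 z := by
  obtain ⟨τ, t1, t2, t3⟩ := exists_tau (d := d) hb0 hbc
  have hd' := abs_le.mp hζ
  have h := strip_id (σ := -τ) (τ := τ) (by linarith) (by linarith)
    (f := fun ζ => (∫ z, AJ c d b F J X ζ z) - ∫ z, AJ c d b F J X 0 z) ?_ ?_ ζ (by linarith) (by linarith)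
  · exact sub_eq_zero.mp h
  · refine DifferentiableOn.sub_const ?_ _
    refine hol_param ?_ ?_ ?_ ?_
    · exact (isOpen_lt continuous_const continuous_im).inter (isOpen_lt continuous_im continuous_const)
    · intro ζ hζ
      exact (AJ_cont hc hd hb0 hbc hF J X t1.le t2 t3 (abs_le.mpr ⟨hζ.1.le, hζ.2.le⟩)).aestronglyMeasurable
    · intro z ζ hζ
      exact (AJ_diffAt hc hd hb0 hF J X t1.le t2 t3 (abs_le.mpr ⟨hζ.1.le, hζ.2.le⟩) z).differentiableWithinAt
    · intro ζ₀ _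
      obtain ⟨g, hg, h⟩ := AJ_dom hc hd hb0 hbc hM hF J X t1.le t2 t3 (|ζ₀.re| + 1)
      refine ⟨1, one_pos, g, hg, ae_of_all _ fun z ζ hζ hr => h ζ (abs_le.mpr ⟨hζ.1.le, hζ.2.le⟩) ?_ z⟩
      have := (abs_re_le_norm (ζ - ζ₀)).trans hr.le
      rw [sub_re] at this
      have := abs_sub_abs_le_abs_sub ζ.re ζ₀.re
      linarith
  · refine Filter.Eventually.frequently (Filter.Eventually.of_forall fun t => ?_)
    have : ∫ z, AJ c d b F J X t z = ∫ z, AJ c d b F J X 0 z := by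
      simp_rw [AJ_shift F J X t]
      exact integral_add_right_eq_self _ _
    simp [this]

end step3


section step4
variable {c d : ℝ} {b : ℂ}

noncomputable def WW (c d : ℝ) (b : ℂ) {M : ℕ} (z : Fin M → ℝ) : ℂ :=
  ∏ q ∈ Finset.univ.filter (fun q : Fin M × Fin M => q.1 < q.2), wfun c d b (z q.1 - z q.2)

lemma pairF_plus (hc : 0 < c) (hd : 0 < d) (hb0 : 0 < b.re) (hbc : b.re < c) {M : ℕ} (J : Finset (Fin M))
    {z : Fin M → ℝ} (hz : Function.Injective z) :
    pairF c d b J (I * d / 2) z = WW c d b z * coef c (-b) (fun k => (z k : ℂ)) J := by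
  unfold pairF WW coef
  rw [pairs_prod, ← Finset.prod_mul_distrib]
  refine Finset.prod_congr rfl fun q hq => ?_
  simp only [Finset.mem_filter, Finset.mem_univ, true_and] at hq
  have k : ∀ i j, i ≠ j → wfun c d b (z i - z j) * (Complex.sinh (Real.pi * (z i - z j - I * -b) / c) / Complex.sinh (Real.pi * (z i - z j) / c)) =
      Theta c d b (z i - z j + I * d / 2) := by
    intro i j hij
    have := wfun_Theta_plus hc hd hb0 hbc (t := z i - z j) (sub_ne_zero.mpr (hz.ne hij))
    push_cast at this
    rw [← this]; simp
  by_cases i1 : q.1 ∈ J <;> by_cases i2 : q.2 ∈ J <;> simp only [i1, i2, not_true_eq_false,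
      not_false_eq_true, and_true, and_false, if_true, if_false, and_self, mul_one]
  · exact (k _ _ hq.ne).symm
  · rw [← k _ _ hq.ne', ← wfun_even hc hd, neg_sub]

lemma pairF_minus (hc : 0 < c) (hd : 0 < d) (hb0 : 0 < b.re) (hbc : b.re < c) {M : ℕ} (J : Finset (Fin M))
    {z : Fin M → ℝ} (hz : Function.Injective z) :
    pairF c d b J (-(I * d / 2)) z = WW c d b z * coef c b (fun k => (z k : ℂ)) J := by
  unfold pairF WW coef
  rw [pairs_prod, ← Finset.prod_mul_distrib]
  refine Finset.prod_congr rfl fun q hq => ?_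
  simp only [Finset.mem_filter, Finset.mem_univ, true_and] at hq
  have k : ∀ i j, i ≠ j → wfun c d b (z i - z j) * (Complex.sinh (Real.pi * (z i - z j - I * b) / c) / Complex.sinh (Real.pi * (z i - z j) / c)) =
      Theta c d b (z i - z j + -(I * d / 2)) := by
    intro i j hij
    have := wfun_Theta_minus hc hd hb0 hbc (t := z i - z j) (sub_ne_zero.mpr (hz.ne hij))
    push_cast at this
    rw [this]; rfl
  by_cases i1 : q.1 ∈ J <;> by_cases i2 : q.2 ∈ J <;> simp only [i1, i2, not_true_eq_false,
      not_false_eq_true, and_true, and_false, if_true, if_false, and_self, mul_one]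
  · exact (k _ _ hq.ne).symm
  · rw [← k _ _ hq.ne', ← wfun_even hc hd, neg_sub]

lemma rker_fker (hc : 0 < c) (hd : 0 < d) (hb0 : 0 < b.re) (hbc : b.re < c) (u : ℝ) :
    rker c d b (u - I * d / 2) = rker c d b (u + I * d / 2) * fker c b u := by
  have h := rker_shift hc hd (b := b) (w := u) (by simp [abs_of_pos hb0]; linarith)
  have hn : cosh (Real.pi * (u - I * b / 2) / c) ≠ 0 := cosh_ne hc (by
    have : ((u : ℂ) - I * b / 2).im = - (b.re / 2) := by
      rw [show (u : ℂ) - I * b / 2 = u + (-(1/2) : ℝ) * (I * b) by push_cast; ring, add_im, im_ofReal_mul]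
      simp; ring
    rw [this, abs_neg, abs_of_pos (by linarith)]; linarith)
  unfold fker
  rw [mul_div_assoc', eq_div_iff hn, h]

/-- common kernel -/
noncomputable def RP (c d : ℝ) (b : ℂ) {M : ℕ} (X : Fin (M+1) → ℝ) (z : Fin M → ℝ) : ℂ :=
  ∏ j, ∏ k, rker c d b ((X j : ℂ) - z k + I * d / 2)

lemma prod_ite_mul {n : ℕ} (T : Finset (Fin n)) (f g : Fin n → ℂ) :
    ∏ i, f i * (if i ∈ T then g i else 1) = (∏ i, f i) * ∏ i ∈ T, g i := by
  rw [Finset.prod_mul_distrib, Finset.prod_ite_mem, Finset.univ_inter]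

lemma kerx (hc : 0 < c) (hd : 0 < d) (hb0 : 0 < b.re) (hbc : b.re < c) {M : ℕ} (X : Fin (M+1) → ℝ) (z : Fin M → ℝ)
    (T : Finset (Fin (M+1))) :
    ∏ j, ∏ k, rker c d b (X j + I * d / 2 - I * d * (if j ∈ T then 1 else 0) - z k) =
      RP c d b X z * ∏ m ∈ T, ∏ k, fker c b (X m - z k) := by
  unfold RP
  rw [← prod_ite_mul]
  refine Finset.prod_congr rfl fun j _ => ?_
  split_ifs
  · rw [← Finset.prod_mul_distrib]
    refine Finset.prod_congr rfl fun k _ => ?_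
    have := rker_fker hc hd hb0 hbc (X j - z k)
    push_cast at this
    rw [← this]; congr 1; ring
  · rw [mul_one]
    refine Finset.prod_congr rfl fun k _ => ?_
    congr 1; ring

lemma kerz (hc : 0 < c) (hd : 0 < d) (hb0 : 0 < b.re) (hbc : b.re < c) {M : ℕ} (X : Fin (M+1) → ℝ) (z : Fin M → ℝ)
    (J : Finset (Fin M)) :
    ∏ j, ∏ k, rker c d b (X j - z k - sJ d J (-1) (I * d / 2) k) =
      RP c d b X z * ∏ m ∈ J, ∏ i, fker c b (X i - z m) := by
  unfold RP
  rw [Finset.prod_comm, Finset.prod_comm (f := fun j k => rker c d b ((X j : ℂ) - z k + I * d / 2)), ← prod_ite_mul]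
  refine Finset.prod_congr rfl fun k _ => ?_
  split_ifs with h
  · rw [← Finset.prod_mul_distrib]
    refine Finset.prod_congr rfl fun j _ => ?_
    have := rker_fker hc hd hb0 hbc (X j - z k)
    push_cast at this
    rw [← this]; simp [sJ, h]
  · rw [mul_one]
    refine Finset.prod_congr rfl fun j _ => ?_
    congr 1; simp [sJ, h]; ring

/-- pointwise identity, first half -/
lemma point1 (hc : 0 < c) (hd : 0 < d) (hb0 : 0 < b.re) (hbc : b.re < c) {M : ℕ}
    {y : Fin M → ℝ} {F : (Fin M → ℂ) → ℂ} (hF : Good c d b M y F) (X : Fin (M+1) → ℝ) (hX : Function.Injective X)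
    {z : Fin M → ℝ} (hz : Function.Injective z) (k : ℕ) :
    exp (I * alphaPar c d * (I * d / 2) * ∑ j, (y j : ℂ)) *
    ∑ T ∈ Finset.powersetCard (k+1) Finset.univ, coef c b (fun j => (X j : ℂ)) T *
      Hint c d b F ∅ 0 (fun j => X j + I * d / 2 - I * d * (if j ∈ T then 1 else 0)) 0 0 z =
    ∑ J ∈ Finset.powersetCard (k+1) Finset.univ, AJ c d b F J X (I * d / 2) z +
    ∑ J ∈ Finset.powersetCard k Finset.univ, AJ c d b F J X (I * d / 2) z := by
  have hT := Good_trans hF (by linarith) z (I * d / 2) (by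
    rw [show I * d / 2 = ((d / 2 : ℝ) : ℂ) * I by push_cast; ring, im_ofReal_mul]
    simp only [I_im, mul_one]; rw [abs_of_pos (by linarith)]; linarith)
  set q := exp (I * alphaPar c d * (I * d / 2) * ∑ j, (y j : ℂ))
  have hA : ∀ J : Finset (Fin M), AJ c d b F J X (I * d / 2) z = WW c d b z * RP c d b X z * F (fun j => z j + I * d / 2) *
      (coef c (-b) (fun k => (z k : ℂ)) J * ∏ m ∈ J, ∏ i, fker c b (X i - z m)) := by
    intro J
    unfold AJ Hint
    rw [kerz hc hd hb0 hbc, pairF_plus hc hd hb0 hbc J hz]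
    have : (fun k => (z k : ℂ) + sJ d J 1 (I * d / 2) k) = fun j => z j + I * d / 2 := by
      ext k; simp [sJ]
    rw [this]; ring
  simp only [hA, ← Finset.mul_sum]
  rw [← mul_add, ← kernel_id hc (by rw [abs_of_pos hb0]; exact hbc) X z hX hz k, hT]
  simp only [Hint_empty, kerx hc hd hb0 hbc]
  simp only [Finset.mul_sum]
  refine Finset.sum_congr rfl fun T _ => ?_
  unfold WW
  ring

/-- pointwise identity, second half -/
lemma point2 (hc : 0 < c) (hd : 0 < d) (hb0 : 0 < b.re) (hbc : b.re < c) {M : ℕ}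
    {y : Fin M → ℝ} {F : (Fin M → ℂ) → ℂ} (hF : Good c d b M y F) (X : Fin (M+1) → ℝ)
    {z : Fin M → ℝ} (hz : Function.Injective z) (k : ℕ) :
    ∑ J ∈ Finset.powersetCard k Finset.univ, AJ c d b F J X (-(I * d / 2)) z =
    exp (I * alphaPar c d * (I * d / 2) * ∑ j, (y j : ℂ)) *
    (∑ T ∈ Finset.powersetCard k (Finset.univ : Finset (Fin M)), ∏ j ∈ T, Complex.exp (((2 * Real.pi * y j / c : ℝ) : ℂ))) *
      Hint c d b F ∅ 0 (fun j => X j + I * d / 2) 0 0 z := by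
  have hT := Good_trans hF (by linarith) z (I * d / 2) (by
    rw [show I * d / 2 = ((d / 2 : ℝ) : ℂ) * I by push_cast; ring, im_ofReal_mul]
    simp only [I_im, mul_one]; rw [abs_of_pos (by linarith)]; linarith)
  set q := exp (I * alphaPar c d * (I * d / 2) * ∑ j, (y j : ℂ))
  have hA : ∀ J : Finset (Fin M), AJ c d b F J X (-(I * d / 2)) z = WW c d b z * RP c d b X z *
      (coef c b (fun k => (z k : ℂ)) J * F (fun j => z j + I * d / 2 - I * d * (if j ∈ J then 1 else 0))) := by
    intro J
    unfold AJ Hint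
    rw [pairF_minus hc hd hb0 hbc J hz]
    have e1 : (fun k => (z k : ℂ) + sJ d J 1 (-(I * d / 2)) k) = fun j => z j + I * d / 2 - I * d * (if j ∈ J then 1 else 0) := by
      ext k; unfold sJ; split_ifs
      · ring
      · simp
    have e2 : ∏ j, ∏ k, rker c d b (X j - z k - sJ d J (-1) (-(I * d / 2)) k) = RP c d b X z := by
      unfold RP
      refine Finset.prod_congr rfl fun j _ => Finset.prod_congr rfl fun k _ => ?_
      congr 1; unfold sJ; split_ifs
      · ring
      · push_cast; ring
    rw [e1, e2]; ring
  simp only [hA, ← Finset.mul_sum]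
  rw [hF.eig k z hz, hT, Hint_empty]
  have : ∏ j, ∏ k, rker c d b (X j + I * d / 2 - z k) = RP c d b X z := by
    unfold RP
    refine Finset.prod_congr rfl fun j _ => Finset.prod_congr rfl fun k _ => ?_
    congr 1; ring
  rw [this]
  unfold WW
  ring

end step4


section step5
variable {c d : ℝ} {b : ℂ}

lemma xT_tube (hc : 0 < c) (hd : 0 < d) (hbc : b.re < c) {n : ℕ} (X : Fin n → ℝ) (T : Finset (Fin n)) :
    (fun j => (X j : ℂ) + I * d / 2 - I * d * (if j ∈ T then 1 else 0)) ∈ tube n ((c + d - b.re) / 2) := by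
  intro j
  by_cases h : j ∈ T
  · have : (X j + I * d / 2 - I * d * (if j ∈ T then 1 else 0) : ℂ) = (X j : ℂ) + ((-(d / 2) : ℝ) : ℂ) * I := by
      simp [h]; ring
    simp only [this, add_im, ofReal_im, im_ofReal_mul, I_im, zero_add, mul_one, abs_neg]
    rw [abs_of_pos (by linarith)]; linarith
  · have : (X j + I * d / 2 - I * d * (if j ∈ T then 1 else 0) : ℂ) = (X j : ℂ) + ((d / 2 : ℝ) : ℂ) * I := by
      simp [h]; ring
    simp only [this, add_im, ofReal_im, im_ofReal_mul, I_im, zero_add, mul_one]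
    rw [abs_of_pos (by linarith)]; linarith

lemma Hint0_int (hc : 0 < c) (hd : 0 < d) (hb0 : 0 < b.re) (hbc : b.re < c) {M : ℕ} (hM : 0 < M)
    {y : Fin M → ℝ} {F : (Fin M → ℂ) → ℂ} (hF : Good c d b M y F) {x : Fin (M+1) → ℂ}
    (hx : x ∈ tube (M+1) ((c + d - b.re) / 2)) : Integrable (Hint c d b F ∅ 0 x 0 0) := by
  obtain ⟨g, hg, h⟩ := Hint0_dom hc hd hb0 hbc hM hF hx
  exact hg.mono' (Hint0_cont hc hd hb0 hbc hF hx).aestronglyMeasurable (ae_of_all _ h.self_of_nhds)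

noncomputable def esym (c : ℝ) {n : ℕ} (y : Fin n → ℝ) (k : ℕ) : ℂ :=
  ∑ T ∈ Finset.powersetCard k (Finset.univ : Finset (Fin n)), ∏ j ∈ T, Complex.exp (((2 * Real.pi * y j / c : ℝ) : ℂ))

lemma int_eig (hc : 0 < c) (hd : 0 < d) (hb0 : 0 < b.re) (hbc : b.re < c) {M : ℕ} (hM : 0 < M)
    {y : Fin M → ℝ} {F : (Fin M → ℂ) → ℂ} (hF : Good c d b M y F) (X : Fin (M+1) → ℝ) (hX : Function.Injective X) (k : ℕ) :
    ∑ T ∈ Finset.powersetCard (k+1) Finset.univ, coef c b (fun j => (X j : ℂ)) T *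
      ∫ z, Hint c d b F ∅ 0 (fun j => X j + I * d / 2 - I * d * (if j ∈ T then 1 else 0)) 0 0 z =
    (esym c y (k+1) + esym c y k) * ∫ z, Hint c d b F ∅ 0 (fun j => X j + I * d / 2) 0 0 z := by
  have him : |(I * d / 2).im| ≤ d / 2 := by
    rw [show I * d / 2 = ((d / 2 : ℝ) : ℂ) * I by push_cast; ring, im_ofReal_mul]
    simp only [I_im, mul_one]; rw [abs_of_pos (by linarith)]
  have him' : |(-(I * d / 2)).im| ≤ d / 2 := by rw [neg_im, abs_neg]; exact him
  set q := exp (I * alphaPar c d * (I * d / 2) * ∑ j, (y j : ℂ)) with hq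
  have hq0 : q ≠ 0 := exp_ne_zero _
  apply mul_left_cancel₀ hq0
  have L1 : q * ∑ T ∈ Finset.powersetCard (k+1) Finset.univ, coef c b (fun j => (X j : ℂ)) T *
      ∫ z, Hint c d b F ∅ 0 (fun j => X j + I * d / 2 - I * d * (if j ∈ T then 1 else 0)) 0 0 z =
      ∫ z, (∑ J ∈ Finset.powersetCard (k+1) Finset.univ, AJ c d b F J X (I * d / 2) z +
        ∑ J ∈ Finset.powersetCard k Finset.univ, AJ c d b F J X (I * d / 2) z) := by
    simp only [← integral_const_mul]
    rw [← integral_finsetSum _ fun T _ => (Hint0_int hc hd hb0 hbc hM hF (xT_tube hc hd hbc X T)).const_mul _,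
      ← integral_const_mul]
    refine integral_congr_ae ?_
    filter_upwards [ae_injective M] with z hz
    exact point1 hc hd hb0 hbc hF X hX hz k
  have iA : ∀ ζ : ℂ, |ζ.im| ≤ d / 2 → ∀ k, Integrable (fun z => ∑ J ∈ Finset.powersetCard k Finset.univ, AJ c d b F J X ζ z) :=
    fun ζ hζ k => integrable_finsetSum _ fun J _ => AJ_int hc hd hb0 hbc hM hF J X hζ
  have L2 : ∀ k, ∫ z, ∑ J ∈ Finset.powersetCard k Finset.univ, AJ c d b F J X (I * d / 2) z =
      ∫ z, ∑ J ∈ Finset.powersetCard k Finset.univ, AJ c d b F J X (-(I * d / 2)) z := by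
    intro k
    rw [integral_finsetSum _ fun J _ => AJ_int hc hd hb0 hbc hM hF J X him,
      integral_finsetSum _ fun J _ => AJ_int hc hd hb0 hbc hM hF J X him']
    refine Finset.sum_congr rfl fun J _ => ?_
    rw [AJ_const hc hd hb0 hbc hM hF J X him, AJ_const hc hd hb0 hbc hM hF J X him']
  have L3 : ∀ k, ∫ z, ∑ J ∈ Finset.powersetCard k Finset.univ, AJ c d b F J X (-(I * d / 2)) z =
      q * esym c y k * ∫ z, Hint c d b F ∅ 0 (fun j => X j + I * d / 2) 0 0 z := by
    intro k
    rw [← integral_const_mul]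
    refine integral_congr_ae ?_
    filter_upwards [ae_injective M] with z hz
    exact point2 hc hd hb0 hbc hF X hz k
  rw [L1, integral_add (iA _ him _) (iA _ him _), L2, L2, L3, L3]
  ring

lemma esym_split (hc : 0 < c) {M : ℕ} (y : Fin (M+1) → ℝ) (k : ℕ) :
    esym c y (k+1) = exp (((2 * Real.pi * y (Fin.last M) / c : ℝ) : ℂ)) ^ (k+1) *
      (esym c (fun j => y (Fin.castSucc j) - y (Fin.last M)) (k+1) + esym c (fun j => y (Fin.castSucc j) - y (Fin.last M)) k) := by
  set E := exp (((2 * Real.pi * y (Fin.last M) / c : ℝ) : ℂ)) with hE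
  have key : ∀ j : Fin M, exp (((2 * Real.pi * y (Fin.castSucc j) / c : ℝ) : ℂ)) =
      E * exp (((2 * Real.pi * (y (Fin.castSucc j) - y (Fin.last M)) / c : ℝ) : ℂ)) := by
    intro j; rw [hE, ← exp_add]; congr 1; push_cast; ring
  have h : ∀ (k : ℕ) (T : Finset (Fin M)), T ∈ Finset.powersetCard k (Finset.univ : Finset (Fin M)) → 
      ∏ j ∈ T.map Fin.castSuccEmb, exp (((2 * Real.pi * y j / c : ℝ) : ℂ)) =
      E ^ k * ∏ j ∈ T, exp (((2 * Real.pi * (y (Fin.castSucc j) - y (Fin.last M)) / c : ℝ) : ℂ)) := by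
    intro k T hT
    rw [Finset.prod_map]
    have : T.card = k := (Finset.mem_powersetCard.mp hT).2
    rw [← this, ← Finset.prod_const, ← Finset.prod_mul_distrib]
    exact Finset.prod_congr rfl fun j _ => key j
  unfold esym
  rw [sum_powersetCard_last, mul_add, Finset.mul_sum, Finset.mul_sum]
  congr 1
  · exact Finset.sum_congr rfl fun T hT => h _ T hT
  · refine Finset.sum_congr rfl fun T hT => ?_
    rw [Finset.prod_insert (last_notMem_map T), h _ T hT, pow_succ, ← hE]; ring

lemma sum_xT {n : ℕ} (X : Fin n → ℝ) (T : Finset (Fin n)) :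
    ∑ j, ((X j : ℂ) + I * d / 2 - I * d * (if j ∈ T then 1 else 0)) = ∑ j, ((X j : ℂ) + I * d / 2) - I * d * T.card := by
  rw [Finset.sum_sub_distrib, ← Finset.mul_sum]; simp

lemma Fnext_eig (hc : 0 < c) (hd : 0 < d) (hb0 : 0 < b.re) (hbc : b.re < c) {M : ℕ} (hM : 0 < M)
    {y : Fin (M+1) → ℝ} {F : (Fin M → ℂ) → ℂ} (hF : Good c d b M (fun j => y (Fin.castSucc j) - y (Fin.last M)) F)
    (k : ℕ) (X : Fin (M+1) → ℝ) (hX : Function.Injective X) :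
    ∑ T ∈ Finset.powersetCard k (Finset.univ : Finset (Fin (M+1))), coef c b (fun j => (X j : ℂ)) T *
      Fnext c d b M (y (Fin.last M)) F (fun j => X j + I * d / 2 - I * d * (if j ∈ T then 1 else 0)) =
    esym c y k * Fnext c d b M (y (Fin.last M)) F (fun j => X j + I * d / 2) := by
  rcases k with _ | k
  · simp [esym, coef]
  have h := int_eig hc hd hb0 hbc hM hF X hX k
  set E := exp (((2 * Real.pi * y (Fin.last M) / c : ℝ) : ℂ)) with hE
  set P := exp (I * alphaPar c d * y (Fin.last M) * ∑ j, ((X j : ℂ) + I * d / 2)) / (Nat.factorial M : ℂ) with hP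
  have hT : ∀ T ∈ Finset.powersetCard (k+1) (Finset.univ : Finset (Fin (M+1))), coef c b (fun j => (X j : ℂ)) T *
      Fnext c d b M (y (Fin.last M)) F (fun j => X j + I * d / 2 - I * d * (if j ∈ T then 1 else 0)) =
      P * E ^ (k+1) * (coef c b (fun j => (X j : ℂ)) T * 
      ∫ z, Hint c d b F ∅ 0 (fun j => X j + I * d / 2 - I * d * (if j ∈ T then 1 else 0)) 0 0 z) := by
    intro T hT
    have hcard : T.card = k + 1 := (Finset.mem_powersetCard.mp hT).2
    unfold Fnext
    rw [sum_xT, hcard]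
    have : exp (I * alphaPar c d * y (Fin.last M) * (∑ j, ((X j : ℂ) + I * d / 2) - I * d * ((k + 1 : ℕ) : ℂ))) =
        exp (I * alphaPar c d * y (Fin.last M) * ∑ j, ((X j : ℂ) + I * d / 2)) * E ^ (k+1) := by
      rw [hE, ← exp_nat_mul, ← exp_add]
      congr 1
      rw [mul_sub, sub_eq_add_neg]
      congr 1
      have hc' : (c : ℂ) ≠ 0 := by exact_mod_cast hc.ne'
      have hd' : (d : ℂ) ≠ 0 := by exact_mod_cast hd.ne'
      unfold alphaPar
      push_cast
      field_simp
      rw [I_sq]; ring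
    rw [this, hP]; ring
  rw [Finset.sum_congr rfl hT, ← Finset.mul_sum, h, esym_split hc, ← hE]
  unfold Fnext
  rw [← hP]; ring

lemma Good_step (hc : 0 < c) (hd : 0 < d) (hb0 : 0 < b.re) (hbc : b.re < c) {N : ℕ}
    {y : Fin (N+2) → ℝ} {F : (Fin (N+1) → ℂ) → ℂ}
    (hF : Good c d b (N+1) (fun j => y (Fin.castSucc j) - y (Fin.last (N+1))) F) :
    Good c d b (N+2) y (Fnext c d b (N+1) (y (Fin.last (N+1))) F) where
  agree := Fnext_agree hF
  cont := Fnext_cont hc hd hb0 hbc (Nat.succ_pos _) hF _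
  line := Fnext_line hc hd hb0 hbc (Nat.succ_pos _) hF _
  bound := Fnext_bound hc hd hb0 hbc (Nat.succ_pos _) hF _
  cov := fun X t => by
    rw [Fnext_cov hF]
    congr 2
    rw [Fin.sum_univ_castSucc (n := N+1)]
    push_cast
    rw [Finset.sum_sub_distrib]
    simp only [Finset.sum_const, Finset.card_univ, Fintype.card_fin, nsmul_eq_mul]
    push_cast
    ring
  eig := fun k X hX => Fnext_eig hc hd hb0 hbc (Nat.succ_pos _) hF k X hX

lemma Good_base (hc : 0 < c) (hd : 0 < d) (y : Fin 1 → ℝ) :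
    Good c d b 1 y (fun x => exp (I * alphaPar c d * x 0 * y 0)) where
  agree := fun x => by simp [Jrec]
  cont := Continuous.continuousOn (by fun_prop)
  line := fun p v => Differentiable.differentiableOn (by fun_prop)
  bound := fun ε ρ _ _ _ => by
    refine ⟨Real.exp (|alphaPar c d * y 0| * ρ), Real.exp_pos _, fun x hx => ?_⟩
    have hD : Dsum (fun j => (x j).re) = 0 := by
      unfold Dsum
      refine Finset.sum_eq_zero fun q hq => ?_
      have : q.1 = q.2 := Subsingleton.elim _ _
      simp [this]
    rw [hD, mul_zero, mul_zero, Real.exp_zero, mul_one, norm_exp]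
    apply Real.exp_le_exp.mpr
    rw [show I * alphaPar c d * x 0 * y 0 = ((alphaPar c d * y 0 : ℝ) : ℂ) * (I * x 0) by push_cast; ring, re_ofReal_mul]
    refine (le_abs_self _).trans ?_
    rw [abs_mul]
    refine mul_le_mul_of_nonneg_left ?_ (abs_nonneg _)
    simpa using hx 0
  cov := fun X t => by
    rw [← exp_add]; congr 1; simp; ring
  eig := fun k X hX => by
    have hc' : (c : ℂ) ≠ 0 := by exact_mod_cast hc.ne'
    have hd' : (d : ℂ) ≠ 0 := by exact_mod_cast hd.ne'
    rcases k with _ | k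
    · simp [coef]
    rcases k with _ | k
    · have : Finset.powersetCard (0+1) (Finset.univ : Finset (Fin 1)) = {{0}} := by decide
      rw [this, Finset.sum_singleton, Finset.sum_singleton, Finset.prod_singleton]
      have : coef c b (fun j => (X j : ℂ)) {0} = 1 := by
        have h : ({0} : Finset (Fin 1))ᶜ = ∅ := by decide
        simp [coef, h]
      rw [this, one_mul, ← exp_add]
      congr 1
      simp only [Finset.mem_singleton, if_true]
      unfold alphaPar
      push_cast
      field_simp
      ring_nf
      rw [I_sq]; ring
    · have : Finset.powersetCard (k+1+1) (Finset.univ : Finset (Fin 1)) = ∅ := by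
        rw [Finset.powersetCard_eq_empty]; simp
      rw [this]; simp

lemma Good_exists (hc : 0 < c) (hd : 0 < d) (hb0 : 0 < b.re) (hbc : b.re < c) (N : ℕ) :
    ∀ y : Fin (N+1) → ℝ, ∃ F, Good c d b (N+1) y F := by
  induction N with
  | zero => exact fun y => ⟨_, Good_base hc hd y⟩
  | succ N ih =>
    intro y
    obtain ⟨F, hF⟩ := ih (fun j => y (Fin.castSucc j) - y (Fin.last (N+1)))
    exact ⟨_, Good_step hc hd hb0 hbc hF⟩

end step5


section final
variable {c d : ℝ} {b : ℂ}

lemma exists_stretch {ι : Type*} [Finite ι] (u : ι → ℝ) {s : ℝ} (h : ∀ i, u i < s) :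
    ∃ τ : ℝ, 1 < τ ∧ ∀ i, τ * u i < s := by
  have : ∀ᶠ τ in nhdsWithin (1:ℝ) (Set.Ioi 1), 1 < τ ∧ ∀ i, τ * u i < s := by
    refine (eventually_mem_nhdsWithin).and (nhdsWithin_le_nhds (Filter.eventually_all.mpr fun i => ?_))
    have hc : ContinuousAt (fun τ : ℝ => τ * u i) 1 := Continuous.continuousAt (by fun_prop)
    exact hc.eventually_lt continuousAt_const (by simpa using h i)
  exact this.exists

lemma abs_mul_lt {t τ u s : ℝ} (h1 : -τ < t) (h2 : t < τ) (h : τ * |u| < s) : |t * u| < s := by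
  rw [abs_mul]
  exact (mul_le_mul_of_nonneg_right (abs_le.mpr ⟨h1.le, h2.le⟩) (abs_nonneg _)).trans_lt h

lemma F_eq_Good {N : ℕ} {y : Fin N → ℝ} {G Fb : (Fin N → ℂ) → ℂ} (hG : Good c d b N y G)
    (hF : DifferentiableOn ℂ Fb {x | ∀ j k, |(x j - x k).im| < c + d - b.re})
    (hA : ∀ x : Fin N → ℝ, Fb (fun i => (x i : ℂ)) = Jrec c d b N x y) {x : Fin N → ℂ}
    (hx : x ∈ tube N ((c + d - b.re) / 2)) : Fb x = G x := by
  obtain ⟨τ, h1, h2⟩ := exists_stretch (fun j => |(x j).im|) hx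
  set p : Fin N → ℂ := fun j => ((x j).re : ℂ)
  set v : Fin N → ℂ := fun j => ((x j).im : ℂ)
  have hline : Differentiable ℂ (fun ζ : ℂ => (fun j => p j + ζ * v j : Fin N → ℂ)) := by fun_prop
  have htube : ∀ ζ : ℂ, -τ < ζ.im → ζ.im < τ → ∀ j, |(p j + ζ * v j).im| < (c + d - b.re) / 2 := by
    intro ζ k1 k2 j
    have : (p j + ζ * v j).im = ζ.im * (x j).im := by simp [p, v]
    rw [this]; exact abs_mul_lt k1 k2 (h2 j)
  have h := strip_id (σ := -τ) (τ := τ) (by linarith) (by linarith)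
    (f := fun ζ => Fb (fun j => p j + ζ * v j) - G (fun j => p j + ζ * v j)) ?_ ?_ I (by simp; linarith) (by simpa using h1)
  · have e : (fun j => p j + I * v j) = x := by
      ext j; simp only [p, v]; rw [mul_comm]; exact re_add_im _
    rw [e] at h
    exact sub_eq_zero.mp h
  · refine DifferentiableOn.sub ?_ ((hG.line p v).mono fun ζ hζ => htube ζ hζ.1 hζ.2)
    refine hF.comp hline.differentiableOn fun ζ hζ j k => ?_
    have a1 := htube ζ hζ.1 hζ.2 j
    have a2 := htube ζ hζ.1 hζ.2 k
    rw [sub_im]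
    exact (abs_sub _ _).trans_lt (by linarith)
  · refine Filter.Eventually.frequently (Filter.Eventually.of_forall fun t => ?_)
    have e : (fun j => p j + t * v j) = fun j => (((x j).re + t * (x j).im : ℝ) : ℂ) := by
      ext j; simp [p, v]
    rw [e, hA, hG.agree, sub_self]

noncomputable def den (c : ℝ) {n : ℕ} (x : Fin n → ℂ) : ℂ :=
  ∏ m, ∏ l, if m = l then 1 else Complex.sinh ((Real.pi : ℂ) * (x m - x l) / (c : ℂ))

noncomputable def numT (c : ℝ) (b : ℂ) {n : ℕ} (T : Finset (Fin n)) (x : Fin n → ℂ) : ℂ :=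
  ∏ m, ∏ l, if m ∈ T ∧ l ∉ T then Complex.sinh ((Real.pi : ℂ) * (x m - x l - I * b) / (c : ℂ)) else
    if m = l then 1 else Complex.sinh ((Real.pi : ℂ) * (x m - x l) / (c : ℂ))

lemma den_ne {n : ℕ} (x : Fin n → ℂ) : den c x ≠ 0 ↔ ∀ m l, m ≠ l → Complex.sinh ((Real.pi : ℂ) * (x m - x l) / (c : ℂ)) ≠ 0 := by
  unfold den
  simp only [Finset.prod_ne_zero_iff, Finset.mem_univ, true_implies]
  refine forall_congr' fun m => forall_congr' fun l => ?_
  by_cases h : m = l <;> simp [h]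

lemma coef_den {n : ℕ} (T : Finset (Fin n)) (x : Fin n → ℂ)
    (hx : ∀ m l, m ≠ l → Complex.sinh ((Real.pi : ℂ) * (x m - x l) / (c : ℂ)) ≠ 0) :
    coef c b x T * den c x = numT c b T x := by
  have : coef c b x T = ∏ m, ∏ l, if m ∈ T ∧ l ∉ T then Complex.sinh ((Real.pi : ℂ) * (x m - x l - I * b) / (c : ℂ)) /
            Complex.sinh ((Real.pi : ℂ) * (x m - x l) / (c : ℂ)) else 1 := by
    unfold coef
    rw [← Finset.prod_subset (Finset.subset_univ T)]
    · refine Finset.prod_congr rfl fun m hm => ?_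
      rw [← Finset.prod_subset (Finset.subset_univ Tᶜ)]
      · refine Finset.prod_congr rfl fun l hl => ?_
        rw [if_pos ⟨hm, by simpa using hl⟩]
      · intro l _ hl
        rw [if_neg]; rintro ⟨_, h⟩; exact hl (by simpa using h)
    · intro m _ hm
      refine Finset.prod_eq_one fun l _ => ?_
      rw [if_neg]; rintro ⟨h, _⟩; exact hm h
  rw [this]
  unfold den numT
  rw [← Finset.prod_mul_distrib]
  refine Finset.prod_congr rfl fun m _ => ?_
  rw [← Finset.prod_mul_distrib]
  refine Finset.prod_congr rfl fun l _ => ?_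
  by_cases h : m ∈ T ∧ l ∉ T
  · have hml : m ≠ l := by rintro rfl; exact h.2 h.1
    rw [if_pos h, if_pos h, if_neg hml, div_mul_cancel₀ _ (hx m l hml)]
  · rw [if_neg h, if_neg h, one_mul]

lemma den_diff {n : ℕ} : Differentiable ℂ (fun x : Fin n → ℂ => den c x) := by
  intro x
  unfold den
  refine diffAt_fprod _ _ _ fun m _ => diffAt_fprod _ _ _ fun l _ => ?_
  split_ifs
  · fun_prop
  · have : DifferentiableAt ℂ (fun x : Fin n → ℂ => (Real.pi : ℂ) * (x m - x l) / (c : ℂ)) x := by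
      simp only [div_eq_mul_inv]; fun_prop
    exact this.csinh

lemma num_diff {n : ℕ} (T : Finset (Fin n)) : Differentiable ℂ (fun x : Fin n → ℂ => numT c b T x) := by
  intro x
  unfold numT
  refine diffAt_fprod _ _ _ fun m _ => diffAt_fprod _ _ _ fun l _ => ?_
  split_ifs
  · have : DifferentiableAt ℂ (fun x : Fin n → ℂ => (Real.pi : ℂ) * (x m - x l - I * b) / (c : ℂ)) x := by
      simp only [div_eq_mul_inv]; fun_prop
    exact this.csinh
  · fun_prop
  · have : DifferentiableAt ℂ (fun x : Fin n → ℂ => (Real.pi : ℂ) * (x m - x l) / (c : ℂ)) x := by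
      simp only [div_eq_mul_inv]; fun_prop
    exact this.csinh

lemma main_eig (hc : 0 < c) (hd : 0 < d) (hb0 : 0 < b.re) (hbc : b.re < c) {n : ℕ} (y : Fin (n+1) → ℝ)
    (Fb : (Fin (n+1) → ℂ) → ℂ) (hF : DifferentiableOn ℂ Fb {x | ∀ j k, |(x j - x k).im| < c + d - b.re})
    (hA : ∀ x : Fin (n+1) → ℝ, Fb (fun i => (x i : ℂ)) = Jrec c d b (n+1) x y)
    (x : Fin (n+1) → ℂ) (hx : ∀ j k, |(x j - x k).im| < c - b.re)
    (hs : ∀ m l, m ≠ l → Complex.sinh ((Real.pi : ℂ) * (x m - x l) / (c : ℂ)) ≠ 0) (k : ℕ) :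
    ∑ T ∈ Finset.powersetCard k Finset.univ, coef c b x T * Fb (fun j => x j - I * d * (if j ∈ T then 1 else 0)) =
      esym c y k * Fb x := by
  obtain ⟨G, hG⟩ := Good_exists hc hd hb0 hbc n y
  obtain ⟨τ, h1, h2⟩ := exists_stretch (fun q : Fin (n+1) × Fin (n+1) => |(x q.1 - x q.2).im|) (fun q => hx q.1 q.2)
  have hd2 : b.re < c + d := by linarith
  set p : Fin (n+1) → ℂ := fun j => ((x j).re : ℂ) + I * d / 2 with hp
  set v : Fin (n+1) → ℂ := fun j => (((x j).im - d / 2 : ℝ) : ℂ) with hv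
  let xs : ℂ → (Fin (n+1) → ℂ) := fun ζ j => p j + ζ * v j
  have hxs : Differentiable ℂ xs := by
    refine differentiable_pi.mpr fun j => ?_
    change Differentiable ℂ (fun ζ => p j + ζ * v j); fun_prop
  have hxI : xs I = x := by
    ext j
    change p j + I * v j = x j
    rw [hp, hv]; push_cast
    conv_rhs => rw [← re_add_im (x j)]
    ring
  have himv : ∀ ζ j k, (xs ζ j - xs ζ k).im = ζ.im * (x j - x k).im := by
    intro ζ j k
    have : xs ζ j - xs ζ k = (((x j).re - (x k).re : ℝ) : ℂ) + ζ * (((x j - x k).im : ℝ) : ℂ) := by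
      change p j + ζ * v j - (p k + ζ * v k) = _
      rw [hp, hv, sub_im]; push_cast; ring
    rw [this, add_im, ofReal_im, im_mul_ofReal, zero_add]
  have hdiff : ∀ ζ : ℂ, -τ < ζ.im → ζ.im < τ → ∀ j k, |(xs ζ j - xs ζ k).im| < c - b.re := by
    intro ζ k1 k2 j k
    rw [himv]; exact abs_mul_lt k1 k2 (h2 (j, k))
  have hreal : ∀ t : ℝ, xs t = fun j => (((x j).re + t * ((x j).im - d / 2) : ℝ) : ℂ) + I * d / 2 := by
    intro t; ext j
    change p j + t * v j = _
    rw [hp, hv]; push_cast; ring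
  have hden : den c x ≠ 0 := (den_ne x).mpr hs
  have hfreq : ∃ᶠ t : ℝ in nhdsWithin 0 {0}ᶜ, den c (xs t) ≠ 0 := by
    intro hcon
    have h := strip_id (σ := -2) (τ := 2) (by norm_num) (by norm_num) (f := fun ζ => den c (xs ζ))
      (den_diff.comp hxs).differentiableOn (Filter.Eventually.frequently (hcon.mono fun t ht => not_not.mp ht)) I (by rw [I_im]; norm_num) (by simp)
    rw [hxI] at h
    exact hden h
  have hmain := strip_id (σ := -τ) (τ := τ) (by linarith) (by linarith)
    (f := fun ζ => ∑ T ∈ Finset.powersetCard k Finset.univ, numT c b T (xs ζ) * Fb (fun j => xs ζ j - I * d * (if j ∈ T then 1 else 0))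
      - esym c y k * (den c (xs ζ) * Fb (xs ζ))) ?_ ?_ I (by simp; linarith) (by simpa using h1)
  · simp only [hxI] at hmain
    rw [sub_eq_zero] at hmain
    apply mul_right_cancel₀ hden
    rw [Finset.sum_mul]
    calc _ = _ := Finset.sum_congr rfl fun T _ => by
            rw [mul_right_comm, coef_den T x hs]
      _ = _ := hmain
      _ = _ := by ring
  · have hsub : ∀ T : Finset (Fin (n+1)), DifferentiableOn ℂ (fun ζ => Fb (fun j => xs ζ j - I * d * (if j ∈ T then 1 else 0)))
        {z : ℂ | -τ < z.im ∧ z.im < τ} := by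
      intro T
      refine hF.comp (f := fun ζ => (fun j => xs ζ j - I * d * (if j ∈ T then 1 else 0))) ?_ fun ζ hζ j k => ?_
      · refine Differentiable.differentiableOn (differentiable_pi.mpr fun j => ?_)
        exact ((differentiable_pi.mp hxs j).sub_const _)
      · have hh := abs_lt.mp (hdiff ζ hζ.1 hζ.2 j k)
        have : ((xs ζ j - I * d * (if j ∈ T then 1 else 0)) - (xs ζ k - I * d * (if k ∈ T then 1 else 0))).im =
            (xs ζ j - xs ζ k).im - d * ((if j ∈ T then 1 else 0) - (if k ∈ T then 1 else 0)) := by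
          by_cases i1 : j ∈ T <;> by_cases i2 : k ∈ T <;> simp [i1, i2]
          · ring
          · ring
        rw [this, abs_lt]
        by_cases i1 : j ∈ T <;> by_cases i2 : k ∈ T <;> simp only [i1, i2, if_true, if_false] <;> constructor <;> linarith [hh.1, hh.2]
    have h0 : DifferentiableOn ℂ (fun ζ => Fb (xs ζ)) {z : ℂ | -τ < z.im ∧ z.im < τ} := by
      have := hsub ∅
      simpa using this
    refine DifferentiableOn.sub ?_ (DifferentiableOn.const_mul ((den_diff.comp hxs).differentiableOn.mul h0) _)
    refine DifferentiableOn.fun_sum fun T _ => ?_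
    exact ((num_diff T).comp hxs).differentiableOn.mul (hsub T)
  · refine hfreq.mono fun t ht => ?_
    have ht' := (den_ne _).mp ht
    set X : Fin (n+1) → ℝ := fun j => (x j).re + t * ((x j).im - d / 2) with hX
    have hxt : xs t = fun j => (X j : ℂ) + I * d / 2 := hreal t
    have hsX : ∀ m l, xs t m - xs t l = X m - X l := by intro m l; rw [hxt]; ring
    have hinj : Function.Injective X := by
      intro m l hml
      by_contra hne
      apply ht' m l hne
      rw [hsX, hml]; simp
    have heig := hG.eig k X hinj
    have hcoef : ∀ T, coef c b (xs t) T = coef c b (fun j => (X j : ℂ)) T := by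
      intro T; unfold coef; simp only [hsX]
    have e1 : ∀ T : Finset (Fin (n+1)), Fb (fun j => xs t j - I * d * (if j ∈ T then 1 else 0)) =
        G (fun j => X j + I * d / 2 - I * d * (if j ∈ T then 1 else 0)) := by
      intro T
      rw [hxt]
      exact F_eq_Good hG hF hA (xT_tube hc hd hbc X T)
    have e2 : Fb (xs t) = G (fun j => X j + I * d / 2) := by
      have := e1 ∅
      simpa [hxt] using this
    simp only [e1, e2, ← coef_den _ _ ht', hcoef]
    rw [sub_eq_zero]
    calc _ = (∑ T ∈ Finset.powersetCard k Finset.univ, coef c b (fun j => (X j : ℂ)) T *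
            G (fun j => X j + I * d / 2 - I * d * (if j ∈ T then 1 else 0))) * den c (xs t) := by
          rw [Finset.sum_mul]; exact Finset.sum_congr rfl fun T _ => by ring
      _ = _ := by rw [heig]; unfold esym; ring

end final
/-- Prop. 6.2: the holomorphic extension `F` of `J_N(·;·,y)` to `D_N`
satisfies the joint eigenvalue equations of the `2N` commuting Calogero–Moser A∆Os:
for `Re b ∈ (0,a_s)`, `max_{j<k}|Im(x_j−x_k)| < a_s − Re b`, and `(c,d)` running over
`(a₊,a₋), (a₋,a₊)` (i.e. `c = a_δ`, `d = a_{−δ}` for `δ = +,−`), the weighted sum of the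
shifted values `F(b, x − i d χ_I)` over `k`-subsets `I` equals the `k`-th elementary
symmetric function of `exp(2πy_j/c)` times `F(b,x)`. -/
theorem statement16 (ap am : ℝ) (hap : 0 < ap) (ham : 0 < am)
    (N : ℕ) (hN : 2 ≤ N) (y : Fin N → ℝ)
    (F : ℂ × (Fin N → ℂ) → ℂ)
    (hFhol : DifferentiableOn ℂ F (DN ap am N))
    (hFagree : ∀ b : ℂ, 0 < b.re → b.re < ap + am → ∀ x : Fin N → ℝ,
      F (b, fun i => (x i : ℂ)) = Jrec ap am b N x y) :
    ∀ b : ℂ, 0 < b.re → b.re < min ap am →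
    ∀ x : Fin N → ℂ, (∀ j k : Fin N, |(x j - x k).im| < min ap am - b.re) →
    ∀ c d : ℝ, ((c, d) = (ap, am) ∨ (c, d) = (am, ap)) →
    (∀ m n : Fin N, m ≠ n → Complex.sinh ((Real.pi : ℂ) * (x m - x n) / (c : ℂ)) ≠ 0) →
    ∀ k : ℕ, 1 ≤ k → k ≤ N →
      ∑ T ∈ Finset.powersetCard k (Finset.univ : Finset (Fin N)),
        (∏ m ∈ T, ∏ n ∈ Tᶜ,
          Complex.sinh ((Real.pi : ℂ) * (x m - x n - Complex.I * b) / (c : ℂ)) /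
            Complex.sinh ((Real.pi : ℂ) * (x m - x n) / (c : ℂ))) *
          F (b, fun j => x j - Complex.I * (d : ℂ) * (if j ∈ T then 1 else 0))
      = (∑ T ∈ Finset.powersetCard k (Finset.univ : Finset (Fin N)),
          ∏ j ∈ T, Complex.exp (((2 * Real.pi * y j / c : ℝ) : ℂ))) * F (b, x) := by
  intro b hb0 hb x hx c d hcd hs k _ _
  obtain ⟨n, rfl⟩ : ∃ n, N = n + 1 := ⟨N - 1, by omega⟩
  have hba := lt_of_lt_of_le hb (min_le_left ap am)
  have hbm := lt_of_lt_of_le hb (min_le_right ap am)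
  have key : ∀ c d : ℝ, 0 < c → 0 < d → b.re < c → c + d = ap + am → min ap am ≤ c →
      (∀ X : Fin (n+1) → ℝ, Jrec ap am b (n+1) X y = Jrec c d b (n+1) X y) →
      (∀ m l : Fin (n+1), m ≠ l → Complex.sinh ((Real.pi : ℂ) * (x m - x l) / (c : ℂ)) ≠ 0) →
      ∑ T ∈ Finset.powersetCard k Finset.univ, coef c b x T * F (b, fun j => x j - I * d * (if j ∈ T then 1 else 0)) =
        esym c y k * F (b, x) := by
    intro c d hc hd hbc hsum hmin hJ hs
    refine main_eig hc hd hb0 hbc y (fun x => F (b, x)) ?_ ?_ x ?_ hs k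
    · refine hFhol.comp (f := fun x : Fin (n+1) → ℂ => (b, x)) (Differentiable.differentiableOn (by fun_prop)) fun x hx => ?_
      refine ⟨⟨hb0, by linarith⟩, fun j k => ?_⟩
      rw [← hsum]; exact hx j k
    · intro X
      rw [hFagree b hb0 (by linarith), hJ]
    · intro j k
      exact (hx j k).trans_le (by linarith)
  rcases hcd with h | h <;> obtain ⟨rfl, rfl⟩ := Prod.mk.inj h
  · exact key c d hap ham hba rfl (min_le_left _ _) (fun _ => rfl) hs
  · exact key c d ham hap hbm (add_comm _ _) (min_le_right _ _) (fun X => Jrec_symm hap ham b _ X y) hs
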